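/- Let P ∈ ℝ^{n×n} be an ergodic row-stochastic Markov matrix with stationary distribution π, π_max = max_i π_i, π_min = min_i π_i, mixing time function τ(·), and stationary frequency matrix F = diag(π) P. Let X_0, X_1, ..., X_N be a trajectory of the Markov chain with transition matrix P (and arbitrary initial distribution), and define the empirical quantities π̂_0(i) = (1/N) Σ_{t=1}^N 1{X_{t−1} = i} and F̂_0(i,j) = (1/N) Σ_{t=1}^N 1{X_{t−1} = i, X_t = j}. For any ε > 0, setting α = τ(min(ε/2, π_max)) + 1, one has Prob(‖F̂_0 − F‖ ≥ ε) ≤ 2 α n exp(−(N ε^2 / 8)/(2 π_max α + ε α / 6)) and Prob(‖π̂_0 − π‖_∞ ≥ ε) ≤ 2 α n exp(−(N ε^2 / 8)/(2 π_max α + ε α / 6)), where ‖·‖ is the spectral norm and ‖·‖_∞ the entrywise max norm of the vector. -/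

import Mathlib

open scoped BigOperators
open Matrix

noncomputable section

namespace MJ

/-- Euclidean (ℓ2) norm of a finite vector. -/
def l2 {k : ℕ} (v : Fin k → ℝ) : ℝ := Real.sqrt (∑ j, v j ^ 2)

/-- ℓ1 norm of a finite vector. -/
def l1 {k : ℕ} (v : Fin k → ℝ) : ℝ := ∑ i, |v i|

/-- Maximum absolute row sum (matrix ∞-norm). -/
def rowSumNorm {m k : ℕ} (A : Matrix (Fin m) (Fin k) ℝ) : ℝ := ⨆ i, ∑ j, |A i j|

/-- Frobenius norm. -/
def frob {m k : ℕ} (A : Matrix (Fin m) (Fin k) ℝ) : ℝ := Real.sqrt (∑ i, ∑ j, A i j ^ 2)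

/-- Spectral norm (ℓ2 operator norm). -/
def spec {m k : ℕ} (A : Matrix (Fin m) (Fin k) ℝ) : ℝ :=
  sSup {c : ℝ | ∃ x : Fin k → ℝ, l2 x ≤ 1 ∧ c = l2 (A.mulVec x)}

/-- `i`-th largest singular value (1-indexed), via Courant–Fischer max-min. -/
def singVal {m k : ℕ} (A : Matrix (Fin m) (Fin k) ℝ) (i : ℕ) : ℝ :=
  sSup {c : ℝ | ∃ V : Submodule ℝ (Fin k → ℝ), Module.finrank ℝ V = i ∧
    ∀ x ∈ V, c * l2 x ≤ l2 (A.mulVec x)}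

/-- Row-stochastic matrix. -/
def RowStochastic {k : ℕ} (P : Matrix (Fin k) (Fin k) ℝ) : Prop :=
  (∀ i j, 0 ≤ P i j) ∧ ∀ i, ∑ j, P i j = 1

/-- Probability vector. -/
def IsProbVec {k : ℕ} (v : Fin k → ℝ) : Prop := (∀ i, 0 ≤ v i) ∧ ∑ i, v i = 1

/-- Stationary distribution: a probability vector with πᵀ P = πᵀ. -/
def IsStationary {k : ℕ} (P : Matrix (Fin k) (Fin k) ℝ) (piv : Fin k → ℝ) : Prop :=
  IsProbVec piv ∧ ∀ j, ∑ i, piv i * P i j = piv j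

/-- Ergodicity (irreducible + aperiodic ⟺ primitive for finite chains). -/
def Ergodic' {k : ℕ} (P : Matrix (Fin k) (Fin k) ℝ) : Prop :=
  ∃ t : ℕ, ∀ i j, 0 < (P ^ t) i j

/-- ε-mixing time: τ(ε) = min{t : max_i (1/2)‖(P^t)(i,:) − π‖₁ ≤ ε}. -/
def mixingTime {k : ℕ} (P : Matrix (Fin k) (Fin k) ℝ) (piv : Fin k → ℝ) (ε : ℝ) : ℕ :=
  sInf {t : ℕ | ∀ i, (1/2) * ∑ j, |(P ^ t) i j - piv j| ≤ ε}

/-- Full SVD decomposition predicate: A = U S Vᵀ with U, V orthogonal and S diagonal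
with nonnegative entries arranged in descending order. -/
def IsSVD {m k : ℕ} (A : Matrix (Fin m) (Fin k) ℝ) (U : Matrix (Fin m) (Fin m) ℝ)
    (S : Matrix (Fin m) (Fin k) ℝ) (V : Matrix (Fin k) (Fin k) ℝ) : Prop :=
  Uᵀ * U = 1 ∧ Vᵀ * V = 1 ∧ A = U * S * Vᵀ ∧
  (∀ (i : Fin m) (j : Fin k), (i : ℕ) ≠ (j : ℕ) → S i j = 0) ∧
  (∀ i j, 0 ≤ S i j) ∧
  (∀ (a b : ℕ) (ham : a < m) (hak : a < k) (hbm : b < m) (hbk : b < k),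
    a ≤ b → S ⟨b, hbm⟩ ⟨b, hbk⟩ ≤ S ⟨a, ham⟩ ⟨a, hak⟩)

/-- `Ur` consists of the first `r` left singular vectors of `A`. -/
def IsLeftSingTrunc {m k : ℕ} (A : Matrix (Fin m) (Fin k) ℝ) (r : ℕ)
    (Ur : Matrix (Fin m) (Fin r) ℝ) : Prop :=
  ∃ U S V, IsSVD A U S V ∧ ∃ h : r ≤ m, ∀ (i : Fin m) (j : Fin r),
    Ur i j = U i ⟨(j : ℕ), lt_of_lt_of_le j.isLt h⟩

/-- `Vr` consists of the first `r` right singular vectors of `A`. -/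
def IsRightSingTrunc {m k : ℕ} (A : Matrix (Fin m) (Fin k) ℝ) (r : ℕ)
    (Vr : Matrix (Fin k) (Fin r) ℝ) : Prop :=
  IsLeftSingTrunc Aᵀ r Vr

/-- The matrix (I − EEᵀ)(FFᵀ), whose spectral/Frobenius norm is the sinΘ distance
between the column spaces of `E` and `F` (for `E`, `F` with orthonormal columns). -/
def sinThetaMat {k r : ℕ} (E F : Matrix (Fin k) (Fin r) ℝ) : Matrix (Fin k) (Fin k) ℝ :=
  (1 - E * Eᵀ) * (F * Fᵀ)

/-- Membership matrix: each row has exactly one entry 1 and all others 0. -/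
def IsMembership {k r : ℕ} (M : Matrix (Fin k) (Fin r) ℝ) : Prop :=
  ∀ i, ∃ j, M i j = 1 ∧ ∀ j', j' ≠ j → M i j' = 0

/-- A family of finsets forming a partition of `Fin k`. -/
def IsPartition {k r : ℕ} (Ω : Fin r → Finset (Fin k)) : Prop :=
  (∀ a b, a ≠ b → Disjoint (Ω a) (Ω b)) ∧ Finset.univ.biUnion Ω = Finset.univ

/-- `P` is aggregatable w.r.t. partition `Ω`: rows within the same cluster coincide. -/
def Aggregatable {k r : ℕ} (P : Matrix (Fin k) (Fin k) ℝ) (Ω : Fin r → Finset (Fin k)) : Prop :=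
  ∀ s, ∀ i ∈ Ω s, ∀ j ∈ Ω s, ∀ c, P i c = P j c

/-- Misclustering rate: min over bijections of the relative misclustering counts. -/
def MR {k r : ℕ} (Ω Ωh : Fin r → Finset (Fin k)) : ℝ :=
  ⨅ σ : Equiv.Perm (Fin r), ∑ j, (((Ω j) \ (Ωh (σ j))).card : ℝ) / ((Ω j).card : ℝ)

/-- k-means objective on the rows of `U`. -/
def kmeansObj {k r : ℕ} (U : Matrix (Fin k) (Fin r) ℝ) (Ωh : Fin r → Finset (Fin k))
    (c : Fin r → Fin r → ℝ) : ℝ :=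
  ∑ s, ∑ i ∈ Ωh s, ∑ j, (U i j - c s j) ^ 2

/-- Optimal value of the k-means problem on the rows of `U`. -/
def kmeansOpt {k r : ℕ} (U : Matrix (Fin k) (Fin r) ℝ) : ℝ :=
  sInf {v : ℝ | ∃ Ωh c, IsPartition Ωh ∧ v = kmeansObj U Ωh c}

/-- A (1+ε) approximate solution of the k-means problem on the rows of `U`. -/
def IsApproxKMeans {k r : ℕ} (U : Matrix (Fin k) (Fin r) ℝ) (ε : ℝ)
    (Ωh : Fin r → Finset (Fin k)) (c : Fin r → Fin r → ℝ) : Prop :=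
  IsPartition Ωh ∧ kmeansObj U Ωh c ≤ (1 + ε) * kmeansOpt U

/-- Optimal value of the k-means problem in membership-matrix form. -/
def kmeansOptM {k r : ℕ} (U : Matrix (Fin k) (Fin r) ℝ) : ℝ :=
  sInf {v : ℝ | ∃ (M : Matrix (Fin k) (Fin r) ℝ) (C : Matrix (Fin r) (Fin r) ℝ),
    IsMembership M ∧ v = frob (M * C - U) ^ 2}

/-- Number of t ∈ {1,…,N} with x_{t−1} = i. -/
def countState {k N : ℕ} (x : Fin (N+1) → Fin k) (i : Fin k) : ℕ :=
  (Finset.univ.filter fun t : Fin N => x t.castSucc = i).card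

/-- Number of t ∈ {1,…,N} with x_{t−1} = i and x_t = j. -/
def countTrans {k N : ℕ} (x : Fin (N+1) → Fin k) (i j : Fin k) : ℕ :=
  (Finset.univ.filter fun t : Fin N => x t.castSucc = i ∧ x t.succ = j).card

/-- Empirical state distribution. -/
def empPi {k N : ℕ} (x : Fin (N+1) → Fin k) (i : Fin k) : ℝ :=
  (countState x i : ℝ) / (N : ℝ)

/-- Empirical frequency matrix. -/
def empF {k N : ℕ} (x : Fin (N+1) → Fin k) : Matrix (Fin k) (Fin k) ℝ :=
  Matrix.of fun i j => (countTrans x i j : ℝ) / (N : ℝ)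

/-- Empirical transition matrix (uniform row if a state never occurs). -/
def empMatrix {k N : ℕ} (x : Fin (N+1) → Fin k) : Matrix (Fin k) (Fin k) ℝ :=
  Matrix.of fun i j =>
    if countState x i = 0 then 1 / (k : ℝ)
    else (countTrans x i j : ℝ) / (countState x i : ℝ)

/-- Probability weight of a finite Markov-chain path with initial distribution `pi0`. -/
def pathWeight {k : ℕ} (N : ℕ) (P : Matrix (Fin k) (Fin k) ℝ) (pi0 : Fin k → ℝ)
    (x : Fin (N+1) → Fin k) : ℝ :=
  pi0 (x 0) * ∏ t : Fin N, P (x t.castSucc) (x t.succ)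

/-- Probability of an event over Markov-chain trajectories of length N+1. -/
def pathProb {k : ℕ} (N : ℕ) (P : Matrix (Fin k) (Fin k) ℝ) (pi0 : Fin k → ℝ)
    (E : Set ((Fin (N+1)) → Fin k)) : ℝ :=
  ∑ x : Fin (N+1) → Fin k, E.indicator (pathWeight N P pi0) x

end MJ

section PartA
open scoped BigOperators
open Matrix

namespace MJ
lemma gt_ortho_sum {ι : Type*} [Fintype ι] [DecidableEq ι] (P Q : Matrix ι ι ℝ)
    (hQ : Q * Qᵀ = 1) (x y : ι → ℝ) (i : ι) :
    ∑ j, (∑ k, P k i * x k * Q k j) * (∑ k, P k i * y k * Q k j) = ∑ k, P k i ^ 2 * (x k * y k) := by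
  have h : ∀ k l, ∑ j, Q k j * Q l j = if k = l then 1 else 0 := by
    intro k l
    have := congrFun (congrFun hQ k) l
    simpa [Matrix.mul_apply, Matrix.one_apply] using this
  calc ∑ j, (∑ k, P k i * x k * Q k j) * (∑ k, P k i * y k * Q k j)
      = ∑ j, ∑ k, ∑ l, (P k i * x k * (P l i * y l)) * (Q k j * Q l j) := by
        refine Finset.sum_congr rfl fun j _ => ?_
        rw [Finset.sum_mul_sum]
        refine Finset.sum_congr rfl fun k _ => Finset.sum_congr rfl fun l _ => ?_
        ring
    _ = ∑ k, ∑ l, (P k i * x k * (P l i * y l)) * ∑ j, (Q k j * Q l j) := by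
        rw [Finset.sum_comm]
        refine Finset.sum_congr rfl fun k _ => ?_
        rw [Finset.sum_comm]
        refine Finset.sum_congr rfl fun l _ => ?_
        rw [Finset.mul_sum]
    _ = _ := by
        refine Finset.sum_congr rfl fun k _ => ?_
        simp [h]
        ring

/-- Golden-Thompson in Gibbs variational form. -/
lemma gt_gibbs {ι : Type*} [Fintype ι] [DecidableEq ι] (P Q : Matrix ι ι ℝ)
    (hP : P * Pᵀ = 1) (hQ : Q * Qᵀ = 1) (t a b : ι → ℝ)
    (ht : ∀ i, 0 < t i) (ha : ∀ i, 0 < a i) (hb : ∀ i, 0 < b i) :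
    ∑ i, ∑ j, (∑ k, P k i * Q k j) ^ 2 * (t i * Real.log (a j))
      + ∑ k, (∑ i, t i * P k i ^ 2) * Real.log (b k) + ∑ i, t i
      ≤ ∑ i, t i * Real.log (t i) + ∑ k, (∑ j, a j * Q k j ^ 2) * b k := by
  set O : ι → ι → ℝ := fun i j => ∑ k, P k i * Q k j with hO
  set tk : ι → ℝ := fun k => ∑ i, t i * P k i ^ 2 with htk
  set ak : ι → ℝ := fun k => ∑ j, a j * Q k j ^ 2 with hak
  let F : ℝ → ℝ := fun s => ∑ i, ∑ j, O i j ^ 2 *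
      (t i * Real.log (a j + s * (t i - a j)) - (a j + s * (t i - a j)))
  let G : ℝ → ℝ := fun s => ∑ k, (tk k * (Real.log (1 + s * (b k - 1)) +
      s * (1 - s) * (b k - 1) / (1 + s * (b k - 1)))
      - ak k * (s * (b k ^ 2 / (1 + s * (b k - 1))) - s))
  have hm : ∀ s ∈ Set.Icc (0:ℝ) 1, ∀ i j, 0 < a j + s * (t i - a j) := by
    intro s hs i j
    rcases eq_or_lt_of_le hs.1 with h | h
    · rw [← h]; simpa using ha j
    · nlinarith [mul_pos h (ht i), mul_nonneg (sub_nonneg.2 hs.2) (ha j).le]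
  have hy : ∀ s ∈ Set.Icc (0:ℝ) 1, ∀ k, 0 < 1 + s * (b k - 1) := by
    intro s hs k
    rcases eq_or_lt_of_le hs.1 with h | h
    · rw [← h]; simp
    · nlinarith [mul_pos h (hb k), hs.2]
  -- derivatives
  have hF : ∀ s ∈ Set.Icc (0:ℝ) 1, HasDerivAt F
      (∑ i, ∑ j, O i j ^ 2 * ((1 - s) * (t i - a j) ^ 2 / (a j + s * (t i - a j)))) s := by
    intro s hs
    refine HasDerivAt.fun_sum fun i _ => HasDerivAt.fun_sum fun j _ => ?_
    have h0 := (hm s hs i j).ne'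
    have h1 : HasDerivAt (fun s : ℝ => a j + s * (t i - a j)) (t i - a j) s := by
      simpa using ((hasDerivAt_id s).mul_const (t i - a j)).const_add (a j)
    have := (((h1.log h0).const_mul (t i)).sub h1).const_mul (O i j ^ 2)
    refine HasDerivAt.congr_deriv this ?_
    generalize hz : a j + s * (t i - a j) = z at h0
    field_simp
    rw [← hz]
    ring
  have hG : ∀ s ∈ Set.Icc (0:ℝ) 1, HasDerivAt G
      (∑ k, (tk k * ((1 - s) * (2 * ((b k - 1) / (1 + s * (b k - 1)))
          - s * ((b k - 1) / (1 + s * (b k - 1))) ^ 2))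
        - ak k * ((1 - s) * (2 * ((b k - 1) / (1 + s * (b k - 1)))
          + (1 - s) * ((b k - 1) / (1 + s * (b k - 1))) ^ 2)))) s := by
    intro s hs
    refine HasDerivAt.fun_sum fun k _ => ?_
    have h0 := (hy s hs k).ne'
    have h1 : HasDerivAt (fun s : ℝ => 1 + s * (b k - 1)) (b k - 1) s := by
      simpa using ((hasDerivAt_id s).mul_const (b k - 1)).const_add 1
    have h2 : HasDerivAt (fun s : ℝ => s * (1 - s) * (b k - 1)) ((1 - 2 * s) * (b k - 1)) s := by
      have := (((hasDerivAt_id s).mul ((hasDerivAt_id s).const_sub 1)).mul_const (b k - 1))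
      refine HasDerivAt.congr_deriv this ?_
      simp only [id, Pi.mul_apply]; ring
    have h3 : HasDerivAt (fun s : ℝ => s * (b k ^ 2 / (1 + s * (b k - 1))) - s)
        (b k ^ 2 / (1 + s * (b k - 1)) - s * (b k ^ 2 * (b k - 1) / (1 + s * (b k - 1)) ^ 2) - 1) s := by
      have := ((hasDerivAt_id s).mul ((hasDerivAt_const s (b k ^ 2)).div h1 h0)).sub (hasDerivAt_id s)
      refine HasDerivAt.congr_deriv this ?_
      simp only [id]
      generalize hz : 1 + s * (b k - 1) = z at h0
      simp only [Pi.div_apply, hz]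
      field_simp
      ring
    have := (((h1.log h0).add (h2.div h1 h0)).const_mul (tk k)).sub (h3.const_mul (ak k))
    refine HasDerivAt.congr_deriv this ?_
    generalize hz : 1 + s * (b k - 1) = z at h0
    field_simp
    rw [← hz]
    ring
  have hmono : MonotoneOn (fun s => F s - G s) (Set.Icc 0 1) := by
    apply monotoneOn_of_deriv_nonneg (convex_Icc 0 1)
    · intro s hs
      exact ((hF s hs).sub (hG s hs)).continuousAt.continuousWithinAt
    · intro s hs
      exact ((hF s (interior_subset hs)).sub (hG s (interior_subset hs))).differentiableAt.differentiableWithinAt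
    · intro s hs
      have hs' := interior_subset hs
      have hd : deriv (fun s => F s - G s) s = _ := ((hF s hs').sub (hG s hs')).deriv
      rw [hd, sub_nonneg]
      set x : ι → ℝ := fun k => (b k - 1) / (1 + s * (b k - 1)) with hx
      let X : ι → ι → ℝ := fun i j => ∑ k, P k i * x k * Q k j
      have e1 : ∀ i, ∑ j, O i j * X i j = ∑ k, P k i ^ 2 * x k := by
        intro i
        have := gt_ortho_sum P Q hQ (fun _ => 1) x i
        simpa [hO, X] using this
      have e2 : ∀ j, ∑ i, O i j * X i j = ∑ k, Q k j ^ 2 * x k := by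
        intro j
        have := gt_ortho_sum Q P hP (fun _ => 1) x j
        simp only [mul_one, one_mul] at this
        rw [← this]
        refine Finset.sum_congr rfl fun i _ => ?_
        simp only [hO, X]
        congr 1
        · exact Finset.sum_congr rfl fun k _ => by ring
        · exact Finset.sum_congr rfl fun k _ => by ring
      have e3 : ∀ i, ∑ j, X i j * X i j = ∑ k, P k i ^ 2 * (x k * x k) := by
        intro i
        exact gt_ortho_sum P Q hQ x x i
      have e4 : ∀ j, ∑ i, X i j * X i j = ∑ k, Q k j ^ 2 * (x k * x k) := by
        intro j
        rw [← gt_ortho_sum Q P hP x x j]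
        refine Finset.sum_congr rfl fun i _ => ?_
        simp only [X]
        congr 1
        · exact Finset.sum_congr rfl fun k _ => by ring
        · exact Finset.sum_congr rfl fun k _ => by ring
      have e5 : ∑ i, ∑ j, (1 - s) * (2 * (t i - a j) * (O i j * X i j) - (a j + s * (t i - a j)) * (X i j * X i j))
          = ∑ k, (tk k * ((1 - s) * (2 * x k - s * x k ^ 2)) - ak k * ((1 - s) * (2 * x k + (1 - s) * x k ^ 2))) := by
        have q1 : ∑ i, ∑ j, t i * (O i j * X i j) = ∑ k, tk k * x k := by
          simp_rw [← Finset.mul_sum, e1, htk, Finset.sum_mul, Finset.mul_sum]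
          rw [Finset.sum_comm]
          exact Finset.sum_congr rfl fun _ _ => Finset.sum_congr rfl fun _ _ => by ring
        have q2 : ∑ i, ∑ j, a j * (O i j * X i j) = ∑ k, ak k * x k := by
          rw [Finset.sum_comm]
          simp_rw [← Finset.mul_sum, e2, hak, Finset.sum_mul, Finset.mul_sum]
          rw [Finset.sum_comm]
          exact Finset.sum_congr rfl fun _ _ => Finset.sum_congr rfl fun _ _ => by ring
        have q3 : ∑ i, ∑ j, t i * (X i j * X i j) = ∑ k, tk k * x k ^ 2 := by
          simp_rw [← Finset.mul_sum, e3, htk, Finset.sum_mul, Finset.mul_sum]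
          rw [Finset.sum_comm]
          exact Finset.sum_congr rfl fun _ _ => Finset.sum_congr rfl fun _ _ => by ring
        have q4 : ∑ i, ∑ j, a j * (X i j * X i j) = ∑ k, ak k * x k ^ 2 := by
          rw [Finset.sum_comm]
          simp_rw [← Finset.mul_sum, e4, hak, Finset.sum_mul, Finset.mul_sum]
          rw [Finset.sum_comm]
          exact Finset.sum_congr rfl fun _ _ => Finset.sum_congr rfl fun _ _ => by ring
        have l1 : ∑ i, ∑ j, (1 - s) * (2 * (t i - a j) * (O i j * X i j) - (a j + s * (t i - a j)) * (X i j * X i j))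
           = (1 - s) * (2 * (∑ i, ∑ j, t i * (O i j * X i j)) - 2 * (∑ i, ∑ j, a j * (O i j * X i j))
             - s * (∑ i, ∑ j, t i * (X i j * X i j)) - (1 - s) * (∑ i, ∑ j, a j * (X i j * X i j))) := by
          simp only [Finset.mul_sum, ← Finset.sum_sub_distrib]
          exact Finset.sum_congr rfl fun _ _ => Finset.sum_congr rfl fun _ _ => by ring
        rw [l1, q1, q2, q3, q4]
        simp only [Finset.mul_sum, ← Finset.sum_sub_distrib]
        exact Finset.sum_congr rfl fun _ _ => by ring
      rw [← e5]
      refine Finset.sum_le_sum fun i _ => Finset.sum_le_sum fun j _ => ?_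
      have h0 := hm s hs' i j
      have h1 : 0 ≤ 1 - s := sub_nonneg.2 hs'.2
      have : O i j ^ 2 * ((1 - s) * (t i - a j) ^ 2 / (a j + s * (t i - a j))) -
         (1 - s) * (2 * (t i - a j) * (O i j * X i j) - (a j + s * (t i - a j)) * (X i j * X i j))
         = (1 - s) * (((t i - a j) * O i j - (a j + s * (t i - a j)) * X i j) ^ 2 / (a j + s * (t i - a j))) := by
        generalize hz : a j + s * (t i - a j) = z at h0
        field_simp
        ring
      have h2 : 0 ≤ (1 - s) * (((t i - a j) * O i j - (a j + s * (t i - a j)) * X i j) ^ 2 / (a j + s * (t i - a j))) := by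
        positivity
      linarith
  have h01 := hmono (Set.left_mem_Icc.2 zero_le_one) (Set.right_mem_Icc.2 zero_le_one) zero_le_one
  have rowsum : ∀ i, ∑ j, O i j ^ 2 = 1 := by
    intro i
    have := gt_ortho_sum P Q hQ (fun _ => 1) (fun _ => 1) i
    have hP' : Pᵀ * P = 1 := mul_eq_one_comm.1 hP
    have h2 := congrFun (congrFun hP' i) i
    simp [Matrix.mul_apply] at h2
    simp at this
    simp only [hO, sq, this, h2]
  have colsum : ∀ k, ∑ j, Q j k ^ 2 = 1 := by
    intro i
    have hP' : Qᵀ * Q = 1 := mul_eq_one_comm.1 hQ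
    have h2 := congrFun (congrFun hP' i) i
    simp [Matrix.mul_apply] at h2
    simp only [sq, h2]
  have colO : ∀ j, ∑ i, O i j ^ 2 = 1 := by
    intro j
    have := gt_ortho_sum Q P hP (fun _ => 1) (fun _ => 1) j
    simp only [mul_one] at this
    rw [colsum j] at this
    rw [← this]
    refine Finset.sum_congr rfl fun i _ => ?_
    simp only [hO, sq]
    congr 1 <;> exact Finset.sum_congr rfl fun k _ => by ring
  have F0 : F 0 = ∑ i, ∑ j, O i j ^ 2 * (t i * Real.log (a j)) - ∑ j, a j := by
    have h1 : ∑ j, a j = ∑ i, ∑ j, O i j ^ 2 * a j := by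
      rw [Finset.sum_comm]
      refine Finset.sum_congr rfl fun j _ => ?_
      rw [← Finset.sum_mul, colO]; ring
    rw [h1, ← Finset.sum_sub_distrib]
    refine Finset.sum_congr rfl fun i _ => ?_
    rw [← Finset.sum_sub_distrib]
    refine Finset.sum_congr rfl fun j _ => ?_
    rw [zero_mul, add_zero]; ring
  have F1 : F 1 = ∑ i, t i * Real.log (t i) - ∑ i, t i := by
    simp only [F, one_mul, add_sub_cancel]
    simp_rw [← Finset.sum_mul, rowsum, one_mul, Finset.sum_sub_distrib]
  have G0 : G 0 = 0 := by simp [G]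
  have G1 : G 1 = ∑ k, tk k * Real.log (b k) - ∑ k, ak k * b k + ∑ k, ak k := by
    simp only [G]
    rw [← Finset.sum_sub_distrib, ← Finset.sum_add_distrib]
    refine Finset.sum_congr rfl fun k _ => ?_
    have := (hb k).ne'
    simp
    field_simp
    ring
  have hs : ∑ k, ak k = ∑ j, a j := by
    simp only [hak]
    rw [Finset.sum_comm]
    simp_rw [← Finset.mul_sum, colsum, mul_one]
  simp only [F0, F1, G0, G1, hs] at h01
  linarith
end MJ
end PartA

section PartB
open scoped BigOperators
open Matrix

namespace MJ
variable {ι : Type*} [Fintype ι] [DecidableEq ι]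

lemma tr_conj (U V : Matrix ι ι ℝ) (x y : ι → ℝ) :
    trace ((U * diagonal x * Uᵀ) * (V * diagonal y * Vᵀ))
      = ∑ i, ∑ j, x i * y j * ((Uᵀ * V) i j) ^ 2 := by
  have h : trace ((U * diagonal x * Uᵀ) * (V * diagonal y * Vᵀ))
      = trace ((diagonal x * (Uᵀ * V)) * (diagonal y * (Uᵀ * V)ᵀ)) := by
    rw [Matrix.transpose_mul, Matrix.transpose_transpose]
    rw [show (U * diagonal x * Uᵀ) * (V * diagonal y * Vᵀ) = U * (diagonal x * Uᵀ * V * diagonal y * Vᵀ) by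
      simp only [Matrix.mul_assoc]]
    rw [Matrix.trace_mul_comm]
    simp only [Matrix.mul_assoc]
  rw [h]
  simp only [trace, diag_apply, Matrix.mul_apply (M := diagonal x * (Uᵀ * V)), diagonal_mul, transpose_apply]
  exact Finset.sum_congr rfl fun _ _ => Finset.sum_congr rfl fun _ _ => by ring

lemma gt_matrix (U V W : Matrix ι ι ℝ) (hU : Uᵀ * U = 1) (hV : Vᵀ * V = 1) (hW : Wᵀ * W = 1)
    (t a b : ι → ℝ) (ht : ∀ i, 0 < t i) (ha : ∀ i, 0 < a i) (hb : ∀ i, 0 < b i) :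
    trace ((U * diagonal t * Uᵀ) * (V * diagonal (fun i => Real.log (a i)) * Vᵀ))
     + trace ((U * diagonal t * Uᵀ) * (W * diagonal (fun i => Real.log (b i)) * Wᵀ)) + ∑ i, t i
    ≤ ∑ i, t i * Real.log (t i) + trace ((V * diagonal a * Vᵀ) * (W * diagonal b * Wᵀ)) := by
  have hW' : W * Wᵀ = 1 := mul_eq_one_comm.1 hW
  have hU' : U * Uᵀ = 1 := mul_eq_one_comm.1 hU
  have hV' : V * Vᵀ = 1 := mul_eq_one_comm.1 hV
  have hP : (Wᵀ * U) * (Wᵀ * U)ᵀ = 1 := by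
    rw [transpose_mul, transpose_transpose, Matrix.mul_assoc, ← Matrix.mul_assoc U, hU', Matrix.one_mul, hW]
  have hQ : (Wᵀ * V) * (Wᵀ * V)ᵀ = 1 := by
    rw [transpose_mul, transpose_transpose, Matrix.mul_assoc, ← Matrix.mul_assoc V, hV', Matrix.one_mul, hW]
  have key := gt_gibbs (Wᵀ * U) (Wᵀ * V) hP hQ t a b ht ha hb
  have hO : ∀ i j, ∑ k, (Wᵀ * U) k i * (Wᵀ * V) k j = (Uᵀ * V) i j := by
    intro i j
    have : (Uᵀ * V) = (Wᵀ * U)ᵀ * (Wᵀ * V) := by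
      rw [transpose_mul, transpose_transpose, Matrix.mul_assoc, ← Matrix.mul_assoc W, hW', Matrix.one_mul]
    rw [this, Matrix.mul_apply]
    rfl
  simp_rw [hO] at key
  rw [tr_conj, tr_conj, tr_conj]
  have sw : ∀ (X : Matrix ι ι ℝ) (i k : ι), (Xᵀ * W) i k = (Wᵀ * X) k i := by
    intro X i k
    rw [show Xᵀ * W = (Wᵀ * X)ᵀ by rw [transpose_mul, transpose_transpose]]
    rfl
  have e1 : ∑ i, ∑ j, t i * Real.log (a j) * ((Uᵀ * V) i j) ^ 2
      = ∑ i, ∑ j, (Uᵀ * V) i j ^ 2 * (t i * Real.log (a j)) :=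
    Finset.sum_congr rfl fun _ _ => Finset.sum_congr rfl fun _ _ => by ring
  have e2 : ∑ i, ∑ j, t i * Real.log (b j) * ((Uᵀ * W) i j) ^ 2
      = ∑ k, (∑ i, t i * (Wᵀ * U) k i ^ 2) * Real.log (b k) := by
    rw [Finset.sum_comm]
    refine Finset.sum_congr rfl fun _ _ => ?_
    rw [Finset.sum_mul]
    refine Finset.sum_congr rfl fun _ _ => ?_
    rw [sw]; ring
  have e3 : ∑ i, ∑ j, a i * b j * ((Vᵀ * W) i j) ^ 2
      = ∑ k, (∑ i, a i * (Wᵀ * V) k i ^ 2) * b k := by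
    rw [Finset.sum_comm]
    refine Finset.sum_congr rfl fun _ _ => ?_
    rw [Finset.sum_mul]
    refine Finset.sum_congr rfl fun _ _ => ?_
    rw [sw]; ring
  rw [e1, e2, e3]
  exact key

lemma spectral (H : Matrix ι ι ℝ) (hH : Hᵀ = H) :
    ∃ (V : Matrix ι ι ℝ) (h : ι → ℝ), Vᵀ * V = 1 ∧ H = V * diagonal h * Vᵀ := by
  have hh : H.IsHermitian := by
    rw [Matrix.IsHermitian, conjTranspose_eq_transpose_of_trivial, hH]
  refine ⟨(hh.eigenvectorUnitary : Matrix ι ι ℝ), hh.eigenvalues, ?_, ?_⟩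
  · have := (Matrix.mem_unitaryGroup_iff').1 (hh.eigenvectorUnitary).2
    rwa [star_eq_conjTranspose, conjTranspose_eq_transpose_of_trivial] at this
  · have := hh.spectral_theorem
    rw [Unitary.conjStarAlgAut_apply] at this
    rw [star_eq_conjTranspose, conjTranspose_eq_transpose_of_trivial] at this
    exact this

def Phi (H : Matrix ι ι ℝ) : ℝ :=
  sSup {y | ∃ U : Matrix ι ι ℝ, Uᵀ * U = 1 ∧ y = ∑ i, Real.exp ((Uᵀ * H * U) i i)}

lemma form_eq (U H : Matrix ι ι ℝ) (i : ι) :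
    (Uᵀ * H * U) i i = (fun k => U k i) ⬝ᵥ (H *ᵥ (fun k => U k i)) := by
  rw [Matrix.mul_assoc, Matrix.mul_apply]
  rfl

lemma ortho_col (U : Matrix ι ι ℝ) (hU : Uᵀ * U = 1) (i : ι) :
    (fun k => U k i) ⬝ᵥ (fun k => U k i) = 1 := by
  have := congrFun (congrFun hU i) i
  rw [Matrix.mul_apply, one_apply_eq] at this
  exact this

lemma form_le_abs (H : Matrix ι ι ℝ) (u : ι → ℝ) (hu : u ⬝ᵥ u = 1) :
    u ⬝ᵥ (H *ᵥ u) ≤ ∑ k, ∑ l, |H k l| := by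
  have h1 : ∀ k, |u k| ≤ 1 := by
    intro k
    have : u k * u k ≤ 1 := by
      rw [← hu]
      exact Finset.single_le_sum (f := fun k => u k * u k) (fun i _ => mul_self_nonneg _) (Finset.mem_univ k)
    exact abs_le_one_iff_mul_self_le_one.2 this
  simp only [dotProduct, mulVec, Finset.mul_sum]
  refine Finset.sum_le_sum fun k _ => Finset.sum_le_sum fun l _ => ?_
  calc u k * (H k l * u l) ≤ |u k * (H k l * u l)| := le_abs_self _
    _ = |u k| * |H k l| * |u l| := by rw [abs_mul, abs_mul]; ring
    _ ≤ 1 * |H k l| * 1 := by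
      gcongr
      · exact h1 k
      · exact h1 l
    _ = _ := by ring

lemma Phi_bdd (H : Matrix ι ι ℝ) :
    BddAbove {y | ∃ U : Matrix ι ι ℝ, Uᵀ * U = 1 ∧ y = ∑ i, Real.exp ((Uᵀ * H * U) i i)} := by
  refine ⟨∑ _i : ι, Real.exp (∑ k, ∑ l, |H k l|), ?_⟩
  rintro y ⟨U, hU, rfl⟩
  refine Finset.sum_le_sum fun i _ => ?_
  rw [form_eq]
  exact Real.exp_le_exp.2 (form_le_abs H _ (ortho_col U hU i))

lemma le_Phi (H U : Matrix ι ι ℝ) (hU : Uᵀ * U = 1) :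
    ∑ i, Real.exp ((Uᵀ * H * U) i i) ≤ Phi H := le_csSup (Phi_bdd H) ⟨U, hU, rfl⟩

lemma Phi_le (H : Matrix ι ι ℝ) (c : ℝ)
    (h : ∀ U : Matrix ι ι ℝ, Uᵀ * U = 1 → ∑ i, Real.exp ((Uᵀ * H * U) i i) ≤ c) : Phi H ≤ c := by
  refine csSup_le ⟨_, 1, by simp, rfl⟩ ?_
  rintro y ⟨U, hU, rfl⟩
  exact h U hU

lemma Phi_nonneg (H : Matrix ι ι ℝ) : 0 ≤ Phi H :=
  le_trans (Finset.sum_nonneg fun _ _ => (Real.exp_pos _).le) (le_Phi H 1 (by simp))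

lemma Phi_zero : Phi (0 : Matrix ι ι ℝ) ≤ Fintype.card ι := by
  refine Phi_le _ _ fun U _ => ?_
  simp

lemma Phi_convex {κ : Type*} [Fintype κ] (w : κ → ℝ) (hw : ∀ k, 0 ≤ w k) (hw1 : ∑ k, w k = 1)
    (H : κ → Matrix ι ι ℝ) : Phi (∑ k, w k • H k) ≤ ∑ k, w k * Phi (H k) := by
  refine Phi_le _ _ fun U hU => ?_
  have h1 : ∀ i, Real.exp ((Uᵀ * (∑ k, w k • H k) * U) i i) ≤ ∑ k, w k * Real.exp ((Uᵀ * H k * U) i i) := by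
    intro i
    have : (Uᵀ * (∑ k, w k • H k) * U) i i = ∑ k, w k • (Uᵀ * H k * U) i i := by
      rw [Matrix.mul_sum, Matrix.sum_mul, Matrix.sum_apply]
      refine Finset.sum_congr rfl fun k _ => ?_
      rw [Matrix.mul_smul, Matrix.smul_mul, Matrix.smul_apply]
    rw [this]
    have := convexOn_exp.map_sum_le (t := Finset.univ) (w := w) (p := fun k => (Uᵀ * H k * U) i i)
      (fun k _ => hw k) hw1 (fun k _ => Set.mem_univ _)
    simpa using this
  calc ∑ i, Real.exp ((Uᵀ * (∑ k, w k • H k) * U) i i)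
      ≤ ∑ i, ∑ k, w k * Real.exp ((Uᵀ * H k * U) i i) := Finset.sum_le_sum fun i _ => h1 i
    _ = ∑ k, w k * ∑ i, Real.exp ((Uᵀ * H k * U) i i) := by
      rw [Finset.sum_comm]; simp_rw [Finset.mul_sum]
    _ ≤ _ := Finset.sum_le_sum fun k _ => mul_le_mul_of_nonneg_left (le_Phi _ U hU) (hw k)

lemma Phi_shift (H M : Matrix ι ι ℝ) (c : ℝ) (hM : ∀ x : ι → ℝ, x ⬝ᵥ (M *ᵥ x) ≤ c * (x ⬝ᵥ x)) :
    Phi (H + M) ≤ Real.exp c * Phi H := by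
  refine Phi_le _ _ fun U hU => ?_
  calc ∑ i, Real.exp ((Uᵀ * (H + M) * U) i i) ≤ ∑ i, Real.exp c * Real.exp ((Uᵀ * H * U) i i) := by
        refine Finset.sum_le_sum fun i _ => ?_
        rw [← Real.exp_add, Real.exp_le_exp, Matrix.mul_add, Matrix.add_mul, Matrix.add_apply,
          form_eq U M]
        have := hM (fun k => U k i)
        rw [ortho_col U hU] at this
        linarith
    _ = Real.exp c * ∑ i, Real.exp ((Uᵀ * H * U) i i) := by rw [Finset.mul_sum]
    _ ≤ _ := mul_le_mul_of_nonneg_left (le_Phi _ U hU) (Real.exp_pos _).le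

lemma conj_diag_apply (V U : Matrix ι ι ℝ) (h : ι → ℝ) (i : ι) :
    (Uᵀ * (V * diagonal h * Vᵀ) * U) i i = ∑ k, ((Vᵀ * U) k i) ^ 2 * h k := by
  have : Uᵀ * (V * diagonal h * Vᵀ) * U = (Vᵀ * U)ᵀ * (diagonal h * (Vᵀ * U)) := by
    rw [transpose_mul, transpose_transpose]; simp only [Matrix.mul_assoc]
  rw [this, Matrix.mul_apply]
  refine Finset.sum_congr rfl fun k _ => ?_
  rw [diagonal_mul, transpose_apply]; ring

lemma ortho_mul {V U : Matrix ι ι ℝ} (hV : Vᵀ * V = 1) (hU : Uᵀ * U = 1) :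
    (Vᵀ * U)ᵀ * (Vᵀ * U) = 1 := by
  have hV' : V * Vᵀ = 1 := mul_eq_one_comm.1 hV
  rw [transpose_mul, transpose_transpose, Matrix.mul_assoc, ← Matrix.mul_assoc V, hV', Matrix.one_mul, hU]

lemma ortho_colsq {O : Matrix ι ι ℝ} (hO : Oᵀ * O = 1) (i : ι) : ∑ k, O k i ^ 2 = 1 := by
  have := ortho_col O hO i
  simpa [dotProduct, sq] using this

lemma ortho_rowsq {O : Matrix ι ι ℝ} (hO : Oᵀ * O = 1) (k : ι) : ∑ i, O k i ^ 2 = 1 := by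
  have h : (Oᵀ)ᵀ * Oᵀ = 1 := by rw [transpose_transpose]; exact mul_eq_one_comm.1 hO
  exact ortho_colsq h k

lemma peierls (V : Matrix ι ι ℝ) (hV : Vᵀ * V = 1) (h : ι → ℝ) :
    Phi (V * diagonal h * Vᵀ) ≤ ∑ k, Real.exp (h k) := by
  refine Phi_le _ _ fun U hU => ?_
  have hO := ortho_mul hV hU
  calc ∑ i, Real.exp ((Uᵀ * (V * diagonal h * Vᵀ) * U) i i)
      ≤ ∑ i, ∑ k, ((Vᵀ * U) k i) ^ 2 * Real.exp (h k) := by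
        refine Finset.sum_le_sum fun i _ => ?_
        rw [conj_diag_apply]
        have := convexOn_exp.map_sum_le (t := Finset.univ) (w := fun k => ((Vᵀ * U) k i) ^ 2) (p := h)
          (fun k _ => sq_nonneg _) (ortho_colsq hO i) (fun k _ => Set.mem_univ _)
        simpa using this
    _ = _ := by
        rw [Finset.sum_comm]
        refine Finset.sum_congr rfl fun k _ => ?_
        rw [← Finset.sum_mul, ortho_rowsq hO, one_mul]

lemma exp_form_le_Phi (H : Matrix ι ι ℝ) (hH : Hᵀ = H) (w : ι → ℝ) (hw : w ⬝ᵥ w = 1) :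
    Real.exp (w ⬝ᵥ (H *ᵥ w)) ≤ Phi H := by
  obtain ⟨V, h, hV, rfl⟩ := spectral H hH
  have hV' : V * Vᵀ = 1 := mul_eq_one_comm.1 hV
  have h1 : w ⬝ᵥ ((V * diagonal h * Vᵀ) *ᵥ w) = ∑ k, ((Vᵀ *ᵥ w) k) ^ 2 * h k := by
    have : w ⬝ᵥ ((V * diagonal h * Vᵀ) *ᵥ w) = (Vᵀ *ᵥ w) ⬝ᵥ (diagonal h *ᵥ (Vᵀ *ᵥ w)) := by
      rw [← mulVec_mulVec, ← mulVec_mulVec, dotProduct_mulVec, ← mulVec_transpose]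
    rw [this]
    simp only [dotProduct, mulVec_diagonal]
    exact Finset.sum_congr rfl fun _ _ => by ring
  have h2 : ∑ k, ((Vᵀ *ᵥ w) k) ^ 2 = 1 := by
    have : (Vᵀ *ᵥ w) ⬝ᵥ (Vᵀ *ᵥ w) = w ⬝ᵥ w := by
      rw [mulVec_transpose, ← dotProduct_mulVec, ← mulVec_transpose, mulVec_mulVec, hV', one_mulVec]
    rw [← hw, ← this]
    simp [dotProduct, sq]
  have h3 : ∀ k, ((Vᵀ *ᵥ w) k) ^ 2 ≤ 1 := by
    intro k
    rw [← h2]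
    exact Finset.single_le_sum (f := fun k => ((Vᵀ *ᵥ w) k) ^ 2) (fun _ _ => sq_nonneg _) (Finset.mem_univ k)
  rw [h1]
  have h4 := convexOn_exp.map_sum_le (t := Finset.univ) (w := fun k => ((Vᵀ *ᵥ w) k) ^ 2) (p := h)
          (fun k _ => sq_nonneg _) h2 (fun k _ => Set.mem_univ _)
  simp only [smul_eq_mul] at h4
  refine h4.trans ?_
  refine le_trans (Finset.sum_le_sum (fun k _ => ?_)) (le_Phi _ V hV)
  have h5 : (Vᵀ * (V * diagonal h * Vᵀ) * V) k k = h k := by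
    rw [conj_diag_apply, hV]
    simp [one_apply]
  rw [h5]
  have := Real.exp_pos (h k)
  nlinarith [h3 k]

lemma one_step {Ω : Type*} [Fintype Ω] (w : Ω → ℝ) (hw : ∀ o, 0 ≤ w o) (hw1 : ∑ o, w o = 1)
    (H : Matrix ι ι ℝ) (hH : Hᵀ = H) (V : Ω → Matrix ι ι ℝ) (hV : ∀ o, (V o)ᵀ * V o = 1)
    (z : Ω → ι → ℝ) (c : ℝ) :
    ∑ o, w o * Phi (H + V o * diagonal (z o) * (V o)ᵀ) ≤
      Phi (H + (Real.exp (-c) • ∑ o, w o • (V o * diagonal (fun i => Real.exp (z o i)) * (V o)ᵀ)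
        + (c - 1) • (1 : Matrix ι ι ℝ))) := by
  have hsym : ∀ o, (H + V o * diagonal (z o) * (V o)ᵀ)ᵀ = H + V o * diagonal (z o) * (V o)ᵀ := by
    intro o
    simp [transpose_add, transpose_mul, hH, Matrix.mul_assoc]
  choose W h hW hh using fun o => spectral _ (hsym o)
  let T : Ω → Matrix ι ι ℝ := fun o => W o * diagonal (fun i => Real.exp (h o i)) * (W o)ᵀ
  have hTsym : (∑ o, w o • T o)ᵀ = ∑ o, w o • T o := by
    rw [transpose_sum]
    refine Finset.sum_congr rfl fun o _ => ?_
    simp [T, transpose_mul, Matrix.mul_assoc]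
  obtain ⟨U, t, hU, hT⟩ := spectral _ hTsym
  have hU' : U * Uᵀ = 1 := mul_eq_one_comm.1 hU
  have ht : ∀ i, 0 < t i := by
    intro i
    have e1 : t i = (Uᵀ * (∑ o, w o • T o) * U) i i := by
      rw [hT, conj_diag_apply, hU]
      simp [one_apply]
    have e2 : (Uᵀ * (∑ o, w o • T o) * U) i i = ∑ o, w o * (Uᵀ * T o * U) i i := by
      rw [Matrix.mul_sum, Matrix.sum_mul, Matrix.sum_apply]
      refine Finset.sum_congr rfl fun k _ => ?_
      rw [Matrix.mul_smul, Matrix.smul_mul, Matrix.smul_apply, smul_eq_mul]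
    have e3 : ∀ o, 0 < (Uᵀ * T o * U) i i := by
      intro o
      simp only [T]
      rw [conj_diag_apply]
      by_contra hc
      have h0 : ∀ k ∈ Finset.univ, ((((W o)ᵀ * U) k i) ^ 2 * Real.exp (h o k)) = 0 := by
        refine (Finset.sum_eq_zero_iff_of_nonneg (fun k _ => by positivity)).1 ?_
        exact le_antisymm (not_lt.1 hc) (Finset.sum_nonneg fun k _ => by positivity)
      have h1 := ortho_colsq (ortho_mul (hW o) hU) i
      have h2 : ∑ k, (((W o)ᵀ * U) k i) ^ 2 = 0 := Finset.sum_eq_zero fun k hk => by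
        have := h0 k hk
        rcases mul_eq_zero.1 this with h | h
        · exact h
        · exact absurd h (Real.exp_pos _).ne'
      rw [h2] at h1
      exact zero_ne_one h1
    rw [e1, e2]
    by_contra hc
    have h0 : ∀ o ∈ Finset.univ, w o * (Uᵀ * T o * U) i i = 0 :=
      (Finset.sum_eq_zero_iff_of_nonneg (fun o _ => mul_nonneg (hw o) (e3 o).le)).1
        (le_antisymm (not_lt.1 hc) (Finset.sum_nonneg fun o _ => mul_nonneg (hw o) (e3 o).le))
    have h2 : ∑ o, w o = 0 := Finset.sum_eq_zero fun o ho => by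
      rcases mul_eq_zero.1 (h0 o ho) with h | h
      · exact h
      · exact absurd h (e3 o).ne'
    rw [h2] at hw1
    exact zero_ne_one hw1
  set EZ : Ω → Matrix ι ι ℝ := fun o => V o * diagonal (fun i => Real.exp (z o i)) * (V o)ᵀ with hEZ
  set M := Real.exp (-c) • ∑ o, w o • EZ o + (c - 1) • (1 : Matrix ι ι ℝ) with hM
  set LT := U * diagonal (fun i => Real.log (t i)) * Uᵀ with hLT
  -- upper bound on the left side
  have L1 : ∀ o, Phi (H + V o * diagonal (z o) * (V o)ᵀ) ≤ trace (T o) := by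
    intro o
    rw [hh o]
    refine (peierls _ (hW o) _).trans (le_of_eq ?_)
    simp only [T]
    rw [Matrix.trace_mul_comm, ← Matrix.mul_assoc, hW o, Matrix.one_mul, trace_diagonal]
  -- Gibbs / Golden-Thompson
  have L2 : ∀ o, trace (T o * (V o * diagonal (z o) * (V o)ᵀ)) + (trace (T o * LT) - c * trace (T o))
      + trace (T o) ≤ trace (T o * (H + V o * diagonal (z o) * (V o)ᵀ))
        + Real.exp (-c) * trace (EZ o * ∑ o, w o • T o) := by
    intro o
    have key := gt_matrix (W o) (V o) U (hW o) (hV o) hU (fun i => Real.exp (h o i))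
      (fun i => Real.exp (z o i)) (fun i => Real.exp (-c) * t i) (fun i => Real.exp_pos _)
      (fun i => Real.exp_pos _) (fun i => mul_pos (Real.exp_pos _) (ht i))
    simp only [Real.log_exp] at key
    have e1 : U * diagonal (fun i => Real.log (Real.exp (-c) * t i)) * Uᵀ = LT - c • 1 := by
      have : (fun i => Real.log (Real.exp (-c) * t i)) = (fun i => Real.log (t i)) - fun _ => c := by
        funext i
        rw [Real.log_mul (Real.exp_pos _).ne' (ht i).ne', Real.log_exp, Pi.sub_apply]; ring
      have hd : diagonal ((fun i => Real.log (t i)) - fun _ => c) =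
          diagonal (fun i => Real.log (t i)) - diagonal (fun _ : ι => c) := by
        ext a b
        by_cases hab : a = b
        · subst hab; simp
        · simp [hab]
      rw [this, hd, Matrix.mul_sub, Matrix.sub_mul, hLT]
      congr 1
      rw [← smul_one_eq_diagonal, Matrix.mul_smul, Matrix.smul_mul, Matrix.mul_one, hU']
    have e2 : U * diagonal (fun i => Real.exp (-c) * t i) * Uᵀ = Real.exp (-c) • ∑ o, w o • T o := by
      have : (fun i => Real.exp (-c) * t i) = Real.exp (-c) • t := rfl
      rw [this, Matrix.diagonal_smul, Matrix.mul_smul, Matrix.smul_mul, ← hT]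
    have e3 : ∑ i, Real.exp (h o i) = trace (T o) := by
      simp only [T]
      rw [Matrix.trace_mul_comm, ← Matrix.mul_assoc, hW o, Matrix.one_mul, trace_diagonal]
    have e4 : ∑ i, Real.exp (h o i) * h o i = trace (T o * (H + V o * diagonal (z o) * (V o)ᵀ)) := by
      rw [hh o]
      simp only [T]
      rw [tr_conj, hW o]
      refine Finset.sum_congr rfl fun i _ => ?_
      simp [one_apply]
    rw [e1, e2, e3, e4, Matrix.mul_sub, trace_sub, Matrix.mul_smul, Matrix.mul_smul, trace_smul, trace_smul,
      Matrix.mul_one, smul_eq_mul, smul_eq_mul] at key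
    exact key
  set Tb := ∑ o, w o • T o with hTb
  have trT : ∀ X : Matrix ι ι ℝ, trace (Tb * X) = ∑ o, w o * trace (T o * X) := by
    intro X
    rw [hTb, Matrix.sum_mul, trace_sum]
    refine Finset.sum_congr rfl fun o _ => ?_
    rw [Matrix.smul_mul, trace_smul, smul_eq_mul]
  have trT1 : trace Tb = ∑ o, w o * trace (T o) := by
    simpa using trT 1
  have L3 : trace (Tb * LT) ≤ trace (Tb * (H + M)) := by
    have s := Finset.sum_le_sum (s := Finset.univ) fun o _ => mul_le_mul_of_nonneg_left (L2 o) (hw o)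
    have a1 : trace (Tb * M) = Real.exp (-c) * ∑ o, w o * trace (EZ o * Tb) + (c - 1) * trace Tb := by
      rw [hM, Matrix.mul_add, trace_add, Matrix.mul_smul, trace_smul, Matrix.mul_smul, trace_smul, Matrix.mul_one,
        smul_eq_mul, smul_eq_mul, Matrix.mul_sum, trace_sum]
      congr 2
      refine Finset.sum_congr rfl fun o _ => ?_
      rw [Matrix.mul_smul, trace_smul, smul_eq_mul, Matrix.trace_mul_comm]
    have s' : ∑ o, w o * trace (T o * LT) + (1 - c) * ∑ o, w o * trace (T o)
        ≤ ∑ o, w o * trace (T o * H) + Real.exp (-c) * ∑ o, w o * trace (EZ o * Tb) := by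
      have b1 : ∑ o, w o * (trace (T o * (V o * diagonal (z o) * (V o)ᵀ)) + (trace (T o * LT) - c * trace (T o))
        + trace (T o)) = ∑ o, w o * trace (T o * (V o * diagonal (z o) * (V o)ᵀ)) +
          (∑ o, w o * trace (T o * LT) + (1 - c) * ∑ o, w o * trace (T o)) := by
        simp only [Finset.mul_sum, ← Finset.sum_add_distrib]
        exact Finset.sum_congr rfl fun _ _ => by ring
      have b2 : ∑ o, w o * (trace (T o * (H + V o * diagonal (z o) * (V o)ᵀ))
        + Real.exp (-c) * trace (EZ o * Tb)) = ∑ o, w o * trace (T o * (V o * diagonal (z o) * (V o)ᵀ)) +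
          (∑ o, w o * trace (T o * H) + Real.exp (-c) * ∑ o, w o * trace (EZ o * Tb)) := by
        simp only [Finset.mul_sum, ← Finset.sum_add_distrib]
        refine Finset.sum_congr rfl fun _ _ => ?_
        rw [Matrix.mul_add, trace_add]; ring
      rw [b1, b2] at s
      linarith
    rw [Matrix.mul_add, trace_add, a1, trT1, trT LT, trT H]
    linarith
  have L4 : trace Tb + trace (Tb * (H + M)) - trace (Tb * LT) ≤ Phi (H + M) := by
    refine le_trans ?_ (le_Phi _ U hU)
    have c1 : trace Tb = ∑ i, t i := by
      rw [hT, Matrix.trace_mul_comm, ← Matrix.mul_assoc, hU, Matrix.one_mul, trace_diagonal]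
    have c2 : trace (Tb * LT) = ∑ i, t i * Real.log (t i) := by
      rw [hT, hLT, tr_conj, hU]
      refine Finset.sum_congr rfl fun i _ => ?_
      simp [one_apply]
    have c3 : trace (Tb * (H + M)) = ∑ i, t i * (Uᵀ * (H + M) * U) i i := by
      rw [hT, Matrix.mul_assoc, Matrix.mul_assoc, Matrix.trace_mul_comm, trace]
      refine Finset.sum_congr rfl fun i _ => ?_
      rw [diag_apply, Matrix.mul_assoc, Matrix.mul_assoc, diagonal_mul]
    rw [c1, c2, c3, ← Finset.sum_add_distrib, ← Finset.sum_sub_distrib]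
    refine Finset.sum_le_sum fun i _ => ?_
    set x := (Uᵀ * (H + M) * U) i i
    have := Real.add_one_le_exp (x - Real.log (t i))
    rw [Real.exp_sub, Real.exp_log (ht i), le_div_iff₀ (ht i)] at this
    linarith
  calc ∑ o, w o * Phi (H + V o * diagonal (z o) * (V o)ᵀ) ≤ ∑ o, w o * trace (T o) :=
        Finset.sum_le_sum fun o _ => mul_le_mul_of_nonneg_left (L1 o) (hw o)
    _ = trace Tb := trT1.symm
    _ ≤ _ := by linarith
end MJ
end PartB

section PartC
open scoped BigOperators
open Matrix

namespace MJ

lemma exp_tri (θ y : ℝ) (hy : y ^ 3 = y) :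
    Real.exp (θ * y) = 1 + Real.sinh θ * y + (Real.cosh θ - 1) * y ^ 2 := by
  have h : y * (y - 1) * (y + 1) = 0 := by linear_combination hy
  rcases mul_eq_zero.1 h with h | h
  · rcases mul_eq_zero.1 h with h | h
    · subst h; simp
    · have : y = 1 := by linarith
      subst this
      rw [mul_one, Real.sinh_eq, Real.cosh_eq]; ring
  · have : y = -1 := by linarith
    subst this
    rw [Real.sinh_eq, Real.cosh_eq, mul_neg_one]; ring

section
variable {ι : Type*} [Fintype ι] [DecidableEq ι]

lemma conj_tri (Y : Matrix ι ι ℝ) (hY : Yᵀ = Y) (hY3 : Y * Y * Y = Y) (θ : ℝ) :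
    ∃ (V : Matrix ι ι ℝ) (z : ι → ℝ), Vᵀ * V = 1 ∧ V * diagonal z * Vᵀ = θ • Y ∧
      V * diagonal (fun i => Real.exp (z i)) * Vᵀ =
        1 + Real.sinh θ • Y + (Real.cosh θ - 1) • (Y * Y) := by
  obtain ⟨V, y, hV, hYV⟩ := spectral Y hY
  have hV' : V * Vᵀ = 1 := mul_eq_one_comm.1 hV
  have hdd : ∀ f g : ι → ℝ, (V * diagonal f * Vᵀ) * (V * diagonal g * Vᵀ) =
      V * diagonal (fun i => f i * g i) * Vᵀ := by
    intro f g
    calc (V * diagonal f * Vᵀ) * (V * diagonal g * Vᵀ) = V * diagonal f * (Vᵀ * V) * diagonal g * Vᵀ := by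
          simp only [Matrix.mul_assoc]
      _ = _ := by rw [hV, Matrix.mul_one, Matrix.mul_assoc V, diagonal_mul_diagonal]
  have hinv : ∀ f : ι → ℝ, Vᵀ * (V * diagonal f * Vᵀ) * V = diagonal f := by
    intro f
    calc Vᵀ * (V * diagonal f * Vᵀ) * V = (Vᵀ * V) * diagonal f * (Vᵀ * V) := by
          simp only [Matrix.mul_assoc]
      _ = _ := by rw [hV, Matrix.mul_one, Matrix.one_mul]
  have hy : ∀ i, y i ^ 3 = y i := by
    intro i
    have h3 : V * diagonal (fun i => y i * y i * y i) * Vᵀ = V * diagonal y * Vᵀ := by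
      rw [← hdd, ← hdd, ← hYV, hY3]
    have := congrArg (fun M => Vᵀ * M * V) h3
    simp only [hinv] at this
    have := congrFun (congrFun this i) i
    simp only [diagonal_apply_eq] at this
    linear_combination this
  refine ⟨V, fun i => θ * y i, hV, ?_, ?_⟩
  · have : (fun i => θ * y i) = θ • y := rfl
    rw [this, diagonal_smul, Matrix.mul_smul, Matrix.smul_mul, ← hYV]
  · have hd : diagonal (fun i => Real.exp (θ * y i)) = 1 + Real.sinh θ • diagonal y +
        (Real.cosh θ - 1) • diagonal (fun i => y i * y i) := by
      ext a b
      by_cases hab : a = b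
      · subst hab
        simp only [diagonal_apply_eq, Matrix.add_apply, Matrix.smul_apply, one_apply_eq, smul_eq_mul]
        rw [exp_tri θ _ (hy a)]; ring
      · simp [hab]
    rw [hd, Matrix.mul_add, Matrix.mul_add, Matrix.add_mul, Matrix.add_mul, Matrix.mul_one, hV',
      Matrix.mul_smul, Matrix.mul_smul, Matrix.smul_mul, Matrix.smul_mul, ← hdd, ← hYV]

lemma step_gen {Ω : Type*} [Fintype Ω] (w : Ω → ℝ) (hw : ∀ o, 0 ≤ w o) (hw1 : ∑ o, w o = 1)
    (H F : Matrix ι ι ℝ) (hH : Hᵀ = H) (hF : Fᵀ = F) (Y : Ω → Matrix ι ι ℝ)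
    (hY : ∀ o, (Y o)ᵀ = Y o) (hY3 : ∀ o, Y o * Y o * Y o = Y o) (θ ω g : ℝ)
    (hq : ∀ x : ι → ℝ, Real.exp (-ω) * ∑ o, w o * (Real.sinh θ * (x ⬝ᵥ (Y o *ᵥ x)) +
      (Real.cosh θ - 1) * (x ⬝ᵥ ((Y o * Y o) *ᵥ x))) - θ * (x ⬝ᵥ (F *ᵥ x))
      ≤ (g - (Real.exp (-ω) + ω - 1)) * (x ⬝ᵥ x)) :
    ∑ o, w o * Phi (H + θ • (Y o - F)) ≤ Real.exp g * Phi H := by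
  choose V z hV hz hez using fun o => conj_tri (Y o) (hY o) (hY3 o) θ
  have hH' : (H - θ • F)ᵀ = H - θ • F := by
    rw [transpose_sub, transpose_smul, hH, hF]
  have h1 := one_step w hw hw1 (H - θ • F) hH' V hV z ω
  have h2 : ∀ o, H + θ • (Y o - F) = H - θ • F + V o * diagonal (z o) * (V o)ᵀ := by
    intro o
    rw [hz, smul_sub]; abel
  simp_rw [h2]
  refine h1.trans ?_
  rw [sub_add_eq_add_sub, add_sub_assoc]
  refine Phi_shift _ _ _ fun x => ?_
  have e1 : x ⬝ᵥ (Real.exp (-ω) • ∑ o, w o • (V o * diagonal (fun i => Real.exp (z o i)) * (V o)ᵀ)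
        + (ω - 1) • (1 : Matrix ι ι ℝ) - θ • F) *ᵥ x = (Real.exp (-ω) * ∑ o, w o * (x ⬝ᵥ x + Real.sinh θ * (x ⬝ᵥ (Y o *ᵥ x)) +
      (Real.cosh θ - 1) * (x ⬝ᵥ ((Y o * Y o) *ᵥ x)))) + (ω - 1) * (x ⬝ᵥ x) - θ * (x ⬝ᵥ (F *ᵥ x)) := by
    simp only [hez]
    rw [sub_mulVec, add_mulVec, smul_mulVec, smul_mulVec, smul_mulVec, one_mulVec, Matrix.sum_mulVec,
      dotProduct_sub, dotProduct_add, dotProduct_smul, dotProduct_smul, dotProduct_smul, dotProduct_sum]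
    simp only [smul_eq_mul]
    have e0 : ∀ o, x ⬝ᵥ ((w o • (1 + Real.sinh θ • Y o + (Real.cosh θ - 1) • (Y o * Y o))) *ᵥ x) =
        w o * (x ⬝ᵥ x + Real.sinh θ * (x ⬝ᵥ (Y o *ᵥ x)) +
      (Real.cosh θ - 1) * (x ⬝ᵥ ((Y o * Y o) *ᵥ x))) := by
      intro o
      simp only [smul_mulVec, add_mulVec, one_mulVec, dotProduct_add, dotProduct_smul, smul_eq_mul]
    simp only [e0]
  have e2 : ∑ o, w o * (x ⬝ᵥ x + Real.sinh θ * (x ⬝ᵥ (Y o *ᵥ x)) +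
      (Real.cosh θ - 1) * (x ⬝ᵥ ((Y o * Y o) *ᵥ x))) = x ⬝ᵥ x + ∑ o, w o * (Real.sinh θ * (x ⬝ᵥ (Y o *ᵥ x)) +
      (Real.cosh θ - 1) * (x ⬝ᵥ ((Y o * Y o) *ᵥ x))) := by
    have : x ⬝ᵥ x = ∑ o, w o * (x ⬝ᵥ x) := by rw [← Finset.sum_mul, hw1, one_mul]
    conv_rhs => rw [this]
    rw [← Finset.sum_add_distrib]
    exact Finset.sum_congr rfl fun o _ => by ring
  rw [e1, e2]
  have := hq x
  linarith
end

section
variable {n : ℕ}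

def dil (A : Matrix (Fin n) (Fin n) ℝ) : Matrix (Fin n ⊕ Fin n) (Fin n ⊕ Fin n) ℝ :=
  fromBlocks 0 A Aᵀ 0

lemma dil_symm (A : Matrix (Fin n) (Fin n) ℝ) : (dil A)ᵀ = dil A := by
  simp [dil, fromBlocks_transpose]

lemma dil_form (A : Matrix (Fin n) (Fin n) ℝ) (v : Fin n ⊕ Fin n → ℝ) :
    v ⬝ᵥ (dil A *ᵥ v) = 2 * ∑ i, ∑ l, A i l * (v (Sum.inl i) * v (Sum.inr l)) := by
  have h1 : ∑ l, v (Sum.inr l) * ∑ i, A i l * v (Sum.inl i) =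
      ∑ i, ∑ l, A i l * (v (Sum.inl i) * v (Sum.inr l)) := by
    simp_rw [Finset.mul_sum]
    rw [Finset.sum_comm]
    exact Finset.sum_congr rfl fun i _ => Finset.sum_congr rfl fun l _ => by ring
  have h2 : ∑ i, v (Sum.inl i) * ∑ l, A i l * v (Sum.inr l) =
      ∑ i, ∑ l, A i l * (v (Sum.inl i) * v (Sum.inr l)) := by
    simp_rw [Finset.mul_sum]
    exact Finset.sum_congr rfl fun i _ => Finset.sum_congr rfl fun l _ => by ring
  simp only [dotProduct, mulVec, Fintype.sum_sum_type, dil, fromBlocks_apply₁₁, fromBlocks_apply₁₂,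
    fromBlocks_apply₂₁, fromBlocks_apply₂₂, Matrix.zero_apply, zero_mul, Finset.sum_const_zero, zero_add, add_zero,
    transpose_apply]
  rw [h1, h2]; ring

lemma dil_single_cube (i l : Fin n) :
    dil (single i l (1:ℝ)) * dil (single i l 1) * dil (single i l 1) = dil (single i l 1) := by
  simp [dil, fromBlocks_multiply]

lemma dil_single_sq_form (i l : Fin n) (v : Fin n ⊕ Fin n → ℝ) :
    v ⬝ᵥ ((dil (single i l (1:ℝ)) * dil (single i l 1)) *ᵥ v) = v (Sum.inl i) ^ 2 + v (Sum.inr l) ^ 2 := by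
  have : (dil (single i l (1:ℝ)) * dil (single i l 1)) = fromBlocks (single i i 1) 0 0 (single l l 1) := by
    simp [dil, fromBlocks_multiply]
  rw [this]
  simp [dotProduct, mulVec, Fintype.sum_sum_type, single_apply, ite_and, sq]

lemma dil_single_form (i l : Fin n) (v : Fin n ⊕ Fin n → ℝ) :
    v ⬝ᵥ (dil (single i l (1:ℝ)) *ᵥ v) = 2 * (v (Sum.inl i) * v (Sum.inr l)) := by
  rw [dil_form]
  simp [single_apply, ite_and]

lemma crude_form (F : Matrix (Fin n) (Fin n) ℝ) (hF : ∀ i l, 0 ≤ F i l) (hF1 : ∑ i, ∑ l, F i l ≤ 1)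
    (i l : Fin n) (θ : ℝ) (hθ : 0 ≤ θ) (v : Fin n ⊕ Fin n → ℝ) :
    v ⬝ᵥ ((θ • (dil (single i l (1:ℝ)) - dil F)) *ᵥ v) ≤ Real.sqrt 2 * θ * (v ⬝ᵥ v) := by
  set A : Matrix (Fin n) (Fin n) ℝ := single i l 1 - F with hA
  have hd : dil (single i l (1:ℝ)) - dil F = dil A := by
    ext a b
    rcases a with a | a <;> rcases b with b | b <;> simp [dil, hA]
  have hAA : ∑ a, ∑ b, A a b ^ 2 ≤ 2 := by
    have e : ∀ a b, A a b ^ 2 ≤ single i l (1:ℝ) a b + F a b := by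
      intro a b
      have h1 : F a b ≤ 1 := by
        refine le_trans ?_ hF1
        refine le_trans (Finset.single_le_sum (f := fun b => F a b) (fun b _ => hF a b) (Finset.mem_univ b)) ?_
        exact Finset.single_le_sum (f := fun a => ∑ b, F a b) (fun a _ => Finset.sum_nonneg fun b _ => hF a b) (Finset.mem_univ a)
      have h0 := hF a b
      rw [hA, Matrix.sub_apply, single_apply]
      split_ifs <;> nlinarith
    calc ∑ a, ∑ b, A a b ^ 2 ≤ ∑ a, ∑ b, (single i l (1:ℝ) a b + F a b) :=
          Finset.sum_le_sum fun a _ => Finset.sum_le_sum fun b _ => e a b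
      _ = 1 + ∑ a, ∑ b, F a b := by
          simp only [Finset.sum_add_distrib]
          congr 1
          simp [single_apply, ite_and]
      _ ≤ 2 := by linarith
  set x := fun a => v (Sum.inl a)
  set z := fun a => v (Sum.inr a)
  set S1 := ∑ a, x a ^ 2
  set S2 := ∑ a, z a ^ 2
  have hS : v ⬝ᵥ v = S1 + S2 := by
    simp [dotProduct, Fintype.sum_sum_type, S1, S2, x, z, sq]
  have hS1 : 0 ≤ S1 := Finset.sum_nonneg fun _ _ => sq_nonneg _
  have hS2 : 0 ≤ S2 := Finset.sum_nonneg fun _ _ => sq_nonneg _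
  have hcs : (∑ a, ∑ b, A a b * (x a * z b)) ^ 2 ≤ 2 * (S1 * S2) := by
    have := Finset.sum_mul_sq_le_sq_mul_sq (Finset.univ : Finset (Fin n × Fin n)) (fun q => A q.1 q.2) (fun q => x q.1 * z q.2)
    rw [Fintype.sum_prod_type, Fintype.sum_prod_type, Fintype.sum_prod_type] at this
    refine this.trans ?_
    have e : ∑ a, ∑ b, (x a * z b) ^ 2 = S1 * S2 := by
      simp only [S1, S2, Finset.sum_mul_sum, mul_pow]
    simp only [e]
    exact mul_le_mul_of_nonneg_right hAA (mul_nonneg hS1 hS2)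
  rw [smul_mulVec, dotProduct_smul, hd, dil_form, hS, smul_eq_mul]
  have h2 := Real.sq_sqrt (show (0:ℝ) ≤ 2 by norm_num)
  have h3 : 2 * ∑ a, ∑ b, A a b * (x a * z b) ≤ Real.sqrt 2 * (S1 + S2) := by
    refine abs_le_of_sq_le_sq' ?_ (mul_nonneg (Real.sqrt_nonneg _) (by linarith)) |>.2
    rw [mul_pow, mul_pow, h2]
    nlinarith [sq_nonneg (S1 - S2)]
  calc θ * (2 * ∑ a, ∑ b, A a b * (x a * z b)) ≤ θ * (Real.sqrt 2 * (S1 + S2)) :=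
        mul_le_mul_of_nonneg_left h3 hθ
    _ = _ := by ring

/-- One step bound for the Markov dilation. -/
lemma step_dil (p : Fin n → ℝ) (hp : ∀ i, 0 ≤ p i) (hp1 : ∑ i, p i = 1)
    (P : Matrix (Fin n) (Fin n) ℝ) (hP : ∀ i j, 0 ≤ P i j) (hP1 : ∀ i, ∑ j, P i j = 1) (piv : Fin n → ℝ)
    (H : Matrix (Fin n ⊕ Fin n) (Fin n ⊕ Fin n) ℝ) (hH : Hᵀ = H) (θ ω L : ℝ)
    (hq : ∀ x z : Fin n → ℝ, ∑ i, ∑ l, P i l * (Real.exp (-ω) * (Real.cosh θ - 1) * p i * (x i ^ 2 + z l ^ 2)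
      + 2 * (Real.exp (-ω) * Real.sinh θ * p i - θ * piv i) * (x i * z l)) ≤ L * (∑ i, x i ^ 2 + ∑ i, z i ^ 2)) :
    ∑ i, ∑ l, p i * P i l * Phi (H + θ • (dil (single i l (1:ℝ)) - dil (diagonal piv * P)))
      ≤ Real.exp (L + (Real.exp (-ω) + ω - 1)) * Phi H := by
  have := step_gen (Ω := Fin n × Fin n) (fun o => p o.1 * P o.1 o.2) (fun o => mul_nonneg (hp _) (hP _ _))
    (by rw [Fintype.sum_prod_type]; simp_rw [← Finset.mul_sum, hP1, mul_one, hp1])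
    H (dil (diagonal piv * P)) hH (dil_symm _) (fun o => dil (single o.1 o.2 1)) (fun o => dil_symm _)
    (fun o => dil_single_cube _ _) θ ω (L + (Real.exp (-ω) + ω - 1)) (by
      intro v
      have h := hq (fun i => v (Sum.inl i)) (fun i => v (Sum.inr i))
      have hS : v ⬝ᵥ v = ∑ i, v (Sum.inl i) ^ 2 + ∑ i, v (Sum.inr i) ^ 2 := by
        simp [dotProduct, Fintype.sum_sum_type, sq]
      rw [hS]
      simp only [dil_single_form, dil_single_sq_form]
      rw [dil_form]
      refine (le_of_eq ?_).trans (h.trans (le_of_eq (by ring)))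
      rw [Fintype.sum_prod_type, Finset.mul_sum, Finset.mul_sum, Finset.mul_sum, ← Finset.sum_sub_distrib]
      refine Finset.sum_congr rfl fun i _ => ?_
      rw [Finset.mul_sum, Finset.mul_sum, Finset.mul_sum, ← Finset.sum_sub_distrib]
      refine Finset.sum_congr rfl fun l _ => ?_
      rw [diagonal_mul]
      ring)
  rw [Fintype.sum_prod_type] at this
  exact this
end
end MJ
end PartC

section PartD
open scoped BigOperators
open Matrix

namespace MJ
variable {n : ℕ}

lemma col_crit (P : Matrix (Fin n) (Fin n) ℝ) (hP : ∀ i j, 0 ≤ P i j) (hP1 : ∀ i, ∑ j, P i j = 1)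
    (u γ ψ : Fin n → ℝ) (L : ℝ) (hu : ∀ i, u i < L) (hψ : ∀ i, γ i ^ 2 ≤ (ψ i - u i) * (L - u i))
    (hc : ∀ l, ∑ i, P i l * ψ i ≤ L) (x z : Fin n → ℝ) :
    ∑ i, ∑ l, P i l * (u i * (x i ^ 2 + z l ^ 2) + 2 * γ i * (x i * z l)) ≤
      L * (∑ i, x i ^ 2 + ∑ i, z i ^ 2) := by
  have h1 : ∀ i l, P i l * (u i * (x i ^ 2 + z l ^ 2) + 2 * γ i * (x i * z l)) ≤
      P i l * (L * x i ^ 2) + P i l * ψ i * z l ^ 2 := by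
    intro i l
    have hL : 0 < L - u i := by linarith [hu i]
    have : u i * (x i ^ 2 + z l ^ 2) + 2 * γ i * (x i * z l) ≤ L * x i ^ 2 + ψ i * z l ^ 2 := by
      have h2 : 0 ≤ (L - u i) * ((L - u i) * x i ^ 2 + (ψ i - u i) * z l ^ 2 - 2 * γ i * (x i * z l)) := by
        nlinarith [sq_nonneg ((L - u i) * x i - γ i * z l), mul_le_mul_of_nonneg_right (hψ i) (sq_nonneg (z l))]
      have h3 := nonneg_of_mul_nonneg_right h2 hL
      linarith
    have := mul_le_mul_of_nonneg_left this (hP i l)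
    linarith
  calc _ ≤ ∑ i, ∑ l, (P i l * (L * x i ^ 2) + P i l * ψ i * z l ^ 2) :=
        Finset.sum_le_sum fun i _ => Finset.sum_le_sum fun l _ => h1 i l
    _ = L * ∑ i, x i ^ 2 + ∑ l, (∑ i, P i l * ψ i) * z l ^ 2 := by
        simp only [Finset.sum_add_distrib]
        congr 1
        · rw [Finset.mul_sum]
          refine Finset.sum_congr rfl fun i _ => ?_
          rw [← Finset.sum_mul, hP1, one_mul]
        · rw [Finset.sum_comm]
          exact Finset.sum_congr rfl fun l _ => by rw [Finset.sum_mul]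
    _ ≤ L * ∑ i, x i ^ 2 + ∑ l, L * z l ^ 2 := by
        gcongr with l
        exact hc l
    _ = _ := by rw [← Finset.mul_sum]; ring

/-- Scalar criterion. -/
structure Crit (s κ d m a L A B C q q2 : ℝ) : Prop where
  hs : 0 ≤ s
  hκ : 0 ≤ κ
  ha : 0 ≤ a
  hA : 0 ≤ A
  hB : 0 ≤ B
  hC : κ ≤ C
  hL : κ * (m + a) < L
  h1 : d ^ 2 * m ≤ A * (L - κ * m)
  h2 : s ^ 2 * a + q * m ≤ B * (L - κ * a)
  hq : 0 ≤ q
  hq' : κ * (A + B) - 2 * d * s ≤ q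
  h3 : s ^ 2 * a + q2 * m ≤ C * (L + κ * a)
  hq2 : 0 ≤ q2
  hq2' : κ * (C - A) + 2 * d * s ≤ q2
  hC' : κ * C ≤ s ^ 2
  h4 : κ * m + A * m + (B + C) * a ≤ L

lemma crit_pos {s κ d m a L A B C q q2 : ℝ} (h : Crit s κ d m a L A B C q q2) {π δ : ℝ} (hπ : 0 ≤ π) (hπm : π ≤ m)
    (hδ : 0 ≤ δ) (hδa : δ ≤ a) : (s * δ - d * π) ^ 2 ≤ (A * π + B * δ) * (L - κ * (π + δ)) := by
  have e1 : d ^ 2 * π ^ 2 ≤ A * π * (L - κ * π) := by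
    have := mul_le_mul_of_nonneg_left h.h1 hπ
    have e : A * π * (κ * π) ≤ A * π * (κ * m) := by
      have := h.hA; have := h.hκ; gcongr
    have e' : d ^ 2 * π * π ≤ d ^ 2 * π * m := by gcongr
    nlinarith
  have e2 : s ^ 2 * δ ^ 2 + q * π * δ ≤ B * δ * (L - κ * δ) := by
    have := mul_le_mul_of_nonneg_left h.h2 hδ
    have e : B * δ * (κ * δ) ≤ B * δ * (κ * a) := by
      have := h.hB; have := h.hκ; gcongr
    have e' : s ^ 2 * δ * δ ≤ s ^ 2 * δ * a := by gcongr
    have e'' : q * δ * π ≤ q * δ * m := by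
      have := h.hq; gcongr
    nlinarith
  have e3 := mul_le_mul_of_nonneg_right h.hq' (mul_nonneg hπ hδ)
  nlinarith

lemma crit_neg {s κ d m a L A B C q q2 : ℝ} (h : Crit s κ d m a L A B C q q2) {π t : ℝ} (hπ : 0 ≤ π) (hπm : π ≤ m)
    (ht : 0 ≤ t) (hta : t ≤ a) : (-(s * t) - d * π) ^ 2 ≤ (A * π + C * t) * (L - κ * (π - t)) := by
  have e1 : d ^ 2 * π ^ 2 ≤ A * π * (L - κ * π) := by
    have := mul_le_mul_of_nonneg_left h.h1 hπ
    have e : A * π * (κ * π) ≤ A * π * (κ * m) := by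
      have := h.hA; have := h.hκ; gcongr
    have e' : d ^ 2 * π * π ≤ d ^ 2 * π * m := by gcongr
    nlinarith
  have e2 : s ^ 2 * t + q2 * π ≤ C * (L + κ * t) := by
    have e : (s ^ 2 - κ * C) * t ≤ (s ^ 2 - κ * C) * a :=
      mul_le_mul_of_nonneg_left hta (by linarith [h.hC'])
    have e'' : q2 * π ≤ q2 * m := by
      have := h.hq2; gcongr
    have := h.h3
    nlinarith
  have e2' := mul_le_mul_of_nonneg_left e2 ht
  have e3 := mul_le_mul_of_nonneg_right h.hq2' (mul_nonneg hπ ht)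
  nlinarith

lemma lin_crit (P : Matrix (Fin n) (Fin n) ℝ) (hP : ∀ i j, 0 ≤ P i j) (hP1 : ∀ i, ∑ j, P i j = 1)
    (piv p : Fin n → ℝ) (hpi : ∀ i, 0 ≤ piv i) (hst : ∀ j, ∑ i, piv i * P i j = piv j)
    (hs : ∑ i, p i = ∑ i, piv i) {s κ θ m a L A B C q q2 : ℝ} (hm : ∀ i, piv i ≤ m)
    (htv : (1/2) * ∑ i, |p i - piv i| ≤ a)
    (h : Crit s κ (θ - s) m a L A B C q q2) (x z : Fin n → ℝ) :
    ∑ i, ∑ l, P i l * (κ * p i * (x i ^ 2 + z l ^ 2) + 2 * (s * p i - θ * piv i) * (x i * z l)) ≤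
      L * (∑ i, x i ^ 2 + ∑ i, z i ^ 2) := by
  set dp : Fin n → ℝ := fun i => max (p i - piv i) 0 with hdp
  set dn : Fin n → ℝ := fun i => max (-(p i - piv i)) 0 with hdn
  have hdp0 : ∀ i, 0 ≤ dp i := fun i => le_max_right _ _
  have hdn0 : ∀ i, 0 ≤ dn i := fun i => le_max_right _ _
  have hsub : ∀ i, dp i - dn i = p i - piv i := by
    intro i
    simp only [hdp, hdn]
    rcases le_total 0 (p i - piv i) with h | h
    · rw [max_eq_left h, max_eq_right (by linarith)]; ring
    · rw [max_eq_right h, max_eq_left (by linarith)]; ring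
  have habs : ∀ i, dp i + dn i = |p i - piv i| := by
    intro i
    simp only [hdp, hdn]
    rcases le_total 0 (p i - piv i) with h | h
    · rw [max_eq_left h, max_eq_right (by linarith), abs_of_nonneg h]; ring
    · rw [max_eq_right h, max_eq_left (by linarith), abs_of_nonpos h]; ring
  have hsum1 : ∑ i, dp i - ∑ i, dn i = 0 := by
    rw [← Finset.sum_sub_distrib]; simp_rw [hsub]; rw [Finset.sum_sub_distrib, hs, sub_self]
  have hsum2 : ∑ i, dp i + ∑ i, dn i ≤ 2 * a := by
    rw [← Finset.sum_add_distrib]; simp_rw [habs]; linarith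
  have hpa : ∑ i, dp i ≤ a := by linarith
  have hna : ∑ i, dn i ≤ a := by linarith
  have hpi' : ∀ i, dp i ≤ a := fun i =>
    (Finset.single_le_sum (fun i _ => hdp0 i) (Finset.mem_univ i)).trans hpa
  have hni' : ∀ i, dn i ≤ a := fun i =>
    (Finset.single_le_sum (fun i _ => hdn0 i) (Finset.mem_univ i)).trans hna
  have hPle : ∀ i l, P i l ≤ 1 := fun i l => by
    rw [← hP1 i]
    exact Finset.single_le_sum (fun l _ => hP i l) (Finset.mem_univ l)
  refine col_crit P hP hP1 (fun i => κ * p i) (fun i => s * p i - θ * piv i)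
    (fun i => κ * p i + (A * piv i + B * dp i + C * dn i)) L ?_ ?_ ?_ x z
  · intro i
    refine lt_of_le_of_lt ?_ h.hL
    have := hsub i
    exact mul_le_mul_of_nonneg_left (by linarith [hpi' i, hdn0 i, hm i]) h.hκ
  · intro i
    rcases le_total 0 (p i - piv i) with h0 | h0
    · have e1 : dp i = p i - piv i := max_eq_left h0
      have e2 : dn i = 0 := max_eq_right (by linarith)
      have := crit_pos h (hpi i) (hm i) (hdp0 i) (hpi' i)
      rw [e2]
      rw [e1] at this ⊢
      calc _ = (s * (p i - piv i) - (θ - s) * piv i) ^ 2 := by ring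
        _ ≤ _ := this
        _ = _ := by ring
    · have e1 : dp i = 0 := max_eq_right h0
      have e2 : dn i = -(p i - piv i) := max_eq_left (by linarith)
      have := crit_neg h (hpi i) (hm i) (hdn0 i) (hni' i)
      rw [e1]
      rw [e2] at this ⊢
      calc _ = (-(s * -(p i - piv i)) - (θ - s) * piv i) ^ 2 := by ring
        _ ≤ _ := this
        _ = _ := by ring
  · intro l
    calc ∑ i, P i l * (κ * p i + (A * piv i + B * dp i + C * dn i))
        = (κ + A) * ∑ i, piv i * P i l + (B + κ) * ∑ i, P i l * dp i + (C - κ) * ∑ i, P i l * dn i := by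
          simp only [Finset.mul_sum, ← Finset.sum_add_distrib]
          refine Finset.sum_congr rfl fun i _ => ?_
          have := hsub i
          have : p i = piv i + dp i - dn i := by linarith
          rw [this]; ring
      _ ≤ (κ + A) * m + (B + κ) * a + (C - κ) * a := by
          have hκ := h.hκ; have hA := h.hA; have hB := h.hB; have hC := h.hC
          rw [hst]
          refine add_le_add (add_le_add ?_ ?_) ?_
          · exact mul_le_mul_of_nonneg_left (hm l) (by linarith)
          · refine mul_le_mul_of_nonneg_left ?_ (by linarith)
            refine le_trans (Finset.sum_le_sum fun i _ => ?_) hpa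
            nlinarith [hPle i l, hdp0 i]
          · refine mul_le_mul_of_nonneg_left ?_ (by linarith)
            refine le_trans (Finset.sum_le_sum fun i _ => ?_) hna
            nlinarith [hPle i l, hdn0 i]
      _ = κ * m + A * m + (B + C) * a := by ring
      _ ≤ L := h.h4
end MJ
end PartD

section PartE
open scoped BigOperators
open Matrix

namespace MJ

section
variable {n : ℕ} {E : Type*} [AddCommGroup E]

/-- Value function of the flagged path sum. -/
def Vf (P : Matrix (Fin n) (Fin n) ℝ) (f : Fin n → Fin n → E) (Φ : E → ℝ) :
    ℕ → (ℕ → Bool) → Fin n → E → ℝ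
  | 0, _, _, H => Φ H
  | N + 1, b, i, H => ∑ l, P i l * Vf P f Φ N (fun t => b (t + 1)) l (H + if b 0 then f i l else 0)

lemma path_Vf (P : Matrix (Fin n) (Fin n) ℝ) (f : Fin n → Fin n → E) (Φ : E → ℝ) (N : ℕ) :
    ∀ (b : ℕ → Bool) (pi0 : Fin n → ℝ) (H : Fin n → E),
    ∑ x : Fin (N+1) → Fin n, pathWeight N P pi0 x *
      Φ (H (x 0) + ∑ t : Fin N, if b t then f (x t.castSucc) (x t.succ) else 0) =
    ∑ i, pi0 i * Vf P f Φ N b i (H i) := by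
  induction N with
  | zero =>
    intro b pi0 H
    rw [← (Equiv.funUnique (Fin 1) (Fin n)).symm.sum_comp]
    simp [pathWeight, Vf]
  | succ N ih =>
    intro b pi0 H
    rw [← (Fin.consEquiv (fun _ : Fin (N+2) => Fin n)).sum_comp, Fintype.sum_prod_type]
    refine Finset.sum_congr rfl fun i _ => ?_
    have := ih (fun t => b (t+1)) (fun l => pi0 i * P i l) (fun l => H i + if b 0 then f i l else 0)
    simp only [Vf, Finset.mul_sum, ← mul_assoc]
    rw [← this]
    refine Finset.sum_congr rfl fun y _ => ?_
    have e1 : pathWeight (N+1) P pi0 (Fin.cons i y : Fin (N+2) → Fin n) =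
        pathWeight N P (fun l => pi0 i * P i l) y := by
      simp only [pathWeight, Fin.prod_univ_succ (n := N), Fin.cons_zero]
      simp [mul_assoc]
    have e2 : (∑ t : Fin (N+1), if b t then f ((Fin.cons i y : Fin (N+2) → Fin n) t.castSucc)
        ((Fin.cons i y : Fin (N+2) → Fin n) t.succ) else 0) =
        (if b 0 then f i (y 0) else 0) + ∑ t : Fin N, if b (t+1) then f (y t.castSucc) (y t.succ) else 0 := by
      rw [Fin.sum_univ_succ]
      simp
    change pathWeight (N+1) P pi0 (Fin.cons i y : Fin (N+2) → Fin n) *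
      Φ (H i + ∑ t : Fin (N+1), if b t then f ((Fin.cons i y : Fin (N+2) → Fin n) t.castSucc)
        ((Fin.cons i y : Fin (N+2) → Fin n) t.succ) else 0) = _
    rw [e1, e2, add_assoc]

lemma Vf_skip (P : Matrix (Fin n) (Fin n) ℝ) (f : Fin n → Fin n → E) (Φ : E → ℝ) (N r : ℕ) :
    ∀ (b : ℕ → Bool) (_ : ∀ t < r, b t = false) (i : Fin n) (H : E),
    Vf P f Φ (r + N) b i H = ∑ k, (P ^ r) i k * Vf P f Φ N (fun t => b (t + r)) k H := by
  induction r with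
  | zero => intro b _ i H; simp [one_apply]
  | succ r ih =>
    intro b hb i H
    rw [show r + 1 + N = (r + N) + 1 by ring]
    simp only [Vf]
    rw [hb 0 (by omega)]
    simp only [Bool.false_eq_true, if_false, add_zero]
    have : ∀ l, Vf P f Φ (r + N) (fun t => b (t + 1)) l H =
        ∑ k, (P ^ r) l k * Vf P f Φ N (fun t => b (t + (r + 1))) k H := by
      intro l
      rw [ih (fun t => b (t+1)) (fun t ht => hb _ (by omega)) l H]
      rfl
    simp only [this, pow_succ', Matrix.mul_apply, Finset.sum_mul, Finset.mul_sum]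
    rw [Finset.sum_comm]
    simp only [mul_assoc]

lemma pow_stoch (P : Matrix (Fin n) (Fin n) ℝ) (hP : RowStochastic P) (r : ℕ) : RowStochastic (P ^ r) := by
  induction r with
  | zero =>
    refine ⟨fun i j => ?_, fun i => ?_⟩
    · rw [pow_zero, one_apply]; split_ifs <;> norm_num
    · simp [one_apply]
  | succ r ih =>
    refine ⟨fun i j => ?_, fun i => ?_⟩
    · rw [pow_succ, Matrix.mul_apply]
      exact Finset.sum_nonneg fun k _ => mul_nonneg (ih.1 _ _) (hP.1 _ _)
    · simp only [pow_succ, Matrix.mul_apply]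
      rw [Finset.sum_comm]
      simp only [← Finset.mul_sum, hP.2, mul_one, ih.2]

lemma Vf_none (P : Matrix (Fin n) (Fin n) ℝ) (hP : RowStochastic P) (f : Fin n → Fin n → E) (Φ : E → ℝ) (N : ℕ)
    (b : ℕ → Bool) (hb : ∀ t < N, b t = false) (i : Fin n) (H : E) : Vf P f Φ N b i H = Φ H := by
  have := Vf_skip P f Φ 0 N b hb i H
  rw [add_zero] at this
  rw [this]
  simp only [Vf, ← Finset.sum_mul, (pow_stoch P hP N).2, one_mul]

/-- Bound for one phase, flagged at the last time of each block. -/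
lemma Vf_block (P : Matrix (Fin n) (Fin n) ℝ) (hP : RowStochastic P) (f : Fin n → Fin n → E) (Φ : E → ℝ)
    (S : E → Prop) (hS : ∀ H i l, S H → S (H + f i l)) (T : ℕ) (g : ℝ)
    (hstep : ∀ k H, S H → ∑ i, ∑ l, (P ^ T) k i * P i l * Φ (H + f i l) ≤ Real.exp g * Φ H)
    (K r : ℕ) (hr : r ≤ T) :
    ∀ i H, S H → Vf P f Φ (K * (T + 1) + r) (fun t => decide (t % (T+1) = T)) i H ≤ Real.exp (K * g) * Φ H := by
  induction K with
  | zero =>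
    intro i H hH
    rw [Vf_none P hP]
    · simp
    · intro t ht
      rw [decide_eq_false_iff_not, Nat.mod_eq_of_lt (by omega)]
      omega
  | succ K ih =>
    intro i H hH
    have e : (K + 1) * (T + 1) + r = T + ((K * (T + 1) + r) + 1) := by ring
    rw [e, Vf_skip P f Φ _ T]
    · have hsh : (fun t => decide ((t + 1 + T) % (T+1) = T)) = fun t => decide (t % (T+1) = T) := by
        funext t
        rw [add_assoc, add_comm 1 T, Nat.add_mod_right]
      simp only [Vf, hsh, zero_add]
      have h0 : T % (T + 1) = T := Nat.mod_eq_of_lt (by omega)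
      simp only [h0, decide_true, if_true]
      calc ∑ k, (P ^ T) i k * ∑ l, P k l * Vf P f Φ (K * (T + 1) + r) (fun t => decide (t % (T+1) = T)) l (H + f k l)
          ≤ ∑ k, (P ^ T) i k * ∑ l, P k l * (Real.exp (K * g) * Φ (H + f k l)) := by
            refine Finset.sum_le_sum fun k _ => mul_le_mul_of_nonneg_left (Finset.sum_le_sum fun l _ =>
              mul_le_mul_of_nonneg_left (ih l _ (hS _ _ _ hH)) (hP.1 _ _)) ((pow_stoch P hP T).1 _ _)
        _ = Real.exp (K * g) * ∑ k, ∑ l, (P ^ T) i k * P k l * Φ (H + f k l) := by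
            simp only [Finset.mul_sum]
            exact Finset.sum_congr rfl fun k _ => Finset.sum_congr rfl fun l _ => by ring
        _ ≤ Real.exp (K * g) * (Real.exp g * Φ H) := mul_le_mul_of_nonneg_left (hstep _ _ hH) (Real.exp_pos _).le
        _ = _ := by
            rw [← mul_assoc, ← Real.exp_add]; push_cast; ring_nf
    · intro t ht
      rw [decide_eq_false_iff_not, Nat.mod_eq_of_lt (by omega)]
      omega

/-- Bound for a general phase: with a first-step factor. -/
lemma Vf_phase (P : Matrix (Fin n) (Fin n) ℝ) (hP : RowStochastic P) (f : Fin n → Fin n → E) (Φ : E → ℝ)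
    (S : E → Prop) (hS : ∀ H i l, S H → S (H + f i l)) (hΦ : ∀ H, 0 ≤ Φ H) (T : ℕ) (g c' : ℝ) (hg : 0 ≤ g)
    (hstep : ∀ k H, S H → ∑ i, ∑ l, (P ^ T) k i * P i l * Φ (H + f i l) ≤ Real.exp g * Φ H)
    (ℓ : ℕ) (hℓ : ℓ ≤ T) (hc : 1 ≤ c')
    (hfirst : ∀ k H, S H → ∑ i, ∑ l, (P ^ ℓ) k i * P i l * Φ (H + f i l) ≤ c' * Φ H)
    (N : ℕ) (i : Fin n) (H : E) (hH : S H) :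
    Vf P f Φ N (fun t => decide (t % (T+1) = ℓ)) i H ≤
      c' * (Real.exp (((N - (ℓ + 1) : ℕ) : ℝ) / (T + 1) * g) * Φ H) := by
  rcases le_or_gt N ℓ with hN | hN
  · rw [Vf_none P hP, Nat.sub_eq_zero_of_le (by omega)]
    · simp; nlinarith [hΦ H]
    · intro t ht
      rw [decide_eq_false_iff_not, Nat.mod_eq_of_lt (by omega)]
      omega
  · obtain ⟨M, rfl⟩ : ∃ M, N = ℓ + (M + 1) := ⟨N - (ℓ + 1), by omega⟩
    have e0 : ℓ + (M + 1) - (ℓ + 1) = M := by omega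
    rw [e0, Vf_skip P f Φ _ ℓ]
    · have hsh : (fun t => decide ((t + 1 + ℓ) % (T+1) = ℓ)) = fun t => decide (t % (T+1) = T) := by
        funext t
        congr 1
        have h1 := Nat.div_add_mod t (T+1)
        have h2 : t % (T + 1) < T + 1 := Nat.mod_lt _ (by omega)
        set q := t / (T+1)
        set s := t % (T+1)
        rw [← h1, add_assoc, add_assoc, Nat.mul_add_mod]
        by_cases hs : s = T
        · rw [hs]
          simp only [eq_iff_iff, iff_true]
          rw [show T + (1 + ℓ) = ℓ + (T + 1) by ring, Nat.add_mod_right, Nat.mod_eq_of_lt (by omega)]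
        · simp only [hs, eq_iff_iff, iff_false]
          intro h
          rcases lt_or_ge (s + (1 + ℓ)) (T + 1) with h3 | h3
          · rw [Nat.mod_eq_of_lt h3] at h; omega
          · rw [Nat.mod_eq_sub_mod h3, Nat.mod_eq_of_lt (by omega)] at h; omega
      simp only [Vf, hsh, zero_add]
      have h0 : ℓ % (T + 1) = ℓ := Nat.mod_eq_of_lt (by omega)
      simp only [h0, decide_true, if_true]
      have hb := Vf_block P hP f Φ S hS T g hstep (M / (T+1)) (M % (T+1)) (Nat.lt_succ_iff.1 (Nat.mod_lt _ (by omega)))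
      rw [Nat.div_add_mod'] at hb
      have hK : ((M / (T+1) : ℕ) : ℝ) * g ≤ (M : ℝ) / (T + 1) * g := by
        refine mul_le_mul_of_nonneg_right ?_ hg
        have := @Nat.cast_div_le ℝ _ _ _ M (T+1)
        push_cast at this
        exact this
      calc ∑ k, (P ^ ℓ) i k * ∑ l, P k l * Vf P f Φ M (fun t => decide (t % (T+1) = T)) l (H + f k l)
          ≤ ∑ k, (P ^ ℓ) i k * ∑ l, P k l * (Real.exp ((M:ℝ) / (T + 1) * g) * Φ (H + f k l)) := by
            refine Finset.sum_le_sum fun k _ => mul_le_mul_of_nonneg_left (Finset.sum_le_sum fun l _ =>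
              mul_le_mul_of_nonneg_left ((hb l _ (hS _ _ _ hH)).trans ?_) (hP.1 _ _)) ((pow_stoch P hP ℓ).1 _ _)
            exact mul_le_mul_of_nonneg_right (Real.exp_le_exp.2 hK) (hΦ _)
        _ = Real.exp ((M:ℝ) / (T + 1) * g) * ∑ k, ∑ l, (P ^ ℓ) i k * P k l * Φ (H + f k l) := by
            simp only [Finset.mul_sum]
            exact Finset.sum_congr rfl fun k _ => Finset.sum_congr rfl fun l _ => by ring
        _ ≤ Real.exp ((M:ℝ) / (T + 1) * g) * (c' * Φ H) := mul_le_mul_of_nonneg_left (hfirst _ _ hH) (Real.exp_pos _).le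
        _ = _ := by ring
    · intro t ht
      rw [decide_eq_false_iff_not, Nat.mod_eq_of_lt (by omega)]
      omega
end
end MJ
end PartE

section PartF
open scoped BigOperators
open Matrix

namespace MJ

section
variable {n : ℕ} {E : Type*} [AddCommGroup E] [Module ℝ E]

lemma pathWeight_nonneg {N : ℕ} (P : Matrix (Fin n) (Fin n) ℝ) (hP : RowStochastic P) (pi0 : Fin n → ℝ)
    (h0 : IsProbVec pi0) (x) : 0 ≤ pathWeight N P pi0 x :=
  mul_nonneg (h0.1 _) (Finset.prod_nonneg fun _ _ => hP.1 _ _)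

lemma phase_exp (P : Matrix (Fin n) (Fin n) ℝ) (hP : RowStochastic P) (pi0 : Fin n → ℝ)
    (h0 : IsProbVec pi0) (f : Fin n → Fin n → E) (Φ : E → ℝ)
    (S : E → Prop) (hS0 : S 0) (hS : ∀ H i l, S H → S (H + f i l)) (hΦ : ∀ H, 0 ≤ Φ H)
    (T : ℕ) (g c' : ℝ) (hg : 0 ≤ g)
    (hconv : ∀ H : Fin (T+1) → E, Φ (∑ k, (1 / ((T:ℝ)+1)) • H k) ≤ ∑ k, (1 / ((T:ℝ)+1)) * Φ (H k))
    (hstep : ∀ k H, S H → ∑ i, ∑ l, (P ^ T) k i * P i l * Φ (H + f i l) ≤ Real.exp g * Φ H)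
    (hc : 1 ≤ c') (hfirst : ∀ i l H, S H → Φ (H + f i l) ≤ c' * Φ H) (N : ℕ) :
    ∑ x : Fin (N+1) → Fin n, pathWeight N P pi0 x *
      Φ ((1 / ((T:ℝ)+1)) • ∑ t : Fin N, f (x t.castSucc) (x t.succ)) ≤
    (1 + T * c') / (T + 1) * (Real.exp (N / (T + 1) * g) * Φ 0) := by
  have hT : (0:ℝ) < T + 1 := by positivity
  set M : ℝ := Real.exp (N / (T + 1) * g) * Φ 0 with hM
  have hM0 : 0 ≤ M := mul_nonneg (Real.exp_pos _).le (hΦ 0)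
  -- phase bounds
  have hlt : ∀ ℓ < T, ∀ i, Vf P f Φ N (fun t => decide (t % (T+1) = ℓ)) i 0 ≤ c' * M := by
    intro ℓ hℓ i
    refine (Vf_phase P hP f Φ S hS hΦ T g c' hg hstep ℓ hℓ.le hc ?_ N i 0 hS0).trans ?_
    · intro k H hH
      calc ∑ i, ∑ l, (P ^ ℓ) k i * P i l * Φ (H + f i l) ≤ ∑ i, ∑ l, (P ^ ℓ) k i * P i l * (c' * Φ H) := by
            refine Finset.sum_le_sum fun i _ => Finset.sum_le_sum fun l _ => ?_
            exact mul_le_mul_of_nonneg_left (hfirst i l H hH)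
              (mul_nonneg ((pow_stoch P hP ℓ).1 _ _) (hP.1 _ _))
        _ = c' * Φ H := by
            simp only [← Finset.sum_mul, ← Finset.mul_sum, hP.2, (pow_stoch P hP ℓ).2, mul_one, one_mul]
    · refine mul_le_mul_of_nonneg_left (mul_le_mul_of_nonneg_right (Real.exp_le_exp.2 ?_) (hΦ 0)) (by linarith)
      refine mul_le_mul_of_nonneg_right (div_le_div_of_nonneg_right ?_ hT.le) hg
      exact_mod_cast Nat.sub_le _ _
  have hlast : ∀ i, Vf P f Φ N (fun t => decide (t % (T+1) = T)) i 0 ≤ M := by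
    intro i
    have := Vf_block P hP f Φ S hS T g hstep (N / (T+1)) (N % (T+1))
      (Nat.lt_succ_iff.1 (Nat.mod_lt N (Nat.succ_pos T))) i 0 hS0
    rw [Nat.div_add_mod'] at this
    refine this.trans (mul_le_mul_of_nonneg_right (Real.exp_le_exp.2 ?_) (hΦ 0))
    refine mul_le_mul_of_nonneg_right ?_ hg
    have := @Nat.cast_div_le ℝ _ _ _ N (T+1)
    simpa using this
  -- decomposition
  have hdec : ∀ x : Fin (N+1) → Fin n, (1 / ((T:ℝ)+1)) • ∑ t : Fin N, f (x t.castSucc) (x t.succ) =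
      ∑ ℓ : Fin (T+1), (1 / ((T:ℝ)+1)) • ((fun _ => (0:E)) (x 0) + ∑ t : Fin N,
        if (fun t : ℕ => decide (t % (T+1) = (ℓ:ℕ))) t then f (x t.castSucc) (x t.succ) else 0) := by
    intro x
    rw [← Finset.smul_sum]
    congr 1
    simp only [zero_add]
    rw [Finset.sum_comm]
    refine Finset.sum_congr rfl fun t _ => ?_
    rw [Finset.sum_eq_single (⟨(t:ℕ) % (T+1), Nat.mod_lt _ (Nat.succ_pos T)⟩ : Fin (T+1))]
    · simp
    · intro b _ hb
      rw [if_neg]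
      simp only [decide_eq_true_eq]
      intro h
      exact hb (Fin.ext h.symm)
    · simp
  calc ∑ x : Fin (N+1) → Fin n, pathWeight N P pi0 x *
      Φ ((1 / ((T:ℝ)+1)) • ∑ t : Fin N, f (x t.castSucc) (x t.succ))
      ≤ ∑ x : Fin (N+1) → Fin n, pathWeight N P pi0 x * ∑ ℓ : Fin (T+1), (1 / ((T:ℝ)+1)) *
        Φ ((fun _ => (0:E)) (x 0) + ∑ t : Fin N,
        if (fun t : ℕ => decide (t % (T+1) = (ℓ:ℕ))) t then f (x t.castSucc) (x t.succ) else 0) := by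
        refine Finset.sum_le_sum fun x _ => mul_le_mul_of_nonneg_left ?_ (pathWeight_nonneg P hP pi0 h0 x)
        rw [hdec x]
        exact hconv _
    _ = ∑ ℓ : Fin (T+1), (1 / ((T:ℝ)+1)) * ∑ i, pi0 i * Vf P f Φ N (fun t : ℕ => decide (t % (T+1) = (ℓ:ℕ))) i 0 := by
        simp only [Finset.mul_sum (s := (Finset.univ : Finset (Fin (T+1))))]
        rw [Finset.sum_comm]
        refine Finset.sum_congr rfl fun ℓ _ => ?_
        rw [← path_Vf P f Φ N _ pi0 (fun _ => 0), Finset.mul_sum]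
        exact Finset.sum_congr rfl fun x _ => by ring
    _ ≤ ∑ ℓ : Fin (T+1), (1 / ((T:ℝ)+1)) * (if (ℓ:ℕ) = T then M else c' * M) := by
        refine Finset.sum_le_sum fun ℓ _ => mul_le_mul_of_nonneg_left ?_ (by positivity)
        calc _ ≤ ∑ i, pi0 i * (if (ℓ:ℕ) = T then M else c' * M) := by
              refine Finset.sum_le_sum fun i _ => mul_le_mul_of_nonneg_left ?_ (h0.1 i)
              split_ifs with h
              · rw [h]; exact hlast i
              · exact hlt ℓ (by have := ℓ.2; omega) i
          _ = _ := by rw [← Finset.sum_mul, h0.2, one_mul]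
    _ = _ := by
        rw [← Finset.mul_sum, Fin.sum_univ_castSucc]
        have : ∀ i : Fin T, ((i.castSucc : Fin (T+1)) : ℕ) ≠ T := fun i => by
          have := i.2; simp; omega
        simp only [this, if_false, Fin.val_last, if_true, Finset.sum_const, Finset.card_univ, Fintype.card_fin,
          nsmul_eq_mul]
        ring

lemma tail_bound (P : Matrix (Fin n) (Fin n) ℝ) (hP : RowStochastic P) (pi0 : Fin n → ℝ)
    (h0 : IsProbVec pi0) (f : Fin n → Fin n → E) (Φ : E → ℝ)
    (S : E → Prop) (hS0 : S 0) (hS : ∀ H i l, S H → S (H + f i l)) (hΦ : ∀ H, 0 ≤ Φ H)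
    (T : ℕ) (g c' : ℝ) (hg : 0 ≤ g)
    (hconv : ∀ H : Fin (T+1) → E, Φ (∑ k, (1 / ((T:ℝ)+1)) • H k) ≤ ∑ k, (1 / ((T:ℝ)+1)) * Φ (H k))
    (hstep : ∀ k H, S H → ∑ i, ∑ l, (P ^ T) k i * P i l * Φ (H + f i l) ≤ Real.exp g * Φ H)
    (hc : 1 ≤ c') (hfirst : ∀ i l H, S H → Φ (H + f i l) ≤ c' * Φ H) (N : ℕ)
    (Ev : Set (Fin (N+1) → Fin n)) (y : ℝ)
    (hEv : ∀ x ∈ Ev, Real.exp (N / (T + 1) * y) ≤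
      Φ ((1 / ((T:ℝ)+1)) • ∑ t : Fin N, f (x t.castSucc) (x t.succ))) :
    pathProb N P pi0 Ev ≤ (1 + T * c') / (T + 1) * Φ 0 * Real.exp (-(N / (T + 1) * (y - g))) := by
  have h1 := phase_exp P hP pi0 h0 f Φ S hS0 hS hΦ T g c' hg hconv hstep hc hfirst N
  have h2 : pathProb N P pi0 Ev * Real.exp (N / (T + 1) * y) ≤ ∑ x : Fin (N+1) → Fin n, pathWeight N P pi0 x *
      Φ ((1 / ((T:ℝ)+1)) • ∑ t : Fin N, f (x t.castSucc) (x t.succ)) := by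
    rw [pathProb, Finset.sum_mul]
    refine Finset.sum_le_sum fun x _ => ?_
    have hw := pathWeight_nonneg P hP pi0 h0 x
    by_cases hx : x ∈ Ev
    · rw [Set.indicator_of_mem hx]
      exact mul_le_mul_of_nonneg_left (hEv x hx) hw
    · rw [Set.indicator_of_notMem hx, zero_mul]
      exact mul_nonneg hw (hΦ _)
  have h3 := h2.trans h1
  have e : Real.exp (-(N / (T + 1) * (y - g))) = Real.exp (N / (T + 1) * g) / Real.exp ((N:ℝ) / (T + 1) * y) := by
    rw [← Real.exp_sub]; congr 1; ring
  rw [e, ← mul_div_assoc, le_div_iff₀ (Real.exp_pos _)]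
  calc _ ≤ _ := h3
    _ = _ := by ring
end
end MJ
end PartF

section PartG
open scoped BigOperators
open Matrix

namespace MJ

section
variable {n : ℕ}

lemma dil_add (A B : Matrix (Fin n) (Fin n) ℝ) : dil (A + B) = dil A + dil B := by
  ext a b
  rcases a with a | a <;> rcases b with b | b <;> simp [dil]

lemma dil_sub (A B : Matrix (Fin n) (Fin n) ℝ) : dil (A - B) = dil A - dil B := by
  ext a b
  rcases a with a | a <;> rcases b with b | b <;> simp [dil]

lemma dil_smul (c : ℝ) (A : Matrix (Fin n) (Fin n) ℝ) : dil (c • A) = c • dil A := by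
  ext a b
  rcases a with a | a <;> rcases b with b | b <;> simp [dil]

lemma dil_sum {ι : Type*} (s : Finset ι) (A : ι → Matrix (Fin n) (Fin n) ℝ) :
    dil (∑ k ∈ s, A k) = ∑ k ∈ s, dil (A k) := by
  induction s using Finset.cons_induction with
  | empty =>
    ext a b
    rcases a with a | a <;> rcases b with b | b <;> simp [dil]
  | cons a s ha ih => rw [Finset.sum_cons, Finset.sum_cons, dil_add, ih]

lemma sum_single_empF {N : ℕ} (hN : 0 < N) (x : Fin (N+1) → Fin n) :
    ∑ t : Fin N, single (x t.castSucc) (x t.succ) (1:ℝ) = (N:ℝ) • empF x := by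
  ext i j
  have hN' : (N:ℝ) ≠ 0 := by positivity
  rw [Matrix.sum_apply]
  simp only [empF, countTrans, Matrix.smul_apply, of_apply, smul_eq_mul, single_apply]
  rw [mul_div_cancel₀ _ hN', Finset.card_filter]
  push_cast
  rfl

lemma sum_f {N : ℕ} (hN : 0 < N) (x : Fin (N+1) → Fin n) (θ τ : ℝ) (F : Matrix (Fin n) (Fin n) ℝ) :
    (1 / τ) • ∑ t : Fin N, θ • (dil (single (x t.castSucc) (x t.succ) (1:ℝ)) - dil F) =
      (N / τ * θ) • dil (empF x - F) := by
  rw [← Finset.smul_sum, Finset.sum_sub_distrib, ← dil_sum, sum_single_empF hN, dil_smul, dil_sub]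
  simp only [Finset.sum_const, Finset.card_univ, Fintype.card_fin]
  rw [← Nat.cast_smul_eq_nsmul ℝ, ← smul_sub, smul_smul, smul_smul]
  congr 1
  ring

lemma l2_sq {k : ℕ} (v : Fin k → ℝ) : l2 v ^ 2 = ∑ j, v j ^ 2 :=
  Real.sq_sqrt (Finset.sum_nonneg fun _ _ => sq_nonneg _)

lemma spec_witness (A : Matrix (Fin n) (Fin n) ℝ) (ε e : ℝ) (h : ε ≤ spec A) (he : e < ε) (he0 : 0 ≤ e) :
    ∃ w : Fin n ⊕ Fin n → ℝ, w ⬝ᵥ w = 1 ∧ e ≤ w ⬝ᵥ (dil A *ᵥ w) := by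
  have hne : {c : ℝ | ∃ x : Fin n → ℝ, l2 x ≤ 1 ∧ c = l2 (A.mulVec x)}.Nonempty :=
    ⟨_, 0, by simp [l2], rfl⟩
  obtain ⟨c, ⟨x, hx, rfl⟩, hc⟩ := exists_lt_of_lt_csSup hne (lt_of_lt_of_le he h)
  set b := l2 (A *ᵥ x) with hb
  have hb0 : 0 < b := lt_of_le_of_lt he0 hc
  set r := l2 x with hr
  have hr0 : 0 < r := by
    have hr1 : 0 ≤ r := Real.sqrt_nonneg _
    rcases hr1.lt_or_eq with h | h
    · exact h
    · exfalso
      have h1 := l2_sq x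
      rw [← hr, ← h] at h1
      have hx0 : x = 0 := by
        funext i
        have := (Finset.sum_eq_zero_iff_of_nonneg (s := Finset.univ) (f := fun j => x j ^ 2)
          (fun _ _ => sq_nonneg _)).1 (by simpa using h1.symm) i (Finset.mem_univ i)
        simpa using this
      rw [hb, hx0] at hb0
      simp [l2] at hb0
  set k := Real.sqrt 2 with hk
  have hk2 : k ^ 2 = 2 := Real.sq_sqrt (by norm_num)
  have hk0 : 0 < k := Real.sqrt_pos.2 (by norm_num)
  have hbs := l2_sq (A *ᵥ x)
  have hrs := l2_sq x
  rw [← hb] at hbs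
  rw [← hr] at hrs
  refine ⟨Sum.elim (fun i => (A *ᵥ x) i / (k * b)) (fun i => x i / (k * r)), ?_, ?_⟩
  · simp only [dotProduct, Fintype.sum_sum_type, Sum.elim_inl, Sum.elim_inr]
    have e1 : ∀ i, (A *ᵥ x) i / (k * b) * ((A *ᵥ x) i / (k * b)) = (A *ᵥ x) i ^ 2 * (1 / (2 * b ^ 2)) := by
      intro i; rw [← hk2]; field_simp
    have e2 : ∀ i, x i / (k * r) * (x i / (k * r)) = x i ^ 2 * (1 / (2 * r ^ 2)) := by
      intro i; rw [← hk2]; field_simp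
    simp only [e1, e2, ← Finset.sum_mul, ← hbs, ← hrs]
    field_simp
    norm_num
  · rw [dil_form]
    simp only [Sum.elim_inl, Sum.elim_inr]
    have e3 : 2 * ∑ i, ∑ l, A i l * ((A *ᵥ x) i / (k * b) * (x l / (k * r))) =
        (∑ i, (A *ᵥ x) i ^ 2) * (1 / (b * r)) := by
      rw [Finset.sum_mul, Finset.mul_sum]
      refine Finset.sum_congr rfl fun i _ => ?_
      have : ∀ l, A i l * ((A *ᵥ x) i / (k * b) * (x l / (k * r))) =
          (A i l * x l) * ((A *ᵥ x) i * (1 / (2 * b * r))) := by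
        intro l; rw [← hk2]; field_simp
      simp only [this, ← Finset.sum_mul]
      have e4 : ∑ l, A i l * x l = (A *ᵥ x) i := rfl
      rw [e4]
      field_simp
    rw [e3, ← hbs]
    have : b ^ 2 * (1 / (b * r)) = b / r := by field_simp
    rw [this]
    have : b ≤ b / r := by
      rw [le_div_iff₀ hr0]; nlinarith
    linarith

lemma spec_tail (P : Matrix (Fin n) (Fin n) ℝ) (hP : RowStochastic P) (piv pi0 : Fin n → ℝ)
    (hpiv : IsStationary P piv) (h0 : IsProbVec pi0) (T : ℕ) {θ ω m a L A B C q q2 ε : ℝ} (hθ : 0 < θ)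
    (hε : 0 < ε) (hm : ∀ i, piv i ≤ m) (hm0 : 0 ≤ m)
    (htv : ∀ k, (1/2) * ∑ i, |(P ^ T) k i - piv i| ≤ a)
    (hcr : Crit (Real.exp (-ω) * Real.sinh θ) (Real.exp (-ω) * (Real.cosh θ - 1))
      (θ - Real.exp (-ω) * Real.sinh θ) m a L A B C q q2) {N : ℕ} (hN : 0 < N) :
    pathProb N P pi0 {x | ε ≤ spec (empF x - Matrix.diagonal piv * P)} ≤
      (1 + T * Real.exp (Real.sqrt 2 * θ)) / (T + 1) * (2 * n) *
        Real.exp (-(N / (T + 1) * (θ * ε - (L + (Real.exp (-ω) + ω - 1))))) := by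
  have hg : 0 ≤ L + (Real.exp (-ω) + ω - 1) := by
    have h1 := Real.add_one_le_exp (-ω)
    have h2 : 0 ≤ L := by
      have := hcr.hL
      have := mul_nonneg hcr.hκ (add_nonneg hm0 hcr.ha)
      linarith
    linarith
  have hF0 : ∀ i l, 0 ≤ (diagonal piv * P) i l := fun i l => by
    rw [diagonal_mul]; exact mul_nonneg (hpiv.1.1 _) (hP.1 _ _)
  have hF1 : ∑ i, ∑ l, (diagonal piv * P) i l ≤ 1 := by
    simp only [diagonal_mul, ← Finset.mul_sum, hP.2, mul_one, hpiv.1.2, le_refl]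
  have key := tail_bound P hP pi0 h0
    (fun i l => θ • (dil (single i l (1:ℝ)) - dil (diagonal piv * P))) Phi (fun H => Hᵀ = H)
    (by simp) (by
      intro H i l hH
      rw [transpose_add, hH, transpose_smul, transpose_sub, dil_symm, dil_symm]) Phi_nonneg T
    (L + (Real.exp (-ω) + ω - 1)) (Real.exp (Real.sqrt 2 * θ)) hg
    (by
      intro H
      refine Phi_convex _ (fun _ => by positivity) ?_ H
      simp
      field_simp)
    (by
      intro k H hH
      have hst := pow_stoch P hP T
      refine step_dil (fun i => (P ^ T) k i) (fun i => hst.1 _ _) (hst.2 k) P hP.1 hP.2 piv H hH θ ω L ?_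
      intro x z
      exact lin_crit P hP.1 hP.2 piv (fun i => (P ^ T) k i) hpiv.1.1 hpiv.2 (by rw [hst.2 k, hpiv.1.2]) hm
        (htv k) hcr x z)
    (by
      rw [← Real.exp_zero]; exact Real.exp_le_exp.2 (by positivity))
    (by
      intro i l H hH
      exact Phi_shift _ _ _ (crude_form _ hF0 hF1 i l θ hθ.le))
    N {x | ε ≤ spec (empF x - Matrix.diagonal piv * P)} (θ * ε) (by
      intro x hx
      rw [sum_f hN]
      have hc : (0:ℝ) < N / (T + 1) * θ := by positivity
      set c : ℝ := N / (T + 1) * θ with hcd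
      have h1 : ∀ e, 0 ≤ e → e < ε → Real.exp (c * e) ≤ Phi (c • dil (empF x - diagonal piv * P)) := by
        intro e he0 he
        obtain ⟨w, hw, hw2⟩ := spec_witness _ ε e hx he he0
        refine le_trans (Real.exp_le_exp.2 ?_) (exp_form_le_Phi _ ?_ w hw)
        · rw [smul_mulVec, dotProduct_smul, smul_eq_mul]
          exact mul_le_mul_of_nonneg_left hw2 hc.le
        · rw [transpose_smul, dil_symm]
      rw [show (N:ℝ) / (T + 1) * (θ * ε) = c * ε by rw [hcd]; ring]
      have h2 : Filter.Tendsto (fun e => Real.exp (c * e)) (nhdsWithin ε (Set.Iio ε)) (nhds (Real.exp (c * ε))) := by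
        have : Continuous (fun e => Real.exp (c * e)) := by fun_prop
        exact (this.tendsto ε).mono_left nhdsWithin_le_nhds
      refine le_of_tendsto h2 ?_
      filter_upwards [Ioo_mem_nhdsLT hε] with e he
      exact h1 e he.1.le he.2)
  refine key.trans ?_
  refine mul_le_mul_of_nonneg_right (mul_le_mul_of_nonneg_left ?_ (by positivity)) (Real.exp_pos _).le
  refine Phi_zero.trans (le_of_eq ?_)
  simp
  ring

end
end MJ
end PartG

section PartH
open scoped BigOperators
open Matrix

namespace MJ

section
variable {n : ℕ}

lemma contr (Q : Matrix (Fin n) (Fin n) ℝ) (hQ : RowStochastic Q) (c : Fin n → ℝ) (hc : ∀ i j, c j ≤ Q i j)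
    (v : Fin n → ℝ) (hv : ∑ i, v i = 0) :
    ∑ j, |∑ i, v i * Q i j| ≤ (1 - ∑ j, c j) * ∑ i, |v i| := by
  have e : ∀ j, ∑ i, v i * Q i j = ∑ i, v i * (Q i j - c j) := by
    intro j
    simp only [mul_sub, Finset.sum_sub_distrib, ← Finset.sum_mul, hv]
    ring
  calc ∑ j, |∑ i, v i * Q i j| ≤ ∑ j, ∑ i, |v i| * (Q i j - c j) := by
        refine Finset.sum_le_sum fun j _ => ?_
        rw [e j]
        refine (Finset.abs_sum_le_sum_abs _ _).trans (Finset.sum_le_sum fun i _ => ?_)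
        rw [abs_mul, abs_of_nonneg (sub_nonneg.2 (hc i j))]
    _ = ∑ i, |v i| * (1 - ∑ j, c j) := by
        rw [Finset.sum_comm]
        refine Finset.sum_congr rfl fun i _ => ?_
        rw [← Finset.mul_sum, Finset.sum_sub_distrib, hQ.2]
    _ = _ := by rw [← Finset.sum_mul, mul_comm]

lemma contr2 (Q : Matrix (Fin n) (Fin n) ℝ) (piv : Fin n → ℝ) (η : ℝ)
    (h : ∀ i, (1/2) * ∑ j, |Q i j - piv j| ≤ η)
    (v : Fin n → ℝ) (hv : ∑ i, v i = 0) :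
    ∑ j, |∑ i, v i * Q i j| ≤ (2 * η) * ∑ i, |v i| := by
  have e : ∀ j, ∑ i, v i * Q i j = ∑ i, v i * (Q i j - piv j) := by
    intro j
    simp only [mul_sub, Finset.sum_sub_distrib, ← Finset.sum_mul, hv]
    ring
  calc ∑ j, |∑ i, v i * Q i j| ≤ ∑ j, ∑ i, |v i| * |Q i j - piv j| := by
        refine Finset.sum_le_sum fun j _ => ?_
        rw [e j]
        refine (Finset.abs_sum_le_sum_abs _ _).trans (Finset.sum_le_sum fun i _ => ?_)
        rw [abs_mul]
    _ = ∑ i, |v i| * ∑ j, |Q i j - piv j| := by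
        rw [Finset.sum_comm]
        exact Finset.sum_congr rfl fun i _ => by rw [Finset.mul_sum]
    _ ≤ ∑ i, |v i| * (2 * η) :=
        Finset.sum_le_sum fun i _ => mul_le_mul_of_nonneg_left (by linarith [h i]) (abs_nonneg _)
    _ = _ := by rw [← Finset.sum_mul, mul_comm]

lemma stat_pow (P : Matrix (Fin n) (Fin n) ℝ) (piv : Fin n → ℝ) (h : IsStationary P piv) (s : ℕ) (j : Fin n) :
    ∑ i, piv i * (P ^ s) i j = piv j := by
  induction s generalizing j with
  | zero => simp [one_apply]
  | succ s ih =>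
    simp only [pow_succ, Matrix.mul_apply, Finset.mul_sum]
    rw [Finset.sum_comm]
    simp only [← mul_assoc, ← Finset.sum_mul, ih, h.2]

lemma row_split (P : Matrix (Fin n) (Fin n) ℝ) (piv : Fin n → ℝ) (h : IsStationary P piv) (t s : ℕ) (k j : Fin n) :
    (P ^ (t + s)) k j - piv j = ∑ i, ((P ^ t) k i - piv i) * (P ^ s) i j := by
  rw [pow_add, Matrix.mul_apply]
  simp only [sub_mul, Finset.sum_sub_distrib, stat_pow P piv h]

lemma row_zero (P : Matrix (Fin n) (Fin n) ℝ) (hP : RowStochastic P) (piv : Fin n → ℝ) (h : IsStationary P piv)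
    (t : ℕ) (k : Fin n) : ∑ i, ((P ^ t) k i - piv i) = 0 := by
  rw [Finset.sum_sub_distrib, (pow_stoch P hP t).2, h.1.2, sub_self]

lemma tv_mono (P : Matrix (Fin n) (Fin n) ℝ) (hP : RowStochastic P) (piv : Fin n → ℝ) (h : IsStationary P piv)
    (t s : ℕ) (a : ℝ) (hta : ∀ k, (1/2) * ∑ j, |(P ^ t) k j - piv j| ≤ a) (k : Fin n) :
    (1/2) * ∑ j, |(P ^ (t + s)) k j - piv j| ≤ a := by
  refine le_trans ?_ (hta k)
  simp only [row_split P piv h]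
  have := contr _ (pow_stoch P hP s) (fun _ => 0) (pow_stoch P hP s).1 _ (row_zero P hP piv h t k)
  simp at this
  linarith

lemma tv_two (P : Matrix (Fin n) (Fin n) ℝ) (hP : RowStochastic P) (piv : Fin n → ℝ) (h : IsStationary P piv)
    (t T : ℕ) (hT : t + t ≤ T) (η m : ℝ) (i0 : Fin n) (hi0 : piv i0 = m) (hη : 0 ≤ η) (hηm : η ≤ m)
    (hta : ∀ k, (1/2) * ∑ j, |(P ^ t) k j - piv j| ≤ η) (k : Fin n) :
    (1/2) * ∑ j, |(P ^ T) k j - piv j| ≤ min (η * (2 * η)) (η * (1 - m + η)) := by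
  obtain ⟨s, rfl⟩ : ∃ s, T = t + t + s := ⟨T - (t + t), by omega⟩
  refine tv_mono P hP piv h (t + t) s _ ?_ k
  clear k
  intro k
  simp only [row_split P piv h]
  refine le_min ?_ ?_
  · have := contr2 (P ^ t) piv η hta _ (row_zero P hP piv h t k)
    have h2 := mul_le_mul_of_nonneg_left (hta k) (by linarith : 0 ≤ 2 * η)
    linarith
  · have hcol : ∀ i j, (fun j => if j = i0 then m - η else 0) j ≤ (P ^ t) i j := by
      intro i j
      dsimp only
      split_ifs with hj
      · subst hj
        have h1 := row_zero P hP piv h t i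
        have h2 := hta i
        rw [← Finset.add_sum_erase _ _ (Finset.mem_univ j)] at h1 h2
        have h3 := Finset.abs_sum_le_sum_abs (fun i_1 => (P ^ t) i i_1 - piv i_1) (Finset.univ.erase j)
        have h4 := neg_abs_le ((P ^ t) i j - piv j)
        have h5 := le_abs_self (∑ x ∈ Finset.univ.erase j, ((P ^ t) i x - piv x))
        linarith
      · exact (pow_stoch P hP t).1 _ _
    have := contr (P ^ t) (pow_stoch P hP t) _ hcol _ (row_zero P hP piv h t k)
    simp only [Finset.sum_ite_eq', Finset.mem_univ, if_true] at this
    have hm1 : m ≤ 1 := by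
      rw [← hi0, ← h.1.2]
      exact Finset.single_le_sum (fun i _ => h.1.1 i) (Finset.mem_univ i0)
    have h2 := mul_le_mul_of_nonneg_left (hta k) (by linarith : 0 ≤ 1 - (m - η))
    linarith

lemma mix_nonempty (hn : 0 < n) (P : Matrix (Fin n) (Fin n) ℝ) (hP : RowStochastic P) (hE : Ergodic' P)
    (piv : Fin n → ℝ) (h : IsStationary P piv) (η : ℝ) (hη : 0 < η) :
    ∃ t, ∀ k, (1/2) * ∑ j, |(P ^ t) k j - piv j| ≤ η := by
  obtain ⟨t, ht⟩ := hE
  haveI : Nonempty (Fin n) := ⟨⟨0, hn⟩⟩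
  obtain ⟨⟨i0, j0⟩, hmin⟩ := Finite.exists_min (fun p : Fin n × Fin n => (P ^ t) p.1 p.2)
  set δ := (P ^ t) i0 j0 with hδ
  have hδ0 : 0 < δ := ht _ _
  have hst := pow_stoch P hP t
  set q := 1 - ∑ _j : Fin n, δ with hq
  have hq1 : q < 1 := by
    rw [hq]
    have : 0 < ∑ _j : Fin n, δ := Finset.sum_pos (fun _ _ => hδ0) Finset.univ_nonempty
    linarith
  have hq0 : 0 ≤ q := by
    rw [hq, ← hst.2 i0, ← Finset.sum_sub_distrib]
    exact Finset.sum_nonneg fun j _ => sub_nonneg.2 (hmin (i0, j))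
  have hk : ∀ K k, ∑ j, |(P ^ (K * t)) k j - piv j| ≤ q ^ K * 2 := by
    intro K
    induction K with
    | zero =>
      intro k
      simp only [zero_mul, pow_zero, one_mul]
      calc ∑ j, |(1 : Matrix (Fin n) (Fin n) ℝ) k j - piv j| ≤
          ∑ j, ((1 : Matrix (Fin n) (Fin n) ℝ) k j + piv j) := by
            refine Finset.sum_le_sum fun j _ => ?_
            have h1 := h.1.1 j
            have h2 : 0 ≤ (1 : Matrix (Fin n) (Fin n) ℝ) k j := by
              rw [one_apply]; split_ifs <;> norm_num
            rw [abs_le]; constructor <;> linarith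
        _ = 2 := by
            rw [Finset.sum_add_distrib, h.1.2]
            simp [one_apply]
            norm_num
    | succ K ih =>
      intro k
      rw [add_mul, one_mul]
      simp only [row_split P piv h]
      have := contr (P ^ t) hst (fun _ => δ) (fun i j => hmin (i, j)) _ (row_zero P hP piv h (K * t) k)
      have h2 := mul_le_mul_of_nonneg_left (ih k) hq0
      refine this.trans (h2.trans (le_of_eq ?_))
      ring
  obtain ⟨K, hK⟩ := exists_pow_lt_of_lt_one hη hq1
  exact ⟨K * t, fun k => by linarith [hk K k]⟩

lemma mix_spec (hn : 0 < n) (P : Matrix (Fin n) (Fin n) ℝ) (hP : RowStochastic P) (hE : Ergodic' P)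
    (piv : Fin n → ℝ) (h : IsStationary P piv) (η : ℝ) (hη : 0 < η) (k : Fin n) :
    (1/2) * ∑ j, |(P ^ (mixingTime P piv η)) k j - piv j| ≤ η :=
  Nat.sInf_mem (mix_nonempty hn P hP hE piv h η hη) k

end
end MJ
end PartH

section PartI
open scoped BigOperators
open Matrix

namespace MJ

/-- There are parameters for the Chernoff method achieving the rate `j * ρ`. -/
def Good (j cj ε m a : ℝ) : Prop :=
  ∃ θ ω L A B C q q2 : ℝ, 0 < θ ∧ Real.exp (Real.sqrt 2 * θ) ≤ cj ∧
    Crit (Real.exp (-ω) * Real.sinh θ) (Real.exp (-ω) * (Real.cosh θ - 1))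
      (θ - Real.exp (-ω) * Real.sinh θ) m a L A B C q q2 ∧
    L + (Real.exp (-ω) + ω - 1) + j * (3 / 4 * ε ^ 2 / (12 * m + ε)) ≤ θ * ε

lemma crit_mk {s κ d m a L A B C q q2 D2 : ℝ} (hs : 0 ≤ s) (hκ : 0 ≤ κ) (hm : 0 < m) (ha : 0 ≤ a) (hA : 0 < A)
    (hB : 0 < B) (hC0 : 0 < C) (hC : κ ≤ C) (hC' : κ * C ≤ s ^ 2) (hq : 0 ≤ q) (hq' : κ * (A + B) - 2 * d * s ≤ q)
    (hq2 : 0 ≤ q2) (hq2' : κ * (C - A) + 2 * d * s ≤ q2) (hD : d ^ 2 ≤ D2)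
    (h1 : (κ + D2 / A) * m + 0 * a ≤ L) (h2 : q / B * m + (κ + s ^ 2 / B) * a ≤ L)
    (h3 : q2 / C * m + (s ^ 2 / C - κ) * a ≤ L) (h4 : (κ + A) * m + (B + C) * a ≤ L) :
    Crit s κ d m a L A B C q q2 := by
  refine ⟨hs, hκ, ha, hA.le, hB.le, hC, ?_, ?_, ?_, hq, hq', ?_, hq2, hq2', hC', by linarith⟩
  · nlinarith [mul_pos hA hm, mul_nonneg hB.le ha, mul_nonneg (sub_nonneg.2 hC) ha]
  · have e : A * (L - κ * m) ≥ A * (D2 / A * m) := mul_le_mul_of_nonneg_left (by linarith) hA.le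
    have e2 : A * (D2 / A * m) = D2 * m := by field_simp
    nlinarith
  · have e : B * (L - κ * a) ≥ B * (q / B * m + s ^ 2 / B * a) := mul_le_mul_of_nonneg_left (by linarith) hB.le
    have e2 : B * (q / B * m + s ^ 2 / B * a) = s ^ 2 * a + q * m := by field_simp; ring
    linarith
  · have e : C * (L + κ * a) ≥ C * (q2 / C * m + s ^ 2 / C * a) := mul_le_mul_of_nonneg_left (by linarith) hC0.le
    have e2 : C * (q2 / C * m + s ^ 2 / C * a) = s ^ 2 * a + q2 * m := by field_simp; ring
    linarith

lemma rate_ge {m ε rl rh X Y c J : ℝ} (hm : 0 < m) (hrl : 0 < rl) (hr : rl < rh) (h1 : rl * m ≤ ε) (h2 : ε ≤ rh * m)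
    (hY : c - Y ≤ J) (e1 : X + Y * rl ≤ c * rl - J * rl ^ 2 / (12 + rl))
    (e2 : X + Y * rh ≤ c * rh - J * rh ^ 2 / (12 + rh)) :
    X * m + Y * ε ≤ c * ε - J * ε ^ 2 / (12 * m + ε) := by
  have hε : 0 < ε := lt_of_lt_of_le (mul_pos hrl hm) h1
  have hp : 0 < 12 * m + ε := by positivity
  have f1 : 0 ≤ ((c - Y) * rl - X) * (12 + rl) - J * rl ^ 2 := by
    have : J * rl ^ 2 / (12 + rl) ≤ (c - Y) * rl - X := by linarith
    rw [div_le_iff₀ (by linarith)] at this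
    linarith
  have f2 : 0 ≤ ((c - Y) * rh - X) * (12 + rh) - J * rh ^ 2 := by
    have : J * rh ^ 2 / (12 + rh) ≤ (c - Y) * rh - X := by linarith
    rw [div_le_iff₀ (by linarith)] at this
    linarith
  have : J * ε ^ 2 / (12 * m + ε) ≤ (c - Y) * ε - X * m := by
    rw [div_le_iff₀ hp]
    have g1 := mul_nonneg (mul_nonneg (sub_nonneg.2 h2) hm.le) f1
    have g2 := mul_nonneg (mul_nonneg (sub_nonneg.2 h1) hm.le) f2
    have g3 := mul_nonneg (mul_nonneg (sub_nonneg.2 h1) (sub_nonneg.2 h2)) (sub_nonneg.2 hY)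
    have g4 := mul_nonneg g3 (sub_pos.2 hr).le
    have key : 0 ≤ (rh - rl) * (((c - Y) * ε - X * m) * (12 * m + ε) - J * ε ^ 2) := by linear_combination g1 + g2 + g4
    have := nonneg_of_mul_nonneg_right key (sub_pos.2 hr)
    linarith
  linarith

/-- Numeric certificate for a box. -/
structure Box (s κ c D2 plo phi A B C q q2 rl rh lam J : ℝ) : Prop where
  hA : 0 < A
  hB : 0 < B
  hC0 : 0 < C
  hC : κ ≤ C
  hC' : κ * C ≤ s ^ 2
  hq : 0 ≤ q
  hq' : κ * (A + B) - plo ≤ q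
  hq2 : 0 ≤ q2
  hq2' : κ * (C - A) + phi ≤ q2
  hrl : 0 < rl
  hr : rl < rh
  hlam : 0 ≤ lam
  hc : c ≤ J
  y3 : 0 ≤ s ^ 2 / C - κ
  a1 : κ + D2 / A ≤ c * rl - J * rl ^ 2 / (12 + rl)
  b1 : κ + D2 / A ≤ c * rh - J * rh ^ 2 / (12 + rh)
  a2 : q / B + (κ + s ^ 2 / B) * lam * rl ≤ c * rl - J * rl ^ 2 / (12 + rl)
  b2 : q / B + (κ + s ^ 2 / B) * lam * rh ≤ c * rh - J * rh ^ 2 / (12 + rh)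
  a3 : q2 / C + (s ^ 2 / C - κ) * lam * rl ≤ c * rl - J * rl ^ 2 / (12 + rl)
  b3 : q2 / C + (s ^ 2 / C - κ) * lam * rh ≤ c * rh - J * rh ^ 2 / (12 + rh)
  a4 : κ + A + (B + C) * lam * rl ≤ c * rl - J * rl ^ 2 / (12 + rl)
  b4 : κ + A + (B + C) * lam * rh ≤ c * rh - J * rh ^ 2 / (12 + rh)

lemma box_good {j cj θ ω s κ θlo γ D2 plo phi A B C q q2 rl rh lam ε m : ℝ} (hj : 0 ≤ j)
    (hθ : 0 < θ) (hexp : Real.exp (Real.sqrt 2 * θ) ≤ cj)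
    (hs : Real.exp (-ω) * Real.sinh θ = s) (hκ : Real.exp (-ω) * (Real.cosh θ - 1) = κ) (hs0 : 0 ≤ s) (hκ0 : 0 ≤ κ)
    (hlo : θlo ≤ θ) (hD : (θ - s) ^ 2 ≤ D2) (hpl : plo ≤ 2 * (θ - s) * s) (hph : 2 * (θ - s) * s ≤ phi)
    (hb : Box s κ (θlo - γ) D2 plo phi A B C q q2 rl rh lam (j * (3 / 4)))
    (hm : 0 < m) (h1 : rl * m ≤ ε) (h2 : ε ≤ rh * m) (hγ : Real.exp (-ω) + ω - 1 ≤ γ * ε) :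
    Good j cj ε m (lam * ε) := by
  have hε : 0 < ε := lt_of_lt_of_le (mul_pos hb.hrl hm) h1
  have hlam := hb.hlam
  refine ⟨θ, ω, (θlo - γ) * ε - j * (3 / 4) * ε ^ 2 / (12 * m + ε), A, B, C, q, q2, hθ, hexp, ?_, ?_⟩
  · rw [hs, hκ]
    have hB := hb.hB
    have hC0 := hb.hC0
    refine crit_mk hs0 hκ0 hm (mul_nonneg hlam hε.le) hb.hA hb.hB hb.hC0 hb.hC hb.hC' hb.hq (by linarith [hb.hq'])
      hb.hq2 (by linarith [hb.hq2']) hD ?_ ?_ ?_ ?_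
    · have := rate_ge (X := κ + D2 / A) (Y := 0) (c := θlo - γ) (J := j * (3 / 4)) hm hb.hrl hb.hr h1 h2 (by linarith [hb.hc]) (by linarith [hb.a1]) (by linarith [hb.b1])
      linarith
    · have hy : 0 ≤ (κ + s ^ 2 / B) * lam := by positivity
      have := rate_ge (Y := (κ + s ^ 2 / B) * lam) hm hb.hrl hb.hr h1 h2 (by linarith [hb.hc]) hb.a2 hb.b2
      linarith
    · have hy : 0 ≤ (s ^ 2 / C - κ) * lam := mul_nonneg hb.y3 hlam
      have := rate_ge (Y := (s ^ 2 / C - κ) * lam) hm hb.hrl hb.hr h1 h2 (by linarith [hb.hc]) hb.a3 hb.b3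
      linarith
    · have hy : 0 ≤ (B + C) * lam := by positivity
      have := rate_ge (Y := (B + C) * lam) hm hb.hrl hb.hr h1 h2 (by linarith [hb.hc]) hb.a4 hb.b4
      linarith
  · have : j * (3 / 4 * ε ^ 2 / (12 * m + ε)) = j * (3 / 4) * ε ^ 2 / (12 * m + ε) := by ring
    rw [this]
    nlinarith

end MJ
end PartI

section PartJ
open scoped BigOperators
open Matrix

namespace MJ

lemma log95_lo : (58778/100000 : ℝ) ≤ Real.log (9/5) := by
  rw [Real.le_log_iff_exp_le (by norm_num)]
  refine (Real.exp_bound' (x := 58778/100000) (by norm_num) (by norm_num) (n := 9) (by norm_num)).trans ?_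
  norm_num [Finset.sum_range_succ, Nat.factorial]

lemma log95_hi : Real.log (9/5) ≤ (58779/100000 : ℝ) := by
  rw [Real.log_le_iff_le_exp (by norm_num)]
  refine le_trans ?_ (Real.sum_le_exp_of_nonneg (x := 58779/100000) (by norm_num) 9)
  norm_num [Finset.sum_range_succ, Nat.factorial]

lemma log86 : -Real.log (43/50) ≤ (15083/100000 : ℝ) := by
  rw [← Real.log_inv, Real.log_le_iff_le_exp (by norm_num)]
  refine le_trans ?_ (Real.sum_le_exp_of_nonneg (x := 15083/100000) (by norm_num) 6)
  norm_num [Finset.sum_range_succ, Nat.factorial]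

lemma sqrt2_le : Real.sqrt 2 ≤ 17 / 12 := Real.sqrt_le_iff.2 (by norm_num)

lemma exp_sqrt2_log {u c : ℝ} (hu : 1 ≤ u) (hc : 0 < c) (h : u ^ 17 ≤ c ^ 12) : Real.exp (Real.sqrt 2 * Real.log u) ≤ c := by
  have h0 : 0 ≤ Real.log u := Real.log_nonneg hu
  have h1 : 17 * Real.log u ≤ 12 * Real.log c := by
    have := Real.log_le_log (by positivity) h
    rw [Real.log_pow, Real.log_pow] at this
    exact_mod_cast this
  rw [← Real.le_log_iff_exp_le hc]
  nlinarith [sqrt2_le]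

lemma exp95 : Real.exp (Real.sqrt 2 * Real.log (9/5)) ≤ 7 / 3 := exp_sqrt2_log (by norm_num) (by norm_num) (by norm_num)

lemma good_w1 {A B C q q2 rl rh lam ε m : ℝ}
    (hb : Box (28/45) (8/45) (58778/100000 - 0) (1187/1000000) (-21431/500000) (-1339/31250) A B C q q2 rl rh lam (2 * (3 / 4)))
    (hm : 0 < m) (h1 : rl * m ≤ ε) (h2 : ε ≤ rh * m) : Good 2 (7/3) ε m (lam * ε) := by
  have l1 := log95_lo
  have l2 := log95_hi
  refine box_good (θ := Real.log (9/5)) (ω := 0) (by norm_num) (by linarith) exp95 ?_ ?_ (by norm_num) (by norm_num) l1 ?_ ?_ ?_ hb hm h1 h2 ?_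
  · rw [Real.sinh_log (by norm_num)]; norm_num
  · rw [Real.cosh_log (by norm_num)]; norm_num
  · nlinarith
  · linarith
  · linarith
  · norm_num

lemma good_w2 {j cj γ el A B C q q2 rl rh lam ε m : ℝ} (hj : 0 ≤ j) (hcj : 7/3 ≤ cj) (hγ : 1083/100000 ≤ γ * el) (hγ0 : 0 ≤ γ)
    (hb : Box (602/1125) (172/1125) (58778/100000 - γ) (347/125000) (56367/1000000) (56379/1000000) A B C q q2 rl rh lam (j * (3 / 4)))
    (hm : 0 < m) (h1 : rl * m ≤ ε) (h2 : ε ≤ rh * m) (h3 : el ≤ ε) : Good j cj ε m (lam * ε) := by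
  have l1 := log95_lo
  have l2 := log95_hi
  have l3 := log86
  have he : Real.exp (-(-Real.log (43/50))) = 43/50 := by rw [neg_neg, Real.exp_log (by norm_num)]
  refine box_good (θ := Real.log (9/5)) (ω := -Real.log (43/50)) hj (by linarith) (exp95.trans hcj) ?_ ?_ (by norm_num) (by norm_num) l1 ?_ ?_ ?_ hb hm h1 h2 ?_
  · rw [he, Real.sinh_log (by norm_num)]; norm_num
  · rw [he, Real.cosh_log (by norm_num)]; norm_num
  · nlinarith
  · linarith
  · linarith
  · rw [he]; nlinarith

lemma box0 : Box (28/45) (8/45) (58778/100000 - 0) (1187/1000000) (-21431/500000) (-1339/31250) (17/2500) (7789/10000) (451/2500) (91271/500000) 0 (7/10) (4/5) (1/4) (2 * (3 / 4)) := by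
  constructor <;> norm_num

lemma box1 : Box (602/1125) (172/1125) (58778/100000 - (1083/50000)) (347/125000) (56367/1000000) (56379/1000000) (169/10000) (2137/10000) (5407/10000) 0 (136463/1000000) (7/10) (4/5) (5/16) (2 * (3 / 4)) := by
  constructor <;> norm_num

lemma box2 : Box (28/45) (8/45) (58778/100000 - 0) (1187/1000000) (-21431/500000) (-1339/31250) (11/2000) (461/625) (2059/10000) (174969/1000000) 0 (4/5) (19/20) (7/25) (2 * (3 / 4)) := by
  constructor <;> norm_num

lemma box3 : Box (602/1125) (172/1125) (58778/100000 - (967/50000)) (347/125000) (56367/1000000) (56379/1000000) (127/10000) (2487/10000) (1013/2000) 0 (32969/250000) (4/5) (19/20) (34527/100000) (2 * (3 / 4)) := by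
  constructor <;> norm_num

lemma box4 : Box (28/45) (8/45) (58778/100000 - 0) (1187/1000000) (-21431/500000) (-1339/31250) (11/2500) (3507/5000) (2311/10000) (84169/500000) 0 (19/20) (23/20) (3/10) (2 * (3 / 4)) := by
  constructor <;> norm_num

lemma box5 : Box (602/1125) (172/1125) (58778/100000 - (361/20000)) (347/125000) (56367/1000000) (56379/1000000) (123/10000) (2849/10000) (2337/5000) 0 (125959/1000000) (19/20) (23/20) (3/8) (2 * (3 / 4)) := by
  constructor <;> norm_num

lemma box6 : Box (602/1125) (172/1125) (58778/100000 - (361/25000)) (347/125000) (56367/1000000) (56379/1000000) (103/10000) (283/1000) (4743/10000) 0 (3183/25000) (19/20) (23/20) (18071/50000) (2 * (3 / 4)) := by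
  constructor <;> norm_num

lemma box7 : Box (28/45) (8/45) (58778/100000 - 0) (1187/1000000) (-21431/500000) (-1339/31250) (37/10000) (6773/10000) (619/2500) (163929/1000000) (8/15625) (23/20) (13/10) (3/10) (2 * (3 / 4)) := by
  constructor <;> norm_num

lemma box8 : Box (602/1125) (172/1125) (58778/100000 - (361/20000)) (347/125000) (56367/1000000) (56379/1000000) (1/125) (779/2500) (177/400) 0 (12281/100000) (23/20) (13/10) (39/100) (2 * (3 / 4)) := by
  constructor <;> norm_num

lemma box9 : Box (602/1125) (172/1125) (58778/100000 - (2777/200000)) (347/125000) (56367/1000000) (56379/1000000) (79/10000) (313/1000) (4411/10000) 0 (122611/1000000) (23/20) (13/10) (79/200) (2 * (3 / 4)) := by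
  constructor <;> norm_num

lemma box10 : Box (28/45) (8/45) (58778/100000 - 0) (1187/1000000) (-21431/500000) (-1339/31250) (33/10000) (3303/5000) (643/2500) (160889/1000000) (229/100000) (13/10) (7/5) (3/10) (2 * (3 / 4)) := by
  constructor <;> norm_num

lemma box11 : Box (602/1125) (172/1125) (58778/100000 - (361/20000)) (347/125000) (56367/1000000) (56379/1000000) (71/10000) (643/2000) (429/1000) 0 (120883/1000000) (13/10) (7/5) (39/100) (2 * (3 / 4)) := by
  constructor <;> norm_num

lemma box12 : Box (602/1125) (172/1125) (58778/100000 - (2777/200000)) (347/125000) (56367/1000000) (56379/1000000) (7/1250) (1721/5000) (509/1250) 0 (5889/50000) (13/10) (7/5) (1/2) (1 * (3 / 4)) := by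
  constructor <;> norm_num

lemma box13 : Box (28/45) (8/45) (58778/100000 - 0) (1187/1000000) (-21431/500000) (-1339/31250) (3/1000) (6373/10000) (551/2000) (78347/500000) (5597/1000000) (7/5) (17/10) (3/10) (2 * (3 / 4)) := by
  constructor <;> norm_num

lemma box14 : Box (602/1125) (172/1125) (58778/100000 - (361/20000)) (347/125000) (56367/1000000) (56379/1000000) (33/2500) (1683/5000) (41/100) 0 (58523/500000) (7/5) (17/10) (19/50) (2 * (3 / 4)) := by
  constructor <;> norm_num

lemma box15 : Box (602/1125) (172/1125) (58778/100000 - (57/4000)) (347/125000) (56367/1000000) (56379/1000000) (99/10000) (223/625) (3963/10000) 0 (1804/15625) (7/5) (17/10) (1/2) (1 * (3 / 4)) := by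
  constructor <;> norm_num

lemma box16 : Box (28/45) (8/45) (58778/100000 - 0) (1187/1000000) (-21431/500000) (-1339/31250) (43/5000) (6209/10000) (713/2500) (77387/500000) (3163/500000) (17/10) 2 (3/10) (2 * (3 / 4)) := by
  constructor <;> norm_num

lemma box17 : Box (602/1125) (172/1125) (58778/100000 - (361/20000)) (347/125000) (56367/1000000) (56379/1000000) (43/10000) (943/2500) (957/2500) (1961/1000000) (14281/125000) (17/10) 2 (1/2) (1 * (3 / 4)) := by
  constructor <;> norm_num

lemma box18 : Box (28/45) (8/45) (58778/100000 - 0) (1187/1000000) (-21431/500000) (-1339/31250) (21/10000) (3081/5000) (147/500) (76391/500000) (4523/500000) 2 (9/4) (29/100) (2 * (3 / 4)) := by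
  constructor <;> norm_num

lemma box19 : Box (602/1125) (172/1125) (58778/100000 - (18673/1000000)) (347/125000) (56367/1000000) (56379/1000000) (21/5000) (3881/10000) (3711/10000) (903/250000) (56237/500000) 2 (9/4) (1/2) (1 * (3 / 4)) := by
  constructor <;> norm_num

lemma box20 : Box (28/45) (8/45) (58778/100000 - 0) (1187/1000000) (-21431/500000) (-1339/31250) (11/5000) (78/125) (1437/5000) (154187/1000000) (1571/200000) (9/4) (5/2) (118519/500000) (2 * (3 / 4)) := by
  constructor <;> norm_num

lemma box21 : Box (602/1125) (172/1125) (58778/100000 - (361/20000)) (347/125000) (56367/1000000) (56379/1000000) (37/10000) (1943/5000) (737/2000) (903/250000) (112153/1000000) (9/4) (5/2) (88889/200000) (1 * (3 / 4)) := by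
  constructor <;> norm_num

/-- Outcome: a rate certificate with `j = 1` or `j = 2`. -/
def Res (ε m : ℝ) : Prop :=
  (∃ a, min (ε / 2) m ≤ a ∧ Good 1 3 ε m a) ∨
  (∃ a, min (min (ε/2) m * (2 * min (ε/2) m)) (min (ε/2) m * (1 - m + min (ε/2) m)) ≤ a ∧ Good 2 (7/3) ε m a ∧
    (ε < 1 ∨ ε < 2 * m))

lemma res1a {ε m : ℝ} (h : Good 1 3 ε m (1 / 2 * ε)) : Res ε m :=
  Or.inl ⟨_, (min_le_left _ _).trans (by linarith), h⟩

lemma res1b {ε m lam : ℝ} (hl : m ≤ lam * ε) (h : Good 1 3 ε m (lam * ε)) : Res ε m :=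
  Or.inl ⟨_, (min_le_right _ _).trans hl, h⟩

lemma res2a {ε m lam : ℝ} (hε : 0 < ε) (hm : 0 < m) (hl : ε ≤ 2 * lam) (h : Good 2 (7/3) ε m (lam * ε)) (hd : ε < 1 ∨ ε < 2 * m) : Res ε m := by
  refine Or.inr ⟨_, (min_le_left _ _).trans ?_, h, hd⟩
  have h1 := min_le_left (ε/2) m
  have h0 : 0 < min (ε/2) m := by positivity
  nlinarith

lemma res2b {ε m lam : ℝ} (hε : 0 < ε) (hm : 0 < m) (hl : 2 * m * m ≤ lam * ε) (h : Good 2 (7/3) ε m (lam * ε)) (hd : ε < 1 ∨ ε < 2 * m) : Res ε m := by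
  refine Or.inr ⟨_, (min_le_left _ _).trans ?_, h, hd⟩
  have h1 := min_le_right (ε/2) m
  have h0 : 0 < min (ε/2) m := by positivity
  nlinarith

lemma res2c {ε m lam : ℝ} (hε : 0 < ε) (hm : 0 < m) (hm1 : m ≤ 1) (hl : 1 - m + ε / 2 ≤ 2 * lam) (h : Good 2 (7/3) ε m (lam * ε)) (hd : ε < 1 ∨ ε < 2 * m) : Res ε m := by
  refine Or.inr ⟨_, (min_le_right _ _).trans ?_, h, hd⟩
  have h1 := min_le_left (ε/2) m
  have h0 : 0 < min (ε/2) m := by positivity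
  nlinarith

lemma res_mid {ε m : ℝ} (hε : 0 < ε) (hm : 0 < m) (hm1 : m ≤ 1) (hlo : (7/10) * m ≤ ε) (hhi : ε ≤ (5/2) * m) : Res ε m := by
  rcases le_total ε ((4/5) * m) with h | hlo'
  · rcases le_total ε (1/2) with he0 | he0
    · exact res2a hε hm (by linarith) (good_w1 box0 hm hlo h) (by first | (left; linarith) | (right; linarith))
    exact res2c hε hm hm1 (by linarith) (good_w2 (γ := (1083/50000)) (el := (1/2)) (by norm_num) (by norm_num) (by norm_num) (by norm_num) box1 hm hlo h (by linarith)) (by first | (left; linarith) | (right; linarith))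
  clear hlo
  rename' hlo' => hlo
  rcases le_total ε ((19/20) * m) with h | hlo'
  · rcases le_total ε (14/25) with he0 | he0
    · exact res2a hε hm (by linarith) (good_w1 box2 hm hlo h) (by first | (left; linarith) | (right; linarith))
    exact res2c hε hm hm1 (by linarith) (good_w2 (γ := (967/50000)) (el := (14/25)) (by norm_num) (by norm_num) (by norm_num) (by norm_num) box3 hm hlo h (by linarith)) (by first | (left; linarith) | (right; linarith))
  clear hlo
  rename' hlo' => hlo
  rcases le_total ε ((23/20) * m) with h | hlo'
  · rcases le_total ε (3/5) with he0 | he0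
    · exact res2a hε hm (by linarith) (good_w1 box4 hm hlo h) (by first | (left; linarith) | (right; linarith))
    rcases le_total ε (3/4) with he1 | he1
    · exact res2a hε hm (by linarith) (good_w2 (γ := (361/20000)) (el := (3/5)) (by norm_num) (by norm_num) (by norm_num) (by norm_num) box5 hm hlo h (by linarith)) (by first | (left; linarith) | (right; linarith))
    exact res2c hε hm hm1 (by linarith) (good_w2 (γ := (361/25000)) (el := (3/4)) (by norm_num) (by norm_num) (by norm_num) (by norm_num) box6 hm hlo h (by linarith)) (by first | (left; linarith) | (right; linarith))
  clear hlo
  rename' hlo' => hlo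
  rcases le_total ε ((13/10) * m) with h | hlo'
  · rcases le_total ε (3/5) with he0 | he0
    · exact res2a hε hm (by linarith) (good_w1 box7 hm hlo h) (by first | (left; linarith) | (right; linarith))
    rcases le_total ε (39/50) with he1 | he1
    · exact res2a hε hm (by linarith) (good_w2 (γ := (361/20000)) (el := (3/5)) (by norm_num) (by norm_num) (by norm_num) (by norm_num) box8 hm hlo h (by linarith)) (by first | (left; linarith) | (right; linarith))
    exact res2c hε hm hm1 (by linarith) (good_w2 (γ := (2777/200000)) (el := (39/50)) (by norm_num) (by norm_num) (by norm_num) (by norm_num) box9 hm hlo h (by linarith)) (by first | (left; linarith) | (right; linarith))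
  clear hlo
  rename' hlo' => hlo
  rcases le_total ε ((7/5) * m) with h | hlo'
  · rcases le_total ε (3/5) with he0 | he0
    · exact res2a hε hm (by linarith) (good_w1 box10 hm hlo h) (by first | (left; linarith) | (right; linarith))
    rcases le_total ε (39/50) with he1 | he1
    · exact res2a hε hm (by linarith) (good_w2 (γ := (361/20000)) (el := (3/5)) (by norm_num) (by norm_num) (by norm_num) (by norm_num) box11 hm hlo h (by linarith)) (by first | (left; linarith) | (right; linarith))
    exact res1a (good_w2 (γ := (2777/200000)) (el := (39/50)) (by norm_num) (by norm_num) (by norm_num) (by norm_num) box12 hm hlo h (by linarith))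
  clear hlo
  rename' hlo' => hlo
  rcases le_total ε ((17/10) * m) with h | hlo'
  · rcases le_total ε (3/5) with he0 | he0
    · exact res2a hε hm (by linarith) (good_w1 box13 hm hlo h) (by first | (left; linarith) | (right; linarith))
    rcases le_total ε (19/25) with he1 | he1
    · exact res2a hε hm (by linarith) (good_w2 (γ := (361/20000)) (el := (3/5)) (by norm_num) (by norm_num) (by norm_num) (by norm_num) box14 hm hlo h (by linarith)) (by first | (left; linarith) | (right; linarith))
    exact res1a (good_w2 (γ := (57/4000)) (el := (19/25)) (by norm_num) (by norm_num) (by norm_num) (by norm_num) box15 hm hlo h (by linarith))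
  clear hlo
  rename' hlo' => hlo
  rcases le_total ε (2 * m) with h | hlo'
  · rcases le_total ε (3/5) with he0 | he0
    · exact res2a hε hm (by linarith) (good_w1 box16 hm hlo h) (by first | (left; linarith) | (right; linarith))
    exact res1a (good_w2 (γ := (361/20000)) (el := (3/5)) (by norm_num) (by norm_num) (by norm_num) (by norm_num) box17 hm hlo h (by linarith))
  clear hlo
  rename' hlo' => hlo
  rcases le_total ε ((9/4) * m) with h | hlo'
  · rcases le_total ε (29/50) with he0 | he0
    · exact res2a hε hm (by linarith) (good_w1 box18 hm hlo h) (by first | (left; linarith) | (right; linarith))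
    exact res1a (good_w2 (γ := (18673/1000000)) (el := (29/50)) (by norm_num) (by norm_num) (by norm_num) (by norm_num) box19 hm hlo h (by linarith))
  clear hlo
  rename' hlo' => hlo
  have h := hhi
  rcases le_total ε (3/5) with he0 | he0
  · exact res2b hε hm (by nlinarith) (good_w1 box20 hm hlo h) (by first | (left; linarith) | (right; linarith))
  exact res1b (by linarith) (good_w2 (γ := (361/20000)) (el := (3/5)) (by norm_num) (by norm_num) (by norm_num) (by norm_num) box21 hm hlo h (by linarith))

end MJ
end PartJ

section PartK
open scoped BigOperators
open Matrix

namespace MJ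

lemma log178_lo : (7537/10000 : ℝ) ≤ Real.log (17/8) := by
  rw [Real.le_log_iff_exp_le (by norm_num)]
  refine (Real.exp_bound' (x := 7537/10000) (by norm_num) (by norm_num) (n := 9) (by norm_num)).trans ?_
  norm_num [Finset.sum_range_succ, Nat.factorial]

lemma log178_hi : Real.log (17/8) ≤ (7538/10000 : ℝ) := by
  rw [Real.log_le_iff_le_exp (by norm_num)]
  refine le_trans ?_ (Real.sum_le_exp_of_nonneg (x := 7538/10000) (by norm_num) 9)
  norm_num [Finset.sum_range_succ, Nat.factorial]

lemma res_big {ε m : ℝ} (hε : 0 < ε) (hm : 0 < m) (h : (5/2) * m ≤ ε) : Res ε m := by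
  refine Or.inl ⟨m, min_le_right _ _, ?_⟩
  have l1 := log178_lo
  have l2 := log178_hi
  refine ⟨Real.log (17/8), 0, 31/20 * m, 44/10000, 8593/10000, 3734/10000, 38/100, 0, by linarith,
    exp_sqrt2_log (by norm_num) (by norm_num) (by norm_num), ?_, ?_⟩
  · have e1 : Real.exp (-0) * Real.sinh (Real.log (17/8)) = 225/272 := by rw [Real.sinh_log (by norm_num)]; norm_num
    have e2 : Real.exp (-0) * (Real.cosh (Real.log (17/8)) - 1) = 81/272 := by rw [Real.cosh_log (by norm_num)]; norm_num
    rw [e1, e2]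
    refine crit_mk (D2 := 542/100000) (by norm_num) (by norm_num) hm hm.le (by norm_num) (by norm_num) (by norm_num) (by norm_num) (by norm_num)
      (by norm_num) (by linarith) (by norm_num) (by linarith) (by nlinarith) ?_ ?_ ?_ ?_ <;> linarith
  · have hp : 0 < 12 * m + ε := by positivity
    have : 3 / 4 * ε ^ 2 / (12 * m + ε) ≤ 7537/10000 * ε - 31/20 * m := by
      rw [div_le_iff₀ hp]
      nlinarith
    have h3 : 7537/10000 * ε ≤ Real.log (17/8) * ε := by gcongr
    norm_num
    linarith

lemma sinh_le_small {t : ℝ} (h0 : 0 ≤ t) (h1 : t ≤ 7/20) : Real.sinh t ≤ t * (1 + 17/100 * t ^ 2) ∧ Real.cosh t - 1 ≤ 507/1000 * t ^ 2 := by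
  have b1 := Real.exp_bound (x := t) (by rw [abs_of_nonneg h0]; linarith) (n := 5) (by norm_num)
  have b2 := Real.exp_bound (x := -t) (by rw [abs_neg, abs_of_nonneg h0]; linarith) (n := 5) (by norm_num)
  rw [abs_neg] at b2
  rw [abs_of_nonneg h0] at b1 b2
  norm_num [Finset.sum_range_succ, Nat.factorial] at b1 b2
  rw [abs_le] at b1 b2
  rw [Real.sinh_eq, Real.cosh_eq]
  have h2 : t ^ 2 ≤ 1/8 := by nlinarith
  have h4 : t ^ 4 ≤ 1/8 * t ^ 2 := by nlinarith [sq_nonneg t]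
  have h5 : t ^ 5 ≤ 1/8 * t ^ 3 := by nlinarith [pow_nonneg h0 3]
  have h6 : t ^ 5 ≤ 7/160 * t ^ 2 := by nlinarith [pow_nonneg h0 4]
  have e1 : (-t) ^ 3 = - t ^ 3 := by ring
  constructor <;> nlinarith [pow_nonneg h0 3]

set_option maxHeartbeats 1000000 in
lemma res_small {ε m : ℝ} (hε : 0 < ε) (hm : 0 < m) (hm1 : m ≤ 1) (h : ε ≤ (7/10) * m) : Res ε m := by
  obtain ⟨t, rfl⟩ : ∃ t, ε = 2 * t * m := ⟨ε / (2 * m), by field_simp⟩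
  have ht : 0 < t := by
    by_contra h'
    nlinarith
  have ht1 : t ≤ 7/20 := by
    by_contra h'
    nlinarith
  obtain ⟨b1, b2⟩ := sinh_le_small ht.le ht1
  have b3 : t < Real.sinh t := Real.self_lt_sinh_iff.2 ht
  have b4 : 0 ≤ Real.cosh t - 1 := by linarith [Real.one_le_cosh t]
  have hmin : min (2 * t * m / 2) m = t * m := by rw [min_eq_left (by nlinarith)]; ring
  set s := Real.sinh t with hs
  set κ := Real.cosh t - 1 with hκ
  have hs0 : 0 < s := by linarith
  have ht2 : 0 < t ^ 2 := by positivity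
  have hs1 : s ≤ 1021/1000 * t := by
    have : t * (1 + 17/100 * t ^ 2) ≤ t * (1021/1000) := mul_le_mul_of_nonneg_left (by nlinarith) ht.le
    linarith
  have hκt : κ ≤ 18/100 * t := by nlinarith
  have hA : s - t ≤ 17/100 * t ^ 3 := by nlinarith
  have hA2 : s - t ≤ 6/100 * t ^ 2 := by
    have : t ^ 3 = t * t ^ 2 := by ring
    nlinarith
  have hlam : 0 ≤ 2 * t ^ 2 * (1 - 74/100 * t) := by
    apply mul_nonneg (by positivity); linarith
  have hg : 1 ≤ (1 - 74/100 * t) * (1 + t) := by nlinarith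
  have hlt : t * (1 - 74/100 * t) ≤ 26/100 := by nlinarith
  have hlam2 : 2 * t ^ 2 * (1 - 74/100 * t) * t ≤ 52/100 * t ^ 2 := by
    have := mul_le_mul_of_nonneg_left hlt ht2.le
    linarith
  refine Or.inr ⟨2 * t ^ 2 * (1 - 74/100 * t) * m, ?_, ?_, Or.inr (by nlinarith)⟩
  · rw [hmin]
    rcases le_total (m * (1 + t)) 1 with hc | hc
    · refine (min_le_left _ _).trans ?_
      have : m ≤ 1 - 74/100 * t := by
        by_contra h'
        nlinarith
      have := mul_le_mul_of_nonneg_left this (show 0 ≤ 2 * t ^ 2 * m by positivity)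
      nlinarith
    · refine (min_le_right _ _).trans ?_
      have : (1 - m + t * m) ≤ 2 * t * (1 - 74/100 * t) := by
        have k1 : (1 - m + t * m) * (1 + t) ≤ 2 * t := by nlinarith
        have k2 : 2 * t ≤ 2 * t * (1 - 74/100 * t) * (1 + t) := by nlinarith
        exact le_of_mul_le_mul_right (k1.trans k2) (by linarith)
      have := mul_le_mul_of_nonneg_left this (show 0 ≤ t * m by positivity)
      nlinarith
  · refine ⟨t, 0, 3/2 * t ^ 2 * m, s - t, 9/10 * s, 7/10 * s, κ * (s - t + 9/10 * s) + 2 * (s - t) * s, κ * (7/10 * s), ht, ?_, ?_, ?_⟩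
    · refine le_trans (Real.exp_le_exp.2 ?_) exp95
      have := log95_lo
      gcongr
      linarith
    · have e0 : Real.exp (-0) = 1 := by norm_num
      rw [e0, one_mul, one_mul, ← hs, ← hκ]
      have hst : 0 < s - t := by linarith
      refine crit_mk (D2 := (s - t) ^ 2) hs0.le b4 hm (mul_nonneg hlam hm.le) hst (by positivity) (by positivity) (by linarith) (by nlinarith [mul_le_mul_of_nonneg_right hκt hs0.le, mul_pos hst hs0])
        (by positivity) (le_of_eq (by ring)) (by positivity) (by linarith [mul_nonneg b4 hst.le, mul_pos hst hs0]) (le_of_eq (by ring)) ?_ ?_ ?_ ?_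
      · have : (s - t) ^ 2 / (s - t) = s - t := by field_simp
        rw [this]
        have : κ + (s - t) ≤ 3/2 * t ^ 2 := by linarith
        nlinarith
      · have e1 : (κ * (s - t + 9/10 * s) + 2 * (s - t) * s) / (9/10 * s) = κ + (s - t) * (κ / s + 2) * (10/9) := by
          field_simp; ring
        have e2 : s ^ 2 / (9/10 * s) = 10/9 * s := by field_simp
        rw [e1, e2]
        have k0 : κ / s ≤ 18/100 := by
          rw [div_le_iff₀ hs0]; linarith
        have k0' : 0 ≤ κ / s := by positivity
        have k1 : (s - t) * (κ / s + 2) * (10/9) ≤ 15/100 * t ^ 2 := by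
          have : (s - t) * (κ / s + 2) ≤ (6/100 * t ^ 2) * (18/100 + 2) := by gcongr
          linarith
        have k2 : (κ + 10/9 * s) * (2 * t ^ 2 * (1 - 74/100 * t)) ≤ 7/10 * t ^ 2 := by
          have : κ + 10/9 * s ≤ 1325/1000 * t := by linarith
          have := mul_le_mul_of_nonneg_right this hlam
          linarith
        have : κ + (s - t) * (κ / s + 2) * (10/9) + (κ + 10/9 * s) * (2 * t ^ 2 * (1 - 74/100 * t)) ≤ 3/2 * t ^ 2 := by linarith
        have := mul_le_mul_of_nonneg_right this hm.le
        linarith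
      · have e1 : κ * (7/10 * s) / (7/10 * s) = κ := by field_simp
        have e2 : s ^ 2 / (7/10 * s) = 10/7 * s := by field_simp
        rw [e1, e2]
        have k2 : (10/7 * s - κ) * (2 * t ^ 2 * (1 - 74/100 * t)) ≤ 8/10 * t ^ 2 := by
          have : 10/7 * s - κ ≤ 146/100 * t := by linarith
          have := mul_le_mul_of_nonneg_right this hlam
          linarith
        have : κ + (10/7 * s - κ) * (2 * t ^ 2 * (1 - 74/100 * t)) ≤ 3/2 * t ^ 2 := by linarith
        have := mul_le_mul_of_nonneg_right this hm.le
        linarith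
      · have k2 : (9/10 * s + 7/10 * s) * (2 * t ^ 2 * (1 - 74/100 * t)) ≤ 9/10 * t ^ 2 := by
          have : 9/10 * s + 7/10 * s ≤ 164/100 * t := by linarith
          have := mul_le_mul_of_nonneg_right this hlam
          linarith
        have : κ + (s - t) + (9/10 * s + 7/10 * s) * (2 * t ^ 2 * (1 - 74/100 * t)) ≤ 3/2 * t ^ 2 := by linarith
        have := mul_le_mul_of_nonneg_right this hm.le
        linarith
    · have hp : 0 < 12 * m + 2 * t * m := by positivity
      have : 3 / 4 * (2 * t * m) ^ 2 / (12 * m + 2 * t * m) ≤ 1/4 * t ^ 2 * m := by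
        rw [div_le_iff₀ hp]
        have : 0 ≤ t ^ 3 * m ^ 2 := by positivity
        nlinarith
      norm_num
      nlinarith

lemma res_all {ε m : ℝ} (hε : 0 < ε) (hm : 0 < m) (hm1 : m ≤ 1) : Res ε m := by
  rcases le_total ε ((7/10) * m) with h | h
  · exact res_small hε hm hm1 h
  rcases le_total ε ((5/2) * m) with h' | h'
  · exact res_mid hε hm hm1 h h'
  · exact res_big hε hm h'

end MJ
end PartK

section PartM
open scoped BigOperators
open Matrix

namespace MJ

section
variable {n : ℕ}

lemma expo_eq {N ε m α : ℝ} (hε : 0 < ε) (hm : 0 < m) (hα : 0 < α) :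
    -(N * ε ^ 2 / 8) / (2 * m * α + ε * α / 6) = -(N / α * (3 / 4 * ε ^ 2 / (12 * m + ε))) := by
  field_simp
  ring

lemma sum_pathWeight_le (P : Matrix (Fin n) (Fin n) ℝ) (hP : RowStochastic P) (pi0 : Fin n → ℝ) (h0 : IsProbVec pi0)
    (Ev : Set (Fin (0+1) → Fin n)) : pathProb 0 P pi0 Ev ≤ 1 := by
  have h : ∑ x : Fin (0+1) → Fin n, pathWeight 0 P pi0 x = 1 := by
    simp only [pathWeight, Finset.univ_eq_empty, Finset.prod_empty, mul_one]
    rw [← h0.2]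
    exact Fintype.sum_equiv (Equiv.funUnique (Fin 1) (Fin n)) _ _ (fun x => rfl)
  rw [← h]
  exact Finset.sum_le_sum fun x _ => Set.indicator_le_self' (fun _ _ => pathWeight_nonneg P hP pi0 h0 _) _

lemma bound_zero (hn : 0 < n) (P : Matrix (Fin n) (Fin n) ℝ) (hP : RowStochastic P) (pi0 : Fin n → ℝ) (h0 : IsProbVec pi0)
    (Ev : Set (Fin (0+1) → Fin n)) (τ : ℕ) (D ε : ℝ) :
    pathProb 0 P pi0 Ev ≤ 2 * ((τ:ℝ) + 1) * n * Real.exp (-(((0:ℕ):ℝ) * ε ^ 2 / 8) / D) := by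
  refine (sum_pathWeight_le P hP pi0 h0 Ev).trans ?_
  have : (1:ℝ) ≤ n := by exact_mod_cast hn
  have h2 : (0:ℝ) ≤ τ := by positivity
  simp
  nlinarith

lemma tau_pos (P : Matrix (Fin n) (Fin n) ℝ) (piv : Fin n → ℝ) (hs : IsStationary P piv) (hn2 : 2 ≤ n) (i0 : Fin n)
    (η ε m : ℝ) (hi0 : piv i0 = m) (hη : η ≤ ε / 2)
    (h : ∀ k, (1/2) * ∑ j, |(P ^ 0) k j - piv j| ≤ η) : 1 ≤ ε ∧ 2 * m ≤ ε := by
  have key : ∀ k, 1 - piv k ≤ η := by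
    intro k
    refine le_trans ?_ (h k)
    have e1 : |(P ^ 0) k k - piv k| + ∑ j ∈ Finset.univ.erase k, |(P ^ 0) k j - piv j| = ∑ j, |(P ^ 0) k j - piv j| :=
      Finset.add_sum_erase _ (fun j => |(P ^ 0) k j - piv j|) (Finset.mem_univ k)
    have e2 : piv k + ∑ j ∈ Finset.univ.erase k, piv j = 1 := by
      rw [Finset.add_sum_erase _ _ (Finset.mem_univ k), hs.1.2]
    have e3 : ∑ j ∈ Finset.univ.erase k, |(P ^ 0) k j - piv j| = ∑ j ∈ Finset.univ.erase k, piv j := by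
      refine Finset.sum_congr rfl fun j hj => ?_
      rw [pow_zero, one_apply_ne (Finset.ne_of_mem_erase hj).symm, zero_sub, abs_neg, abs_of_nonneg (hs.1.1 j)]
    have e4 : 1 - piv k ≤ |(P ^ 0) k k - piv k| := by
      rw [pow_zero, one_apply_eq]; exact le_abs_self _
    linarith
  haveI : Nontrivial (Fin n) := Fin.nontrivial_iff_two_le.2 hn2
  obtain ⟨k, hk⟩ := exists_ne i0
  have h2 : piv k + piv i0 ≤ 1 := by
    rw [← hs.1.2, ← Finset.sum_pair hk]
    exact Finset.sum_le_sum_of_subset_of_nonneg (Finset.subset_univ _) (fun _ _ _ => hs.1.1 _)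
  have k1 := key k
  have k2 := key i0
  constructor <;> linarith

lemma spec_one {N : ℕ} (hN : 0 < N) (P : Matrix (Fin 1) (Fin 1) ℝ) (hP : RowStochastic P) (piv : Fin 1 → ℝ)
    (hs : IsStationary P piv) (x : Fin (N+1) → Fin 1) : spec (empF x - Matrix.diagonal piv * P) ≤ 0 := by
  have h1 : piv 0 = 1 := by simpa using hs.1.2
  have h2 : P 0 0 = 1 := by simpa using hP.2 0
  have hN' : (N:ℝ) ≠ 0 := by positivity
  have : empF x - Matrix.diagonal piv * P = 0 := by
    ext i j
    obtain rfl : i = 0 := Subsingleton.elim _ _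
    obtain rfl : j = 0 := Subsingleton.elim _ _
    have hc : countTrans x 0 0 = N := by
      unfold countTrans
      rw [Finset.filter_true_of_mem (fun t _ => ⟨Subsingleton.elim _ _, Subsingleton.elim _ _⟩)]
      simp
    simp [empF, hc, h1, h2, hN']
  rw [this]
  refine Real.sSup_nonpos ?_
  rintro c ⟨y, -, rfl⟩
  simp [l2]

lemma part1 {N : ℕ} (hn : 0 < n) (hN : 0 < N)
    (P : Matrix (Fin n) (Fin n) ℝ) (piv pi0 : Fin n → ℝ)
    (hP : RowStochastic P) (hs : IsStationary P piv) (h0 : IsProbVec pi0)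
    (m ε : ℝ) (hε : 0 < ε) (hm : 0 < m) (hm1 : m ≤ 1) (i0 : Fin n) (hi0 : piv i0 = m) (hpm : ∀ i, piv i ≤ m)
    (τ : ℕ) (hτ : ∀ k, (1/2) * ∑ j, |(P ^ τ) k j - piv j| ≤ min (ε/2) m) :
    pathProb N P pi0 {x | ε ≤ spec (empF x - Matrix.diagonal piv * P)}
        ≤ 2 * ((τ:ℝ) + 1) * n * Real.exp (-(N * ε ^ 2 / 8) / (2 * m * ((τ:ℝ) + 1) + ε * ((τ:ℝ) + 1) / 6)) := by
  have hα : (0:ℝ) < (τ:ℝ) + 1 := by positivity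
  have hτ0 : (0:ℝ) ≤ τ := by positivity
  have hn0 : (0:ℝ) ≤ n := by positivity
  have hN0 : (0:ℝ) ≤ N := by positivity
  rw [expo_eq hε hm hα]
  rcases res_all hε hm hm1 with ⟨a, ha, θ, ω, L, A, B, C, q, q2, hθ, hex, hcr, hrate⟩ |
    ⟨a, ha, ⟨θ, ω, L, A, B, C, q, q2, hθ, hex, hcr, hrate⟩, hd⟩
  · refine (spec_tail P hP piv pi0 hs h0 τ hθ hε hpm hm.le (fun k => (hτ k).trans ha) hcr hN).trans ?_
    have p1 : (1 + τ * Real.exp (Real.sqrt 2 * θ)) / ((τ:ℝ) + 1) ≤ τ + 1 := by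
      rw [div_le_iff₀ hα]
      have h1 := mul_le_mul_of_nonneg_left hex hτ0
      have h2 : (τ:ℝ) ≤ τ ^ 2 := by exact_mod_cast (Nat.le_self_pow two_ne_zero τ)
      nlinarith
    have p2 : Real.exp (-(N / ((τ:ℝ) + 1) * (θ * ε - (L + (Real.exp (-ω) + ω - 1))))) ≤
        Real.exp (-(N / ((τ:ℝ) + 1) * (3 / 4 * ε ^ 2 / (12 * m + ε)))) := by
      refine Real.exp_le_exp.2 (neg_le_neg (mul_le_mul_of_nonneg_left ?_ (by positivity)))
      linarith
    calc _ ≤ (((τ:ℝ) + 1) * (2 * n)) * Real.exp (-(N / ((τ:ℝ) + 1) * (3 / 4 * ε ^ 2 / (12 * m + ε)))) := by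
          refine mul_le_mul (mul_le_mul_of_nonneg_right p1 (by positivity)) p2 (Real.exp_pos _).le (by positivity)
      _ = _ := by ring
  · rcases Nat.lt_or_ge n 2 with hn2 | hn2
    · obtain rfl : n = 1 := by omega
      have : {x : Fin (N+1) → Fin 1 | ε ≤ spec (empF x - Matrix.diagonal piv * P)} = ∅ := by
        ext x
        simp only [Set.mem_setOf_eq, Set.mem_empty_iff_false, iff_false, not_le]
        exact lt_of_le_of_lt (spec_one hN P hP piv hs x) hε
      rw [this]
      simp only [pathProb, Set.indicator_empty, Finset.sum_const_zero]
      positivity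
    have hτ1 : (1:ℝ) ≤ τ := by
      rcases Nat.eq_zero_or_pos τ with h | h
      · exfalso
        subst h
        have := tau_pos P piv hs hn2 i0 _ ε m hi0 (min_le_left _ _) hτ
        rcases hd with h | h <;> linarith
      · exact_mod_cast h
    have htv : ∀ k, (1/2) * ∑ i, |(P ^ (2 * τ + 1)) k i - piv i| ≤ a := fun k =>
      (tv_two P hP piv hs τ (2 * τ + 1) (by omega) _ m i0 hi0 (by positivity) (min_le_right _ _) hτ k).trans ha
    refine (spec_tail P hP piv pi0 hs h0 (2 * τ + 1) hθ hε hpm hm.le htv hcr hN).trans ?_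
    push_cast
    have e0 : (2 * (τ:ℝ) + 1 + 1) = 2 * ((τ:ℝ) + 1) := by ring
    rw [e0]
    have p1 : (1 + (2 * (τ:ℝ) + 1) * Real.exp (Real.sqrt 2 * θ)) / (2 * ((τ:ℝ) + 1)) ≤ τ + 1 := by
      rw [div_le_iff₀ (by positivity)]
      have h1 := mul_le_mul_of_nonneg_left hex (show 0 ≤ 2 * (τ:ℝ) + 1 by positivity)
      nlinarith
    have p2 : Real.exp (-(N / (2 * ((τ:ℝ) + 1)) * (θ * ε - (L + (Real.exp (-ω) + ω - 1))))) ≤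
        Real.exp (-(N / ((τ:ℝ) + 1) * (3 / 4 * ε ^ 2 / (12 * m + ε)))) := by
      refine Real.exp_le_exp.2 (neg_le_neg ?_)
      calc N / ((τ:ℝ) + 1) * (3 / 4 * ε ^ 2 / (12 * m + ε)) = N / (2 * ((τ:ℝ) + 1)) * (2 * (3 / 4 * ε ^ 2 / (12 * m + ε))) := by
            field_simp
        _ ≤ _ := by
            refine mul_le_mul_of_nonneg_left ?_ (by positivity)
            linarith
    calc _ ≤ (((τ:ℝ) + 1) * (2 * n)) * Real.exp (-(N / ((τ:ℝ) + 1) * (3 / 4 * ε ^ 2 / (12 * m + ε)))) := by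
          refine mul_le_mul (mul_le_mul_of_nonneg_right p1 (by positivity)) p2 (Real.exp_pos _).le (by positivity)
      _ = _ := by ring

end
end MJ
end PartM

section PartO
open scoped BigOperators
open Matrix

namespace MJ

section
variable {n : ℕ}

lemma phi_le {t : ℝ} (h0 : 0 ≤ t) (h1 : t ≤ 1) : (Real.exp t - 1 - t) * (1 - t / 3) ≤ t ^ 2 / 2 := by
  have b := Real.exp_bound' h0 h1 (n := 4) (by norm_num)
  norm_num [Finset.sum_range_succ, Nat.factorial] at b
  have : Real.exp t - 1 - t ≤ t ^ 2 / 2 + t ^ 3 / 6 + t ^ 4 / 18 := by nlinarith [pow_nonneg h0 4]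
  have := mul_le_mul_of_nonneg_right this (show 0 ≤ 1 - t / 3 by linarith)
  nlinarith [pow_nonneg h0 5]

lemma scalar_rate {ε m η : ℝ} (hε : 0 < ε) (hm : 0 < m) (h1 : η ≤ ε / 2) (h2 : η ≤ m) :
    ∃ θ, 0 < θ ∧ Real.exp θ ≤ 3 ∧
      m * (Real.exp θ - 1 - θ) + η * (Real.exp θ - 1) + 3 / 4 * ε ^ 2 / (12 * m + ε) ≤ θ * ε := by
  have hp : 0 < 12 * m + ε := by positivity
  have e1 : Real.exp 1 ≤ 2.7182818286 := Real.exp_one_lt_d9.le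
  rcases le_total ε (2 * m) with h | h
  · refine ⟨3 * ε / (12 * m + ε), by positivity, ?_, ?_⟩
    · refine le_trans (Real.exp_le_exp.2 (?_ : _ ≤ (1:ℝ))) (by linarith)
      rw [div_le_one hp]; linarith
    set D := 12 * m + ε with hD
    set t := 3 * ε / D with ht
    have htD : t * D = 3 * ε := by rw [ht]; field_simp
    have ht0 : 0 < t := by positivity
    have ht1 : t ≤ 1 := by rw [ht, div_le_one hp]; linarith
    have hφ := phi_le ht0.le ht1
    set φ := Real.exp t - 1 - t with hφd
    have hφ0 : 0 ≤ φ := by linarith [Real.add_one_le_exp t]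
    have e2 : 3 / 4 * ε ^ 2 / D = t * ε / 4 := by rw [ht]; field_simp
    have e3 : 1 - t / 3 = 12 * m / D := by rw [ht, hD]; field_simp; ring
    have e4 : m * φ ≤ t * ε / 8 := by
      rw [e3] at hφ
      have : φ * (12 * m / D) * D ≤ t ^ 2 / 2 * D := mul_le_mul_of_nonneg_right hφ hp.le
      have e5 : φ * (12 * m / D) * D = 12 * (m * φ) := by field_simp
      have e6 : t ^ 2 / 2 * D = t * (3 * ε) / 2 := by rw [← htD]; ring
      linarith
    have e7 : η * (Real.exp t - 1) ≤ ε / 2 * t + m * φ := by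
      have : Real.exp t - 1 = t + φ := by rw [hφd]; ring
      rw [this]
      nlinarith
    rw [e2]
    linarith
  · have hgen : ∀ θ E : ℝ, 0 ≤ θ → Real.exp θ ≤ E → 1 ≤ E → 0 ≤ (θ * ε - m * (2 * E - 2 - θ)) * (12 * m + ε) - 3 / 4 * ε ^ 2 →
        m * (Real.exp θ - 1 - θ) + η * (Real.exp θ - 1) + 3 / 4 * ε ^ 2 / (12 * m + ε) ≤ θ * ε := by
      intro θ E hθ hE h1E hh
      have k1 : 3 / 4 * ε ^ 2 / (12 * m + ε) ≤ θ * ε - m * (2 * E - 2 - θ) := by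
        rw [div_le_iff₀ hp]; linarith
      have k2 : η * (Real.exp θ - 1) ≤ m * (Real.exp θ - 1) :=
        mul_le_mul_of_nonneg_right h2 (by linarith [Real.add_one_le_exp θ])
      have k3 := mul_le_mul_of_nonneg_left hE hm.le
      nlinarith
    rcases le_total ε (5 * m) with h5 | h5
    · have e : Real.exp (3/7) ≤ 15351/10000 := by
        refine (Real.exp_bound' (x := 3/7) (by norm_num) (by norm_num) (n := 8) (by norm_num)).trans ?_
        norm_num [Finset.sum_range_succ, Nat.factorial]
      refine ⟨3/7, by norm_num, by linarith, hgen _ _ (by norm_num) e (by norm_num) ?_⟩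
      nlinarith [mul_nonneg (sub_nonneg.2 h) (sub_nonneg.2 h5), mul_nonneg (sub_nonneg.2 h) hm.le, mul_nonneg (sub_nonneg.2 h5) hm.le]
    · refine ⟨1, by norm_num, by linarith, hgen _ _ (by norm_num) e1 (by norm_num) ?_⟩
      nlinarith [mul_nonneg (sub_nonneg.2 h5) (sub_nonneg.2 h5), mul_nonneg (sub_nonneg.2 h5) hm.le, mul_pos hm hm]

lemma entry_le (v : Fin n → ℝ) (hv : ∑ i, v i = 0) (η : ℝ) (h : (1/2) * ∑ i, |v i| ≤ η) (k : Fin n) : |v k| ≤ η := by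
  have e1 := Finset.add_sum_erase Finset.univ v (Finset.mem_univ k)
  have e2 := Finset.add_sum_erase Finset.univ (fun i => |v i|) (Finset.mem_univ k)
  have e3 := Finset.abs_sum_le_sum_abs v (Finset.univ.erase k)
  have e4 : |v k| = |∑ i ∈ Finset.univ.erase k, v i| := by
    rw [← abs_neg]; congr 1; linarith
  linarith

lemma sum_ind_empPi {N : ℕ} (hN : 0 < N) (x : Fin (N+1) → Fin n) (k : Fin n) :
    ∑ t : Fin N, (if x t.castSucc = k then (1:ℝ) else 0) = N * empPi x k := by
  have hN' : (N:ℝ) ≠ 0 := by positivity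
  rw [empPi, countState, Finset.sum_boole]
  field_simp

lemma exp_step {σ θ p π η m : ℝ} (hσ : σ = 1 ∨ σ = -1) (hθ : 0 < θ) (hp : |p - π| ≤ η)
    (hπ : 0 ≤ π) (hπm : π ≤ m) :
    p * Real.exp (σ * θ * (1 - π)) + (1 - p) * Real.exp (σ * θ * (0 - π)) ≤
      Real.exp (m * (Real.exp θ - 1 - θ) + η * (Real.exp θ - 1)) := by
  have hη : 0 ≤ η := (abs_nonneg _).trans hp
  rw [abs_le] at hp
  have e0 : p * Real.exp (σ * θ * (1 - π)) + (1 - p) * Real.exp (σ * θ * (0 - π)) =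
      Real.exp (-(σ * θ * π)) * (p * (Real.exp (σ * θ) - 1) + 1) := by
    rw [show σ * θ * (1 - π) = σ * θ + -(σ * θ * π) by ring, show σ * θ * (0 - π) = -(σ * θ * π) by ring, Real.exp_add]
    ring
  rw [e0]
  refine le_trans (mul_le_mul_of_nonneg_left (Real.add_one_le_exp _) (Real.exp_pos _).le) ?_
  rw [← Real.exp_add]
  refine Real.exp_le_exp.2 ?_
  have a1 := Real.add_one_le_exp θ
  have a2 := Real.add_one_le_exp (-θ)
  have a3 : 0 ≤ m * (Real.exp θ - 1 - θ) - π * (Real.exp θ - 1 - θ) := by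
    rw [← sub_mul]; exact mul_nonneg (by linarith) (by linarith)
  rcases hσ with rfl | rfl
  · have : (p - π) * (Real.exp (1 * θ) - 1) ≤ η * (Real.exp (1 * θ) - 1) :=
      mul_le_mul_of_nonneg_right hp.2 (by rw [one_mul]; linarith)
    rw [one_mul] at *
    linarith
  · rw [neg_one_mul]
    have hsn := (Real.self_le_sinh_iff (x := θ)).2 hθ.le
    rw [Real.sinh_eq] at hsn
    have a4 : Real.exp (-θ) ≤ 1 := Real.exp_le_one_iff.2 (by linarith)
    have a5 : (π - p) * (1 - Real.exp (-θ)) ≤ η * (1 - Real.exp (-θ)) :=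
      mul_le_mul_of_nonneg_right (by linarith) (by linarith)
    have a6 : η * (1 - Real.exp (-θ)) ≤ η * (Real.exp θ - 1) :=
      mul_le_mul_of_nonneg_left (by linarith) hη
    have a7 : π * (θ - 1 + Real.exp (-θ)) ≤ π * (Real.exp θ - 1 - θ) := mul_le_mul_of_nonneg_left (by linarith) hπ
    linarith

lemma scalar_tail {N : ℕ} (hN : 0 < N)
    (P : Matrix (Fin n) (Fin n) ℝ) (piv pi0 : Fin n → ℝ)
    (hP : RowStochastic P) (hs : IsStationary P piv) (h0 : IsProbVec pi0)
    (m ε η : ℝ) (hη : 0 ≤ η) (hm : 0 < m) (hpm : ∀ i, piv i ≤ m)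
    (T : ℕ) (hτ : ∀ k, (1/2) * ∑ j, |(P ^ T) k j - piv j| ≤ η) (σ θ : ℝ) (hσ : σ = 1 ∨ σ = -1) (hθ : 0 < θ) (k : Fin n) :
    pathProb N P pi0 {x | ε ≤ σ * (empPi x k - piv k)} ≤ (1 + T * Real.exp θ) / (T + 1) *
      Real.exp (-(N / (T + 1) * (θ * ε - (m * (Real.exp θ - 1 - θ) + η * (Real.exp θ - 1))))) := by
  have hT : (0:ℝ) < T + 1 := by positivity
  have a1 := Real.add_one_le_exp θ
  have hpk1 : piv k ≤ 1 := by
    rw [← hs.1.2]; exact Finset.single_le_sum (fun i _ => hs.1.1 i) (Finset.mem_univ k)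
  have hpk0 := hs.1.1 k
  have := tail_bound (E := ℝ) P hP pi0 h0 (fun i _ => σ * θ * ((if i = k then (1:ℝ) else 0) - piv k)) Real.exp (fun _ => True) trivial
    (fun _ _ _ _ => trivial) (fun H => (Real.exp_pos H).le) T (m * (Real.exp θ - 1 - θ) + η * (Real.exp θ - 1)) (Real.exp θ)
    (add_nonneg (mul_nonneg hm.le (by linarith)) (mul_nonneg hη (by linarith))) ?_ ?_ (by linarith) ?_ N
    {x | ε ≤ σ * (empPi x k - piv k)} (θ * ε) ?_
  · simpa using this
  · intro H
    have := convexOn_exp.map_sum_le (t := Finset.univ) (w := fun _ : Fin (T+1) => 1 / ((T:ℝ)+1)) (p := H)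
      (fun _ _ => by positivity) (by simp; field_simp) (fun _ _ => Set.mem_univ _)
    simpa using this
  · intro k' H _
    have e1 : ∀ i l, (P ^ T) k' i * P i l * Real.exp (H + σ * θ * ((if i = k then (1:ℝ) else 0) - piv k)) =
        P i l * ((P ^ T) k' i * Real.exp (σ * θ * ((if i = k then (1:ℝ) else 0) - piv k)) * Real.exp H) := by
      intro i l; rw [Real.exp_add]; ring
    simp only [e1, ← Finset.sum_mul, hP.2, one_mul]
    refine mul_le_mul_of_nonneg_right ?_ (Real.exp_pos _).le
    have e2 : ∀ i, (P ^ T) k' i * Real.exp (σ * θ * ((if i = k then (1:ℝ) else 0) - piv k)) =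
        (P ^ T) k' i * Real.exp (σ * θ * (0 - piv k)) + (if i = k then (P ^ T) k' i * (Real.exp (σ * θ * (1 - piv k)) - Real.exp (σ * θ * (0 - piv k))) else 0) := by
      intro i; split_ifs <;> ring
    simp only [e2, Finset.sum_add_distrib, ← Finset.sum_mul, (pow_stoch P hP T).2, Finset.sum_ite_eq', Finset.mem_univ, if_true]
    have := exp_step (p := (P ^ T) k' k) hσ hθ (entry_le (fun i => (P ^ T) k' i - piv i) (row_zero P hP piv hs T k') η (hτ k') k) hpk0 (hpm k)
    linarith
  · intro i l H _
    rw [Real.exp_add, mul_comm]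
    refine mul_le_mul_of_nonneg_right (Real.exp_le_exp.2 ?_) (Real.exp_pos _).le
    rcases hσ with rfl | rfl <;> split_ifs <;> nlinarith
  · intro x hx
    refine Real.exp_le_exp.2 ?_
    rw [← Finset.mul_sum, Finset.sum_sub_distrib, sum_ind_empPi hN]
    simp only [Finset.sum_const, Finset.card_univ, Fintype.card_fin, nsmul_eq_mul, smul_eq_mul]
    have hx' : ε ≤ σ * (empPi x k - piv k) := hx
    calc N / ((T:ℝ) + 1) * (θ * ε) ≤ N / ((T:ℝ) + 1) * (θ * (σ * (empPi x k - piv k))) := by gcongr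
      _ = _ := by ring

lemma pathProb_mono {N : ℕ} (P : Matrix (Fin n) (Fin n) ℝ) (hP : RowStochastic P) (pi0 : Fin n → ℝ) (h0 : IsProbVec pi0)
    {ι : Type*} [Fintype ι] (Ev : Set (Fin (N+1) → Fin n)) (F : ι → Set (Fin (N+1) → Fin n)) (h : ∀ x ∈ Ev, ∃ i, x ∈ F i) :
    pathProb N P pi0 Ev ≤ ∑ i, pathProb N P pi0 (F i) := by
  unfold pathProb
  rw [Finset.sum_comm]
  refine Finset.sum_le_sum fun x _ => ?_
  have hnn : ∀ i, 0 ≤ (F i).indicator (pathWeight N P pi0) x := fun i =>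
    Set.indicator_nonneg (fun _ _ => pathWeight_nonneg P hP pi0 h0 _) _
  by_cases hx : x ∈ Ev
  · obtain ⟨i, hi⟩ := h x hx
    rw [Set.indicator_of_mem hx]
    calc pathWeight N P pi0 x = (F i).indicator (pathWeight N P pi0) x := (Set.indicator_of_mem hi _).symm
      _ ≤ _ := Finset.single_le_sum (f := fun i => (F i).indicator (pathWeight N P pi0) x) (fun i _ => hnn i) (Finset.mem_univ i)
  · rw [Set.indicator_of_notMem hx]
    exact Finset.sum_nonneg fun i _ => hnn i

lemma part2 {N : ℕ} (hn : 0 < n) (hN : 0 < N)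
    (P : Matrix (Fin n) (Fin n) ℝ) (piv pi0 : Fin n → ℝ)
    (hP : RowStochastic P) (hs : IsStationary P piv) (h0 : IsProbVec pi0)
    (m ε : ℝ) (hε : 0 < ε) (hm : 0 < m) (hpm : ∀ i, piv i ≤ m)
    (τ : ℕ) (hτ : ∀ k, (1/2) * ∑ j, |(P ^ τ) k j - piv j| ≤ min (ε/2) m) :
    pathProb N P pi0 {x | ε ≤ ⨆ i, |empPi x i - piv i|}
        ≤ 2 * ((τ:ℝ) + 1) * n * Real.exp (-(N * ε ^ 2 / 8) / (2 * m * ((τ:ℝ) + 1) + ε * ((τ:ℝ) + 1) / 6)) := by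
  have hα : (0:ℝ) < (τ:ℝ) + 1 := by positivity
  have hτ0 : (0:ℝ) ≤ τ := by positivity
  rw [expo_eq hε hm hα]
  obtain ⟨θ, hθ, hex, hrate⟩ := scalar_rate hε hm (min_le_left (ε/2) m) (min_le_right (ε/2) m)
  haveI : Nonempty (Fin n) := ⟨⟨0, hn⟩⟩
  have hsub : ∀ x ∈ {x : Fin (N+1) → Fin n | ε ≤ ⨆ i, |empPi x i - piv i|}, ∃ i : Bool × Fin n,
      x ∈ (fun i : Bool × Fin n => {x : Fin (N+1) → Fin n | ε ≤ (if i.1 then (1:ℝ) else -1) * (empPi x i.2 - piv i.2)}) i := by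
    intro x hx
    obtain ⟨k, hk⟩ := exists_eq_ciSup_of_finite (f := fun i => |empPi x i - piv i|)
    have hx' : ε ≤ |empPi x k - piv k| := by
      have h1 : ε ≤ ⨆ i, |empPi x i - piv i| := hx
      rw [← hk] at h1
      exact h1
    rcases le_abs.1 hx' with h | h
    · exact ⟨(true, k), by simpa using h⟩
    · exact ⟨(false, k), by simpa using h⟩
  refine (pathProb_mono P hP pi0 h0 _ _ hsub).trans ?_
  have each : ∀ i : Bool × Fin n, pathProb N P pi0 {x : Fin (N+1) → Fin n | ε ≤ (if i.1 then (1:ℝ) else -1) * (empPi x i.2 - piv i.2)} ≤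
      ((τ:ℝ) + 1) * Real.exp (-(N / ((τ:ℝ) + 1) * (3 / 4 * ε ^ 2 / (12 * m + ε)))) := by
    rintro ⟨b, k⟩
    refine (scalar_tail hN P piv pi0 hP hs h0 m ε _ (by positivity) hm hpm τ hτ _ θ (by cases b <;> simp) hθ k).trans ?_
    have p1 : (1 + τ * Real.exp θ) / ((τ:ℝ) + 1) ≤ τ + 1 := by
      rw [div_le_iff₀ hα]
      have h1 := mul_le_mul_of_nonneg_left hex hτ0
      have h2 : (τ:ℝ) ≤ τ ^ 2 := by exact_mod_cast (Nat.le_self_pow two_ne_zero τ)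
      nlinarith
    refine mul_le_mul p1 (Real.exp_le_exp.2 (neg_le_neg (mul_le_mul_of_nonneg_left ?_ (by positivity)))) (Real.exp_pos _).le hα.le
    linarith
  refine (Finset.sum_le_sum fun i _ => each i).trans ?_
  simp
  exact le_of_eq (by ring)

end
end MJ
end PartO

open MJ in
/-- concentration of the empirical frequency matrix and state distribution. -/
theorem stmt8 {n N : ℕ} (hn : 0 < n)
    (P : Matrix (Fin n) (Fin n) ℝ) (piv pi0 : Fin n → ℝ)
    (hP : RowStochastic P) (hPe : Ergodic' P) (hpiv : IsStationary P piv)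
    (hpi0 : IsProbVec pi0)
    (pimax : ℝ) (hpimax : pimax = ⨆ i, piv i)
    (ε : ℝ) (hε : 0 < ε)
    (α : ℝ) (hα : α = (mixingTime P piv (min (ε / 2) pimax) : ℝ) + 1) :
    pathProb N P pi0 {x | ε ≤ spec (empF x - Matrix.diagonal piv * P)}
        ≤ 2 * α * n * Real.exp (-(N * ε ^ 2 / 8) / (2 * pimax * α + ε * α / 6)) ∧
    pathProb N P pi0 {x | ε ≤ ⨆ i, |empPi x i - piv i|}
        ≤ 2 * α * n * Real.exp (-(N * ε ^ 2 / 8) / (2 * pimax * α + ε * α / 6)) := by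
  haveI : Nonempty (Fin n) := ⟨⟨0, hn⟩⟩
  obtain ⟨i0, hi0⟩ := exists_eq_ciSup_of_finite (f := piv)
  rw [← hpimax] at hi0
  have hpm : ∀ i, piv i ≤ pimax := fun i => by
    rw [hpimax]; exact le_ciSup (Set.finite_range piv).bddAbove i
  have hm1 : pimax ≤ 1 := by
    rw [← hi0, ← hpiv.1.2]
    exact Finset.single_le_sum (fun i _ => hpiv.1.1 i) (Finset.mem_univ i0)
  have hm : 0 < pimax := by
    by_contra hc
    have hz : ∀ i, piv i = 0 := fun i => le_antisymm ((hpm i).trans (not_lt.1 hc)) (hpiv.1.1 i)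
    have h1 := hpiv.1.2
    simp [hz] at h1
  have hτ := mix_spec hn P hP hPe piv hpiv (min (ε / 2) pimax) (by positivity)
  rw [hα]
  rcases Nat.eq_zero_or_pos N with h | hN
  · subst h
    exact ⟨bound_zero hn P hP pi0 hpi0 _ _ _ _, bound_zero hn P hP pi0 hpi0 _ _ _ _⟩
  · exact ⟨part1 hn hN P piv pi0 hP hpiv hpi0 pimax ε hε hm hm1 i0 hi0 hpm _ hτ,
      part2 hn hN P piv pi0 hP hpiv hpi0 pimax ε hε hm hpm _ hτ⟩
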